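/- arXiv:1203.4132 — 2 statements merged into one kernel-verified Lean document; each statement's English description precedes it below -/
import Mathlib

section
/- Let the weights be θ_k = k, so that g_θ(t) = (1 − t)^{−1}. Then under the generalized Ewens measure, (K_{0n} − n^{1/2}) / (2^{−1/2} n^{1/4}) converges in distribution to a standard normal random variable as n → ∞. -/
open Filter Set Asymptotics MeasureTheory
open scoped Topology

noncomputable section

/-- `c_j(σ)`: the number of cycles of length `j` in the permutation `σ ∈ S_n`
(fixed points count as cycles of length 1). -/
def cycleCount (n j : ℕ) (σ : Equiv.Perm (Fin n)) : ℕ :=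
  if j = 1 then n - σ.support.card else σ.cycleType.count j

/-- `K_{0n}(σ) = Σ_{j=1}^n c_j(σ)`: the total number of cycles of `σ`. -/
def numCycles (n : ℕ) (σ : Equiv.Perm (Fin n)) : ℕ :=
  (n - σ.support.card) + σ.cycleType.card

/-- The unnormalized generalized Ewens weight `∏_{j=1}^n θ_j^{c_j(σ)}`. -/
def ewensWeight (θ : ℕ → ℝ) (n : ℕ) (σ : Equiv.Perm (Fin n)) : ℝ :=
  ∏ j ∈ Finset.Icc 1 n, θ j ^ cycleCount n j σ

/-- The normalization constant `h_n = (1/n!) Σ_σ ∏_j θ_j^{c_j(σ)}` of the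
generalized Ewens measure (equivalently, the `n`-th coefficient of `exp g_θ`). -/
def ewensH (θ : ℕ → ℝ) (n : ℕ) : ℝ :=
  (n.factorial : ℝ)⁻¹ * ∑ σ : Equiv.Perm (Fin n), ewensWeight θ n σ

open scoped Classical in
/-- Probability of an event under the generalized Ewens measure
`ℙ(σ) = (1/(h_n n!)) ∏_j θ_j^{c_j(σ)}`. -/
def ewensProb (θ : ℕ → ℝ) (n : ℕ) (p : Equiv.Perm (Fin n) → Prop) : ℝ :=
  (∑ σ ∈ Finset.univ.filter p, ewensWeight θ n σ) /
    ∑ σ : Equiv.Perm (Fin n), ewensWeight θ n σ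

/-- Expectation under the generalized Ewens measure. -/
def ewensExpect (θ : ℕ → ℝ) (n : ℕ) (f : Equiv.Perm (Fin n) → ℝ) : ℝ :=
  (∑ σ : Equiv.Perm (Fin n), f σ * ewensWeight θ n σ) /
    ∑ σ : Equiv.Perm (Fin n), ewensWeight θ n σ

/-- The coefficient sequence of `g_θ(t) = Σ_{k≥1} (θ_k/k) t^k`. -/
def thetaCoeff (θ : ℕ → ℝ) : ℕ → ℝ := fun k => if k = 0 then 0 else θ k / k

/-- `g_θ` as a function on the complex disc. -/
def gThetaC (θ : ℕ → ℝ) : ℂ → ℂ := fun z => ∑' k : ℕ, (thetaCoeff θ k : ℂ) * z ^ k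

/-- `g_θ` as a real function. -/
def gThetaR (θ : ℕ → ℝ) : ℝ → ℝ := fun t => ∑' k : ℕ, thetaCoeff θ k * t ^ k

/-- The standard normal cumulative distribution function. -/
def stdNormalCDF (x : ℝ) : ℝ :=
  ∫ t in Set.Iic x, Real.exp (-t ^ 2 / 2) / Real.sqrt (2 * Real.pi)

/-- `(K_{0n} - μ_n)/σ_n` converges in distribution to a standard normal random
variable, where `K_{0n}` is distributed according to the generalized Ewens
measure with weights `θ` (stated via pointwise convergence of the CDFs to the
continuous standard normal CDF). -/
def convergesToStdNormal (θ : ℕ → ℝ) (μ σ' : ℕ → ℝ) : Prop :=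
  ∀ x : ℝ, Tendsto
    (fun n => ewensProb θ n fun σ => ((numCycles n σ : ℝ) - μ n) / σ' n ≤ x)
    atTop (𝓝 (stdNormalCDF x))

theorem PowerSeries.coeff_sum_X_pow_pow {n : ℕ} (hn : 0 < n) (k : ℕ) :
    n * PowerSeries.coeff n ((∑ j ∈ Finset.Icc 1 n, (PowerSeries.X : PowerSeries ℝ) ^ j) ^ k) =
      k * n.choose k := by
  obtain rfl | ⟨d, rfl⟩ : k = 0 ∨ ∃ d, k = d + 1 := by
    cases k <;> simp
  · simp [PowerSeries.coeff_one, hn.ne']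
  have hgeom : (PowerSeries.X : PowerSeries ℝ) * PowerSeries.mk 1 =
      (∑ j ∈ Finset.Icc 1 n, (PowerSeries.X : PowerSeries ℝ) ^ j) +
        PowerSeries.X ^ (n + 1) * PowerSeries.mk 1 := by
    ext m
    rcases m with _ | m
    · simp only [PowerSeries.coeff_zero_X_mul, map_add, map_sum, PowerSeries.coeff_X_pow,
        PowerSeries.coeff_X_pow_mul', Finset.sum_ite_eq, Finset.mem_Icc]
      simp
    · rw [PowerSeries.coeff_succ_X_mul]
      simp only [map_add, map_sum, PowerSeries.coeff_X_pow, PowerSeries.coeff_X_pow_mul',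
        PowerSeries.coeff_mk, Pi.one_apply, Finset.sum_ite_eq, Finset.mem_Icc]
      split_ifs <;> first | omega | simp
  have hdvd : (PowerSeries.X : PowerSeries ℝ) ^ (n + 1) ∣
      (PowerSeries.X * PowerSeries.mk 1) ^ (d + 1) -
        (∑ j ∈ Finset.Icc 1 n, (PowerSeries.X : PowerSeries ℝ) ^ j) ^ (d + 1) := by
    refine dvd_trans ?_ (sub_dvd_pow_sub_pow _ _ (d + 1))
    rw [hgeom]
    simp
  have hcoeff := PowerSeries.X_pow_dvd_iff.mp hdvd n (Nat.lt_succ_self n)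
  rw [map_sub, sub_eq_zero] at hcoeff
  rw [← hcoeff, mul_pow, PowerSeries.mk_one_pow_eq_mk_choose_add, PowerSeries.coeff_X_pow_mul']
  split_ifs with h
  · obtain ⟨m, rfl⟩ := Nat.exists_eq_add_of_le' hn
    rw [PowerSeries.coeff_mk, show d + (m + 1 - (d + 1)) = m by omega]
    exact_mod_cast (by rw [Nat.add_one_mul_choose_eq, mul_comm] :
      (m + 1) * m.choose d = (d + 1) * (m + 1).choose (d + 1))
  · rw [Nat.choose_eq_zero_of_lt (by omega)]
    simp

theorem cycleCount_one (n : ℕ) (σ : Equiv.Perm (Fin n)) :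
    cycleCount n 1 σ = n - σ.support.card := if_pos rfl

theorem cycleCount_of_ne_one {n j : ℕ} (hj : j ≠ 1) (σ : Equiv.Perm (Fin n)) :
    cycleCount n j σ = σ.cycleType.count j := if_neg hj

theorem mem_Icc_of_mem_cycleType {n j : ℕ} {σ : Equiv.Perm (Fin n)} (hj : j ∈ σ.cycleType) :
    j ∈ Finset.Icc 2 n := by
  refine Finset.mem_Icc.mpr ⟨Equiv.Perm.two_le_of_mem_cycleType hj, ?_⟩
  have h := Multiset.le_sum_of_mem hj
  rw [Equiv.Perm.sum_cycleType] at h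
  simpa using h.trans (Finset.card_le_univ _)

theorem mem_Icc_of_cycleCount_ne_zero {n j : ℕ} {σ : Equiv.Perm (Fin n)}
    (hj : cycleCount n j σ ≠ 0) : j ∈ Finset.Icc 1 n := by
  by_cases h : j = 1
  · subst h
    rw [cycleCount_one] at hj
    simp only [Finset.mem_Icc]
    omega
  · rw [cycleCount_of_ne_one h] at hj
    have := Finset.mem_Icc.mp (mem_Icc_of_mem_cycleType (Multiset.count_ne_zero.mp hj))
    simp only [Finset.mem_Icc]
    omega

theorem prod_Icc_one_eq_mul_prod_Icc_two {M : Type*} [CommMonoid M] {n : ℕ} (hn : 0 < n)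
    (f : ℕ → M) : ∏ j ∈ Finset.Icc 1 n, f j = f 1 * ∏ j ∈ Finset.Icc 2 n, f j := by
  rw [← Finset.insert_Icc_add_one_left_eq_Icc (show 1 ≤ n from hn), Finset.prod_insert (by simp),
    one_add_one_eq_two]

theorem sum_Icc_one_eq_add_sum_Icc_two {M : Type*} [AddCommMonoid M] {n : ℕ} (hn : 0 < n)
    (f : ℕ → M) : ∑ j ∈ Finset.Icc 1 n, f j = f 1 + ∑ j ∈ Finset.Icc 2 n, f j := by
  rw [← Finset.insert_Icc_add_one_left_eq_Icc (show 1 ≤ n from hn), Finset.sum_insert (by simp),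
    one_add_one_eq_two]

theorem sum_Icc_two_cycleCount {n : ℕ} (σ : Equiv.Perm (Fin n)) (f : ℕ → ℕ → ℕ) :
    ∑ j ∈ Finset.Icc 2 n, f j (cycleCount n j σ) =
      ∑ j ∈ Finset.Icc 2 n, f j (σ.cycleType.count j) := by
  refine Finset.sum_congr rfl fun j hj => ?_
  have := Finset.mem_Icc.mp hj
  rw [cycleCount_of_ne_one (by omega)]

theorem sum_cycleCount {n : ℕ} (hn : 0 < n) (σ : Equiv.Perm (Fin n)) :
    ∑ j ∈ Finset.Icc 1 n, cycleCount n j σ = numCycles n σ := by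
  rw [sum_Icc_one_eq_add_sum_Icc_two hn, sum_Icc_two_cycleCount σ fun _ c => c, cycleCount_one,
    Multiset.sum_count_eq_card fun j hj => mem_Icc_of_mem_cycleType hj, numCycles]

theorem sum_mul_cycleCount {n : ℕ} (hn : 0 < n) (σ : Equiv.Perm (Fin n)) :
    ∑ j ∈ Finset.Icc 1 n, j * cycleCount n j σ = n := by
  have hsum : ∑ j ∈ Finset.Icc 2 n, j * σ.cycleType.count j = σ.support.card := by
    rw [← Equiv.Perm.sum_cycleType, Finset.sum_multiset_count_of_subset _ (Finset.Icc 2 n)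
      fun j hj => mem_Icc_of_mem_cycleType (Multiset.mem_toFinset.mp hj)]
    simp [mul_comm]
  have hle : σ.support.card ≤ n := by simpa using Finset.card_le_univ σ.support
  rw [sum_Icc_one_eq_add_sum_Icc_two hn, sum_Icc_two_cycleCount σ fun j c => j * c, hsum,
    cycleCount_one]
  omega

open scoped Classical in
theorem card_cycleCount_eq_mul {n : ℕ} (hn : 0 < n) {c : ℕ → ℕ}
    (hsupp : ∀ j, c j ≠ 0 → j ∈ Finset.Icc 1 n) (hsum : ∑ j ∈ Finset.Icc 1 n, j * c j = n) :
    (Finset.univ.filter fun σ : Equiv.Perm (Fin n) => (fun j => cycleCount n j σ) = c).card *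
      ((∏ j ∈ Finset.Icc 1 n, j ^ c j) * ∏ j ∈ Finset.Icc 1 n, (c j).factorial) =
      n.factorial := by
  set m : Multiset ℕ := ∑ j ∈ Finset.Icc 2 n, Multiset.replicate (c j) j with hm
  have hcount (j : ℕ) : m.count j = if j ∈ Finset.Icc 2 n then c j else 0 := by
    simp [hm, Multiset.count_sum', Multiset.count_replicate]
  have hmem (j : ℕ) (hj : j ∈ m) : j ∈ Finset.Icc 2 n := by
    by_contra h
    have := hcount j
    rw [if_neg h] at this
    exact Multiset.count_ne_zero.mpr hj this
  have hmsum : c 1 + m.sum = n := by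
    rw [← hsum, sum_Icc_one_eq_add_sum_Icc_two hn, one_mul, hm, Multiset.sum_sum]
    simp [mul_comm]
  have hmprod : m.prod = ∏ j ∈ Finset.Icc 2 n, j ^ c j := by
    simp [hm, Multiset.prod_sum]
  have hfact : ∏ j ∈ m.toFinset, (m.count j).factorial =
      ∏ j ∈ Finset.Icc 2 n, (c j).factorial := by
    rw [Finset.prod_subset (s₂ := Finset.Icc 2 n) fun j hj => hmem j (Multiset.mem_toFinset.mp hj)]
    · exact Finset.prod_congr rfl fun j hj => by rw [hcount, if_pos hj]
    · intro j _ hj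
      rw [Multiset.count_eq_zero.mpr (fun h => hj (Multiset.mem_toFinset.mpr h)),
        Nat.factorial_zero]
  have hfilter : (Finset.univ.filter fun σ : Equiv.Perm (Fin n) =>
      (fun j => cycleCount n j σ) = c) = Finset.univ.filter fun σ => σ.cycleType = m := by
    ext σ
    simp only [Finset.mem_filter, Finset.mem_univ, true_and]
    constructor
    · rintro rfl
      ext j
      rw [hcount]
      split_ifs with hj
      · exact (cycleCount_of_ne_one (by have := Finset.mem_Icc.mp hj; omega) σ).symm
      · exact Multiset.count_eq_zero.mpr fun h => hj (mem_Icc_of_mem_cycleType h)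
    · intro h
      funext j
      by_cases hj : j = 1
      · subst hj
        rw [cycleCount_one, ← Equiv.Perm.sum_cycleType, h]
        omega
      · rw [cycleCount_of_ne_one hj, h, hcount]
        split_ifs with hj'
        · rfl
        · by_contra hc
          have := Finset.mem_Icc.mp (hsupp j (Ne.symm hc))
          simp only [Finset.mem_Icc] at hj'
          omega
  have key := Equiv.Perm.card_of_cycleType_mul_eq (Fin n) m
  rw [Fintype.card_fin, if_pos ⟨by omega, fun j hj => (Finset.mem_Icc.mp (hmem j hj)).1⟩, hmprod,
    hfact, show n - m.sum = c 1 by omega] at key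
  rw [hfilter, ← key, prod_Icc_one_eq_mul_prod_Icc_two hn, prod_Icc_one_eq_mul_prod_Icc_two hn]
  ring

/-- Up to a factor depending on `n` only, the mass that the generalized Ewens measure with
weights `θ_k = k` gives to the permutations of `n` points with `k` cycles. -/
def cycleMass (n k : ℕ) : ℝ := k * n.choose k / k.factorial

theorem sum_ewensWeight_numCycles_eq {n : ℕ} (hn : 0 < n) (k : ℕ) :
    ∑ σ : Equiv.Perm (Fin n) with numCycles n σ = k, ewensWeight (fun j => (j : ℝ)) n σ =
      (n.factorial / n) * cycleMass n k := by
  classical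
  set T := (Finset.piAntidiag (Finset.Icc 1 n) k).filter
    fun c => ∑ j ∈ Finset.Icc 1 n, j * c j = n with hT
  have hmaps : ∀ σ ∈ Finset.univ.filter (fun σ : Equiv.Perm (Fin n) => numCycles n σ = k),
      (fun j => cycleCount n j σ) ∈ T := by
    intro σ hσ
    rw [hT, Finset.mem_filter, Finset.mem_piAntidiag]
    exact ⟨⟨(sum_cycleCount hn σ).trans (Finset.mem_filter.mp hσ).2,
      fun j hj => mem_Icc_of_cycleCount_ne_zero hj⟩, sum_mul_cycleCount hn σ⟩
  have hterm (c : ℕ → ℕ) (hc : c ∈ T) :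
      ∑ σ ∈ Finset.univ.filter (fun σ : Equiv.Perm (Fin n) => numCycles n σ = k) with
        (fun j => cycleCount n j σ) = c, ewensWeight (fun j => (j : ℝ)) n σ =
      (n.factorial / k.factorial) * Nat.multinomial (Finset.Icc 1 n) c := by
    rw [hT, Finset.mem_filter, Finset.mem_piAntidiag] at hc
    obtain ⟨⟨hck, hsupp⟩, hsum⟩ := hc
    have hfilter : ((Finset.univ.filter (fun σ : Equiv.Perm (Fin n) => numCycles n σ = k)).filter
        fun σ => (fun j => cycleCount n j σ) = c) =
        Finset.univ.filter fun σ => (fun j => cycleCount n j σ) = c := by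
      ext σ
      simp only [Finset.mem_filter, Finset.mem_univ, true_and, and_iff_right_iff_imp]
      rintro rfl
      rw [← sum_cycleCount hn, ← hck]
    rw [hfilter, Finset.sum_congr rfl (g := fun _ => ∏ j ∈ Finset.Icc 1 n, (j : ℝ) ^ c j)
      fun σ hσ => by rw [ewensWeight, ← (Finset.mem_filter.mp hσ).2], Finset.sum_const,
      nsmul_eq_mul]
    have hcard := card_cycleCount_eq_mul hn hsupp hsum
    have hmult := Nat.multinomial_spec (Finset.Icc 1 n) c
    rw [hck] at hmult
    rw [← hcard, ← hmult]
    have h₁ : (∏ j ∈ Finset.Icc 1 n, ((c j).factorial : ℝ)) ≠ 0 :=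
      Finset.prod_ne_zero_iff.mpr fun j _ => by positivity
    have h₂ : (Nat.multinomial (Finset.Icc 1 n) c : ℝ) ≠ 0 := by
      exact_mod_cast (Nat.multinomial_pos _ _).ne'
    push_cast
    field_simp
  have hcoeff : (∑ c ∈ T, (Nat.multinomial (Finset.Icc 1 n) c : ℝ)) =
      PowerSeries.coeff n
        ((∑ j ∈ Finset.Icc 1 n, (PowerSeries.X : PowerSeries ℝ) ^ j) ^ k) := by
    rw [Finset.sum_pow_eq_sum_piAntidiag, map_sum, hT, Finset.sum_filter]
    refine Finset.sum_congr rfl fun c _ => ?_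
    simp_rw [← pow_mul, Finset.prod_pow_eq_pow_sum]
    rw [← map_natCast (PowerSeries.C (R := ℝ)), PowerSeries.coeff_C_mul, PowerSeries.coeff_X_pow]
    simp [eq_comm]
  have hn' : (n : ℝ) ≠ 0 := by positivity
  rw [← Finset.sum_fiberwise_of_maps_to hmaps, Finset.sum_congr rfl hterm, ← Finset.mul_sum,
    hcoeff, cycleMass, ← PowerSeries.coeff_sum_X_pow_pow hn]
  field_simp

theorem numCycles_le {n : ℕ} (hn : 0 < n) (σ : Equiv.Perm (Fin n)) : numCycles n σ ≤ n := by
  rw [← sum_cycleCount hn]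
  conv_rhs => rw [← sum_mul_cycleCount hn σ]
  exact Finset.sum_le_sum fun j hj => Nat.le_mul_of_pos_left _ (Finset.mem_Icc.mp hj).1

theorem sum_mul_ewensWeight {n : ℕ} (hn : 0 < n) (f : ℕ → ℝ) :
    ∑ σ : Equiv.Perm (Fin n), f (numCycles n σ) * ewensWeight (fun j => (j : ℝ)) n σ =
      (n.factorial / n) * ∑ k ∈ Finset.range (n + 1), f k * cycleMass n k := by
  rw [← Finset.sum_fiberwise_of_maps_to (g := fun σ => numCycles n σ)
    (t := Finset.range (n + 1)) fun σ _ => Finset.mem_range_succ_iff.mpr (numCycles_le hn σ),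
    Finset.mul_sum]
  refine Finset.sum_congr rfl fun k _ => ?_
  rw [mul_left_comm, ← sum_ewensWeight_numCycles_eq hn, Finset.mul_sum]
  exact Finset.sum_congr rfl fun σ hσ => by rw [(Finset.mem_filter.mp hσ).2]

open scoped Classical in
theorem ewensProb_numCycles {n : ℕ} (hn : 0 < n) (p : ℕ → Prop) :
    ewensProb (fun j => (j : ℝ)) n (fun σ => p (numCycles n σ)) =
      (∑ k ∈ Finset.range (n + 1), (if p k then 1 else 0) * cycleMass n k) /
        ∑ k ∈ Finset.range (n + 1), 1 * cycleMass n k := by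
  have hnum := sum_mul_ewensWeight hn fun k => if p k then 1 else 0
  have hden := sum_mul_ewensWeight hn fun _ => 1
  simp only [ite_mul, one_mul, zero_mul] at hnum hden
  simp only [ite_mul, one_mul, zero_mul]
  rw [ewensProb, Finset.sum_filter, hnum, hden, mul_div_mul_left]
  positivity

theorem cycleMass_zero (n : ℕ) : cycleMass n 0 = 0 := by simp [cycleMass]

theorem cycleMass_nonneg (n k : ℕ) : 0 ≤ cycleMass n k := by unfold cycleMass; positivity

theorem cycleMass_pos {n k : ℕ} (hk : 0 < k) (hkn : k ≤ n) : 0 < cycleMass n k := by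
  have := Nat.choose_pos hkn
  unfold cycleMass
  positivity

theorem cycleMass_eq_zero {n k : ℕ} (h : n < k) : cycleMass n k = 0 := by
  simp [cycleMass, Nat.choose_eq_zero_of_lt h]

theorem cycleMass_succ (n k : ℕ) :
    (k * (k + 1) : ℝ) * cycleMass n (k + 1) = (n - k) * cycleMass n k := by
  have h : (n.choose (k + 1) : ℝ) * (k + 1) = n.choose k * (n - k) := by
    rcases le_or_gt k n with hk | hk
    · rw [← Nat.cast_sub hk]
      exact_mod_cast Nat.choose_succ_right_eq n k
    · simp [Nat.choose_eq_zero_of_lt hk, Nat.choose_eq_zero_of_lt (hk.trans (Nat.lt_succ_self k))]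
  have hf : ((k + 1).factorial : ℝ) = (k + 1) * k.factorial := by
    exact_mod_cast Nat.factorial_succ k
  have hk : (k : ℝ) + 1 ≠ 0 := by positivity
  rw [cycleMass, cycleMass, hf]
  push_cast
  field_simp
  linear_combination (k : ℝ) * h

theorem cycleMass_succ_le {n k : ℕ} {c : ℝ} (hk : 0 < k) (h : (n - k : ℝ) ≤ c * (k * (k + 1))) :
    cycleMass n (k + 1) ≤ c * cycleMass n k := by
  have hpos : (0 : ℝ) < k * (k + 1) := by positivity
  refine le_of_mul_le_mul_left ?_ hpos
  rw [cycleMass_succ, ← mul_assoc, mul_comm (_ * _) c]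
  exact mul_le_mul_of_nonneg_right h (cycleMass_nonneg n k)

theorem cycleMass_le_succ {n k : ℕ} {c : ℝ} (hk : k < n) (h : (k * (k + 1) : ℝ) ≤ c * (n - k)) :
    cycleMass n k ≤ c * cycleMass n (k + 1) := by
  have hpos : (0 : ℝ) < n - k := by exact_mod_cast sub_pos.mpr (Nat.cast_lt (α := ℝ).mpr hk)
  refine le_of_mul_le_mul_left ?_ hpos
  rw [← cycleMass_succ, ← mul_assoc, mul_comm _ c]
  exact mul_le_mul_of_nonneg_right h (cycleMass_nonneg n (k + 1))

theorem le_mul_exp_of_step {u : ℕ → ℝ} {C δ M : ℝ} (hC : 0 ≤ C) (hδ : 0 ≤ δ) (hM : -1 ≤ M)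
    (hu : ∀ m, u m ≤ C)
    (hstep : ∀ m : ℕ, M ≤ m → u (m + 1) ≤ Real.exp (-δ) * u m) (m : ℕ) :
    u m ≤ C * Real.exp (-δ * (m - M - 1)) := by
  have hsmall (m : ℕ) (hm : (m : ℝ) ≤ M + 1) : u m ≤ C * Real.exp (-δ * (m - M - 1)) := by
    refine (hu m).trans (le_mul_of_one_le_right hC (Real.one_le_exp ?_))
    nlinarith
  induction m with
  | zero => exact hsmall 0 (by push_cast; linarith)
  | succ m ih =>
    rcases lt_or_ge (m : ℝ) M with hm | hm
    · exact hsmall (m + 1) (by push_cast; linarith)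
    · refine (hstep m hm).trans ((mul_le_mul_of_nonneg_left ih (Real.exp_pos _).le).trans_eq ?_)
      rw [mul_left_comm, ← Real.exp_add]
      congr 2
      push_cast
      ring

theorem two_mul_div_le_exp {s : ℝ} (hs : 0 < s) :
    2 * s / (2 * s + 1) ≤ Real.exp (-(1 / (2 * s + 1))) := by
  have h := Real.add_one_le_exp (-(1 / (2 * s + 1)))
  refine le_trans (le_of_eq ?_) h
  field_simp
  ring

theorem cycleMass_floor_add_le {n : ℕ} {s : ℝ} (hs : 1 ≤ s) (hn : (n : ℝ) = 4 * s ^ 4) (m : ℕ) :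
    cycleMass n (⌊2 * s ^ 2⌋₊ + 1 + m) ≤ 2 * cycleMass n ⌊2 * s ^ 2⌋₊ *
      Real.exp (-(1 / (2 * s + 1)) * (⌊2 * s ^ 2⌋₊ + 1 + m - 2 * s ^ 2 - s - 1)) := by
  set k₀ := ⌊2 * s ^ 2⌋₊ with hk₀
  have hle : (k₀ : ℝ) ≤ 2 * s ^ 2 := Nat.floor_le (by positivity)
  have hlt : 2 * s ^ 2 < k₀ + 1 := Nat.lt_floor_add_one _
  have hpos : 0 < k₀ := Nat.floor_pos.mpr (by nlinarith)
  have hbase : cycleMass n (k₀ + 1) ≤ 2 * cycleMass n k₀ := by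
    refine cycleMass_succ_le hpos ?_
    rw [hn]
    have h₁ : s ^ 2 ≤ k₀ := by nlinarith
    nlinarith [mul_le_mul h₁ hlt.le (by positivity) (by positivity)]
  have hmono (m : ℕ) : cycleMass n (k₀ + 1 + m) ≤ 2 * cycleMass n k₀ := by
    induction m with
    | zero => exact hbase
    | succ m ih =>
      refine le_trans ?_ ih
      rw [← one_mul (cycleMass n (k₀ + 1 + m))]
      refine cycleMass_succ_le (k := k₀ + 1 + m) (by omega) ?_
      push_cast
      have hm : (0 : ℝ) ≤ m := m.cast_nonneg
      have h₁ : 2 * s ^ 2 ≤ k₀ + 1 + m := by linarith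
      rw [hn]
      nlinarith [mul_le_mul h₁ h₁ (by positivity) (by positivity)]
  have h := le_mul_exp_of_step (u := fun m => cycleMass n (k₀ + 1 + m))
    (C := 2 * cycleMass n k₀) (δ := 1 / (2 * s + 1)) (M := 2 * s ^ 2 + s - k₀ - 1)
    (mul_nonneg zero_le_two (cycleMass_nonneg _ _)) (by positivity) (by linarith) hmono
    (fun m hm => by
      refine (cycleMass_succ_le (k := k₀ + 1 + m) (c := 2 * s / (2 * s + 1)) (by omega) ?_).trans
        (mul_le_mul_of_nonneg_right (two_mul_div_le_exp (by linarith)) (cycleMass_nonneg _ _))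
      push_cast
      set t : ℝ := k₀ + 1 + m with ht
      have h₁ : s * (2 * s + 1) ≤ t := by linarith
      have h₂ : (s * (2 * s + 1)) ^ 2 ≤ t ^ 2 := by gcongr
      rw [div_mul_eq_mul_div, le_div_iff₀ (by positivity), hn]
      have h₃ : 0 ≤ t := le_trans (by positivity) h₁
      nlinarith [mul_le_mul_of_nonneg_left h₂ (show 0 ≤ 2 * s by linarith),
        mul_nonneg (show 0 ≤ s by linarith) h₃, show 0 ≤ s ^ 3 by positivity,
        show 0 ≤ s ^ 4 by positivity]) m
  refine h.trans_eq ?_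
  congr 3
  ring

theorem cycleMass_floor_sub_le {n : ℕ} {s : ℝ} (hs : 1 ≤ s) (hn : (n : ℝ) = 4 * s ^ 4) (m : ℕ) :
    cycleMass n (⌊2 * s ^ 2⌋₊ - m) ≤ cycleMass n ⌊2 * s ^ 2⌋₊ *
      Real.exp (-(1 / (2 * s + 1)) * (m - s - 1)) := by
  set k₀ := ⌊2 * s ^ 2⌋₊ with hk₀
  have hle : (k₀ : ℝ) ≤ 2 * s ^ 2 := Nat.floor_le (by positivity)
  have hkn : k₀ ≤ n := by
    have : (k₀ : ℝ) ≤ n := by rw [hn]; nlinarith [one_le_pow₀ hs (n := 2)]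
    exact_mod_cast this
  have hstep (m : ℕ) (c : ℝ) (hc : 0 ≤ c)
      (h : ∀ i : ℕ, i + (m + 1) = k₀ → (i * (i + 1) : ℝ) ≤ c * (n - i)) :
      cycleMass n (k₀ - (m + 1)) ≤ c * cycleMass n (k₀ - m) := by
    rcases lt_or_ge m k₀ with hm | hm
    · have := cycleMass_le_succ (n := n) (k := k₀ - (m + 1)) (c := c) (by omega)
        (h _ (by omega))
      rwa [show k₀ - (m + 1) + 1 = k₀ - m by omega] at this
    · rw [show k₀ - (m + 1) = 0 by omega, cycleMass_zero]
      exact mul_nonneg hc (cycleMass_nonneg _ _)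
  refine le_mul_exp_of_step (u := fun m => cycleMass n (k₀ - m)) (cycleMass_nonneg _ _)
    (by positivity) (by linarith) (fun m => ?_) (fun m hm => ?_) m
  · induction m with
    | zero => exact le_rfl
    | succ m ih =>
      refine le_trans ?_ ih
      have := hstep m 1 zero_le_one fun i hi => by
        have hi' : (i : ℝ) + 1 ≤ 2 * s ^ 2 := by
          have : ((i + 1 : ℕ) : ℝ) ≤ k₀ := Nat.cast_le.mpr (by omega)
          push_cast at this
          linarith
        have hi₀ : (0 : ℝ) ≤ i := i.cast_nonneg
        rw [hn]
        nlinarith [mul_le_mul hi' hi' (by positivity) (by positivity)]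
      rwa [one_mul] at this
  · refine (hstep m (2 * s / (2 * s + 1)) (by positivity) fun i hi => ?_).trans
      (mul_le_mul_of_nonneg_right (two_mul_div_le_exp (by linarith)) (cycleMass_nonneg _ _))
    have hi' : (i : ℝ) ≤ (2 * s + 1) * (s - 1) := by
      have : ((i + (m + 1) : ℕ) : ℝ) = k₀ := by rw [hi]
      push_cast at this
      linarith
    have hi₀ : (0 : ℝ) ≤ i := i.cast_nonneg
    rw [div_mul_eq_mul_div, le_div_iff₀ (by positivity), hn]
    set M := (2 * s + 1) * (s - 1) with hM
    have h₁ : (i * (i + 1) : ℝ) ≤ M * (M + 1) := by gcongr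
    have h₂ : (2 * s + 1) * (M * (M + 1)) + 2 * s * M ≤ 8 * s ^ 5 := by
      rw [hM]
      nlinarith [show 0 ≤ s ^ 4 by positivity, show 0 ≤ s ^ 3 by positivity,
        show 0 ≤ s ^ 2 by positivity]
    nlinarith [mul_le_mul_of_nonneg_left h₁ (show 0 ≤ 2 * s + 1 by linarith),
      mul_le_mul_of_nonneg_left hi' (show 0 ≤ 2 * s by linarith)]

/-- Exponential domination of the mass at scale `s` around `2 * s ^ 2 = √n`. -/
theorem cycleMass_floor_le_exp {n : ℕ} {s : ℝ} (hs : 1 ≤ s) (hn : (n : ℝ) = 4 * s ^ 4) (y : ℝ) :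
    cycleMass n ⌊2 * s ^ 2 + s * y⌋₊ ≤
      cycleMass n ⌊2 * s ^ 2⌋₊ * (2 * Real.exp (3 - |y| / 3)) := by
  set k := ⌊2 * s ^ 2 + s * y⌋₊ with hk
  have ha := cycleMass_nonneg n ⌊2 * s ^ 2⌋₊
  have hexp (r : ℝ) (hr : (|y| / 3 - 3) * (2 * s + 1) ≤ r) :
      Real.exp (-(1 / (2 * s + 1)) * r) ≤ Real.exp (3 - |y| / 3) := by
    rw [Real.exp_le_exp, neg_mul, one_div_mul_eq_div]
    have := (le_div_iff₀ (show 0 < 2 * s + 1 by positivity)).mpr hr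
    linarith
  rcases lt_or_ge (2 * s ^ 2 + s * y) 0 with hneg | hnonneg
  · rw [hk, Nat.floor_of_nonpos hneg.le, cycleMass_zero]
    positivity
  have hle : (k : ℝ) ≤ 2 * s ^ 2 + s * y := Nat.floor_le hnonneg
  have hlt : 2 * s ^ 2 + s * y < k + 1 := Nat.lt_floor_add_one _
  have hle₀ : (⌊2 * s ^ 2⌋₊ : ℝ) ≤ 2 * s ^ 2 := Nat.floor_le (by positivity)
  have hlt₀ : 2 * s ^ 2 < ⌊2 * s ^ 2⌋₊ + 1 := Nat.lt_floor_add_one _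
  rcases le_or_gt k ⌊2 * s ^ 2⌋₊ with h | h
  · obtain ⟨m, hm⟩ := Nat.exists_eq_add_of_le h
    have hm' : (⌊2 * s ^ 2⌋₊ : ℝ) = k + m := by exact_mod_cast hm
    have key := cycleMass_floor_sub_le hs hn m
    rw [show ⌊2 * s ^ 2⌋₊ - m = k by omega] at key
    refine key.trans (mul_le_mul_of_nonneg_left ((hexp _ ?_).trans ?_) ha)
    · rcases le_total y 0 with hy | hy
      · rw [abs_of_nonpos hy]
        nlinarith
      · have hy1 : y ≤ 1 := by
          have : (0 : ℝ) ≤ m := m.cast_nonneg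
          nlinarith
        rw [abs_of_nonneg hy]
        nlinarith
    · linarith [Real.exp_pos (3 - |y| / 3)]
  · obtain ⟨m, hm⟩ := Nat.exists_eq_add_of_le (Nat.succ_le_of_lt h)
    have hm' : (k : ℝ) = ⌊2 * s ^ 2⌋₊ + 1 + m := by exact_mod_cast hm
    have key := cycleMass_floor_add_le hs hn m
    rw [show ⌊2 * s ^ 2⌋₊ + 1 + m = k from hm.symm, ← hm', mul_comm 2, mul_assoc] at key
    refine key.trans ?_
    refine mul_le_mul_of_nonneg_left (mul_le_mul_of_nonneg_left (hexp _ ?_) zero_le_two) ha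
    have hy : 0 ≤ y := by
      have : (0 : ℝ) ≤ m := m.cast_nonneg
      nlinarith
    rw [abs_of_nonneg hy]
    nlinarith

theorem abs_log_cycleMass_step_le {n i : ℕ} {s : ℝ} (hs : 2 ≤ s) (hn : (n : ℝ) = 4 * s ^ 4)
    (hi : |(i : ℝ) - 2 * s ^ 2| ≤ s ^ 2) :
    |Real.log (cycleMass n (i + 1)) - Real.log (cycleMass n i) +
        (2 * (i - 2 * s ^ 2) + 1) / (2 * s ^ 2)| ≤
      ((i - 2 * s ^ 2) ^ 2 + 4 * s ^ 2) / s ^ 4 := by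
  obtain ⟨h₁, h₂⟩ := abs_le.mp hi
  have hs2 : 4 ≤ s ^ 2 := by nlinarith
  have hs0 : 0 < s ^ 2 := by positivity
  set N := 2 * s ^ 2 with hN
  have hnN : (n : ℝ) = N ^ 2 := by rw [hn, hN]; ring
  have hN8 : 8 ≤ N := by linarith
  have hN0 : 0 < N := by linarith
  set u := (i - N) / N with hu
  have hiu : (i : ℝ) = N * (1 + u) := by rw [hu]; field_simp; ring
  have hu₁ : -(1 / 2) ≤ u := by rw [hu, le_div_iff₀ hN0]; linarith
  have hu₂ : u ≤ 1 / 2 := by rw [hu, div_le_iff₀ hN0]; linarith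
  have hi0 : (0 : ℝ) < i := by linarith
  have hin : (i : ℝ) < n := by rw [hnN]; nlinarith
  have hv₂ : (i : ℝ) / n ≤ 3 / 2 / N := by
    rw [hnN, hiu, div_le_div_iff₀ (by positivity) hN0]
    nlinarith [mul_pos hN0 hN0]
  have hNinv : 3 / 2 / N ≤ 3 / 16 := by rw [div_le_div_iff₀ hN0 (by norm_num)]; linarith
  have hmi : 0 < cycleMass n i :=
    cycleMass_pos (by exact_mod_cast hi0) (by exact_mod_cast hin.le)
  have hratio : cycleMass n (i + 1) =
      (1 - i / n) * ((1 + u) ^ 2)⁻¹ * (1 + 1 / (i : ℝ))⁻¹ * cycleMass n i := by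
    have h := cycleMass_succ n i
    have h1u : 1 + u = i / N := by rw [hiu]; field_simp
    have hi1 : (i : ℝ) + 1 ≠ 0 := by positivity
    rw [h1u, hnN]
    rw [hnN] at h
    field_simp
    linear_combination h
  have hlog : Real.log (cycleMass n (i + 1)) - Real.log (cycleMass n i) =
      Real.log (1 - i / n) - 2 * Real.log (1 + u) - Real.log (1 + 1 / (i : ℝ)) := by
    have e₁ : 0 < 1 - (i : ℝ) / n := by linarith
    have e₂ : 0 < 1 + u := by linarith
    have e₃ : 0 < 1 + 1 / (i : ℝ) := by positivity
    rw [hratio, Real.log_mul (by positivity) hmi.ne', Real.log_mul (by positivity) (by positivity),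
      Real.log_mul (by positivity) (by positivity), Real.log_inv, Real.log_inv, Real.log_pow]
    push_cast
    ring
  have hA₁ : Real.log (1 - i / n) ≤ 0 :=
    Real.log_nonpos (by linarith) (by linarith [show 0 ≤ (i : ℝ) / n by positivity])
  have hA₂ : -(2 / N) ≤ Real.log (1 - i / n) := by
    have e₁ : 0 < 1 - (i : ℝ) / n := by linarith
    refine le_trans ?_ (Real.one_sub_inv_le_log_of_pos e₁)
    rw [le_sub_iff_add_le, ← le_sub_iff_add_le', sub_neg_eq_add, inv_le_iff_one_le_mul₀ e₁]
    have : 2 / N = 4 / 3 * (3 / 2 / N) := by ring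
    rw [this]
    have hw : 0 < 3 / 2 / N := by positivity
    nlinarith [mul_le_mul_of_nonneg_left hv₂ (show 0 ≤ 1 + 4 / 3 * (3 / 2 / N) by positivity)]
  have hB₁ : Real.log (1 + u) ≤ u := by
    linarith [Real.log_le_sub_one_of_pos (show 0 < 1 + u by linarith)]
  have hB₂ : u - 2 * u ^ 2 ≤ Real.log (1 + u) := by
    have e₁ : 0 < 1 + u := by linarith
    refine le_trans ?_ (Real.one_sub_inv_le_log_of_pos e₁)
    rw [le_sub_iff_add_le, ← le_sub_iff_add_le', inv_le_iff_one_le_mul₀ e₁]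
    nlinarith [sq_nonneg u]
  have hC₁ : 0 ≤ Real.log (1 + 1 / (i : ℝ)) :=
    Real.log_nonneg (by linarith [show 0 ≤ 1 / (i : ℝ) by positivity])
  have hC₂ : Real.log (1 + 1 / (i : ℝ)) ≤ 2 / N := by
    have h : 1 / (i : ℝ) ≤ 2 / N := by
      rw [div_le_div_iff₀ hi0 hN0]
      linarith
    linarith [Real.log_le_sub_one_of_pos (show 0 < 1 + 1 / (i : ℝ) by positivity)]
  have hrhs : ((i - N) ^ 2 + 4 * s ^ 2) / s ^ 4 = 4 * u ^ 2 + 8 / N := by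
    rw [hu, hN]
    field_simp
    ring
  have hlin : (2 * (i - N) + 1) / N = 2 * u + 1 / N := by rw [hu]; ring
  rw [hlog, hrhs, hlin, abs_le]
  have e : 2 / N = 2 * (1 / N) := by ring
  have e' : 8 / N = 8 * (1 / N) := by ring
  have : 0 < 1 / N := by positivity
  constructor <;> linarith [sq_nonneg u]

theorem abs_sub_le_of_step_le {f : ℕ → ℝ} {ε a b : ℝ}
    (hf : ∀ i : ℕ, a ≤ i → i ≤ b → |f (i + 1) - f i| ≤ ε) {j k : ℕ} (hj : a ≤ j) (hjb : j ≤ b)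
    (hk : a ≤ k) (hkb : k ≤ b) : |f k - f j| ≤ ε * |(k : ℝ) - j| := by
  wlog h : j ≤ k generalizing j k
  · rw [abs_sub_comm, abs_sub_comm (k : ℝ)]
    exact this hk hkb hj hjb (le_of_not_ge h)
  have := dist_le_Ico_sum_of_dist_le (f := f) (d := fun _ => ε) h fun {i} hji hik => by
    rw [dist_comm, Real.dist_eq]
    exact hf i (hj.trans (Nat.cast_le.mpr hji)) (le_trans (Nat.cast_le.mpr hik.le) hkb)
  rw [dist_comm, Real.dist_eq] at this
  refine this.trans_eq ?_
  rw [Finset.sum_const, Nat.card_Ico, nsmul_eq_mul, Nat.cast_sub h,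
    abs_of_nonneg (sub_nonneg.mpr (Nat.cast_le.mpr h)), mul_comm]

theorem abs_floor_sub_le {s y : ℝ} (h : 0 ≤ 2 * s ^ 2 + s * y) :
    |(⌊2 * s ^ 2 + s * y⌋₊ : ℝ) - 2 * s ^ 2 - s * y| ≤ 1 := by
  rw [abs_le]
  constructor <;> linarith [Nat.floor_le h, Nat.lt_floor_add_one (2 * s ^ 2 + s * y)]

theorem abs_log_cycleMass_floor_le {n : ℕ} {s y : ℝ} (hs : 2 ≤ s) (hsy : |y| + 1 ≤ s)
    (hn : (n : ℝ) = 4 * s ^ 4) :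
    |(Real.log (cycleMass n ⌊2 * s ^ 2 + s * y⌋₊) +
          (⌊2 * s ^ 2 + s * y⌋₊ - 2 * s ^ 2) ^ 2 / (2 * s ^ 2)) -
        (Real.log (cycleMass n ⌊2 * s ^ 2⌋₊) +
          (⌊2 * s ^ 2⌋₊ - 2 * s ^ 2) ^ 2 / (2 * s ^ 2))| ≤ (|y| + 2) ^ 3 * (1 / s) * 2 := by
  set k := ⌊2 * s ^ 2 + s * y⌋₊ with hk
  set k₀ := ⌊2 * s ^ 2⌋₊ with hk₀
  set A := |y| with hA
  have hA0 : 0 ≤ A := abs_nonneg y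
  have hyA : -A ≤ y := neg_abs_le y
  have hyA' : y ≤ A := le_abs_self y
  have hd := abs_le.mp (abs_floor_sub_le (s := s) (y := y) (by nlinarith))
  have hd₀ := abs_le.mp (abs_floor_sub_le (s := s) (y := 0) (by nlinarith))
  simp only [mul_zero, add_zero, sub_zero, ← hk, ← hk₀] at hd hd₀
  set D := (A + 1) * s with hD
  have hDs : D ≤ s ^ 2 := by nlinarith
  have key := abs_sub_le_of_step_le
    (f := fun i : ℕ => Real.log (cycleMass n i) + ((i : ℝ) - 2 * s ^ 2) ^ 2 / (2 * s ^ 2))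
    (ε := (D ^ 2 + 4 * s ^ 2) / s ^ 4) (a := 2 * s ^ 2 - D) (b := 2 * s ^ 2 + D) (j := k₀) (k := k)
    (fun i hi₁ hi₂ => by
      have hi : |(i : ℝ) - 2 * s ^ 2| ≤ D := abs_le.mpr ⟨by linarith, by linarith⟩
      have h := abs_log_cycleMass_step_le hs hn (hi.trans hDs)
      refine le_trans (le_of_eq ?_) (h.trans ?_)
      · congr 1
        push_cast
        field_simp
        ring
      · gcongr ?_ / _
        have := sq_le_sq' (by linarith) (show (i : ℝ) - 2 * s ^ 2 ≤ D by linarith)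
        linarith)
    (by nlinarith) (by nlinarith) (by nlinarith) (by nlinarith)
  refine key.trans ?_
  have hkk : |(k : ℝ) - k₀| ≤ (A + 2) * s := by
    rw [abs_le]
    constructor <;> nlinarith
  calc (D ^ 2 + 4 * s ^ 2) / s ^ 4 * |(k : ℝ) - k₀|
      ≤ (D ^ 2 + 4 * s ^ 2) / s ^ 4 * ((A + 2) * s) := by gcongr
    _ = ((A + 1) ^ 2 + 4) * (A + 2) * (1 / s) := by rw [hD]; field_simp
    _ ≤ (A + 2) ^ 3 * (1 / s) * 2 := by
      have : ((A + 1) ^ 2 + 4) * (A + 2) ≤ (A + 2) ^ 3 * 2 := by nlinarith [mul_nonneg hA0 hA0]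
      have h0 : 0 < 1 / s := by positivity
      nlinarith

theorem tendsto_floor_sub_div {s : ℕ → ℝ} (hs : Tendsto s atTop atTop) (y : ℝ) :
    Tendsto (fun n => ((⌊2 * s n ^ 2 + s n * y⌋₊ : ℝ) - 2 * s n ^ 2) / s n) atTop (𝓝 y) := by
  rw [tendsto_iff_norm_sub_tendsto_zero]
  refine squeeze_zero' (Eventually.of_forall fun _ => norm_nonneg _) ?_
    (tendsto_inv_atTop_zero.comp hs)
  filter_upwards [hs.eventually_ge_atTop (|y| + 1)] with n hn
  have hpos : 0 < s n := by linarith [abs_nonneg y]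
  have h := abs_floor_sub_le (s := s n) (y := y) (by nlinarith [neg_abs_le y])
  rw [Real.norm_eq_abs, Function.comp_apply, ← one_div, le_div_iff₀ hpos]
  refine le_trans (le_of_eq ?_) h
  rw [show (⌊2 * s n ^ 2 + s n * y⌋₊ : ℝ) - 2 * s n ^ 2 - s n * y =
    ((⌊2 * s n ^ 2 + s n * y⌋₊ - 2 * s n ^ 2) / s n - y) * s n by field_simp, abs_mul,
    abs_of_pos hpos]

/-- The local limit theorem for the number of cycles, at scale `s = 2 ^ (-1/2) * n ^ (1/4)`. -/
theorem tendsto_cycleMass_floor_div {s : ℕ → ℝ} (hs : Tendsto s atTop atTop)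
    (hn : ∀ n : ℕ, (n : ℝ) = 4 * s n ^ 4) (y : ℝ) :
    Tendsto (fun n => cycleMass n ⌊2 * s n ^ 2 + s n * y⌋₊ / cycleMass n ⌊2 * s n ^ 2⌋₊) atTop
      (𝓝 (Real.exp (-y ^ 2 / 2))) := by
  have herr : Tendsto (fun n =>
      (Real.log (cycleMass n ⌊2 * s n ^ 2 + s n * y⌋₊) +
          (⌊2 * s n ^ 2 + s n * y⌋₊ - 2 * s n ^ 2) ^ 2 / (2 * s n ^ 2)) -
        (Real.log (cycleMass n ⌊2 * s n ^ 2⌋₊) +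
          (⌊2 * s n ^ 2⌋₊ - 2 * s n ^ 2) ^ 2 / (2 * s n ^ 2))) atTop (𝓝 0) := by
    refine squeeze_zero_norm' (a := fun n => (|y| + 2) ^ 3 * (1 / s n) * 2) ?_ ?_
    · filter_upwards [hs.eventually_ge_atTop 2, hs.eventually_ge_atTop (|y| + 1)] with n h₁ h₂
      exact abs_log_cycleMass_floor_le h₁ h₂ (hn n)
    · simpa [one_div] using
        ((tendsto_inv_atTop_zero.comp hs).const_mul ((|y| + 2) ^ 3)).mul_const 2
  have hlog : Tendsto (fun n => Real.log (cycleMass n ⌊2 * s n ^ 2 + s n * y⌋₊) -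
      Real.log (cycleMass n ⌊2 * s n ^ 2⌋₊)) atTop (𝓝 (-y ^ 2 / 2)) := by
    have h := (herr.sub (((tendsto_floor_sub_div hs y).pow 2).div_const 2)).add
      (((tendsto_floor_sub_div hs 0).pow 2).div_const 2)
    convert h using 1
    · funext n
      simp only [mul_zero, add_zero, div_pow]
      ring
    · congr 1
      ring
  refine (Real.continuous_exp.continuousAt.tendsto.comp hlog).congr' ?_
  filter_upwards [hs.eventually_ge_atTop 2, hs.eventually_ge_atTop (|y| + 1)] with n h₁ h₂
  have hfloor (z : ℝ) (hz : |z| + 1 ≤ s n) : 0 < cycleMass n ⌊2 * s n ^ 2 + s n * z⌋₊ := by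
    have hz' := abs_le.mp (le_refl |z|)
    refine cycleMass_pos (Nat.floor_pos.mpr (by nlinarith)) ?_
    have : (⌊2 * s n ^ 2 + s n * z⌋₊ : ℝ) ≤ n := by
      refine (Nat.floor_le (by nlinarith)).trans ?_
      rw [hn n]
      nlinarith [mul_le_mul h₁ h₁ zero_le_two (by linarith), sq_nonneg (s n ^ 2)]
    exact_mod_cast this
  have h₀ := hfloor 0 (by simpa using h₁.trans' (by norm_num))
  rw [mul_zero, add_zero] at h₀
  rw [Function.comp_apply, Real.exp_sub, Real.exp_log (hfloor y h₂), Real.exp_log h₀]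

theorem integral_floor {b : ℕ → ℝ} {n : ℕ} (hb₀ : b 0 = 0) (hb : ∀ k, n < k → b k = 0) :
    ∫ t : ℝ, b ⌊t⌋₊ = ∑ k ∈ Finset.range (n + 1), b k := by
  have hdecomp (t : ℝ) : b ⌊t⌋₊ = ∑ k ∈ Finset.range (n + 1),
      (Set.Ico (k : ℝ) (k + 1)).indicator (fun _ => b k) t := by
    rcases lt_or_ge t 0 with ht | ht
    · rw [Nat.floor_of_nonpos ht.le, hb₀, Finset.sum_eq_zero]
      intro k _
      refine Set.indicator_of_notMem (fun h => ?_) _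
      linarith [h.1, (k.cast_nonneg : (0 : ℝ) ≤ k)]
    · have hind (k : ℕ) : (Set.Ico (k : ℝ) (k + 1)).indicator (fun _ => b k) t =
          if k = ⌊t⌋₊ then b k else 0 := by
        rw [Set.indicator_apply]
        refine if_congr ?_ rfl rfl
        rw [Set.mem_Ico, eq_comm, Nat.floor_eq_iff ht]
      rw [Finset.sum_congr rfl fun k _ => hind k, Finset.sum_ite_eq']
      split_ifs with h
      · rfl
      · exact hb _ (by simpa using h)
  simp_rw [hdecomp]
  rw [integral_finsetSum]
  · refine Finset.sum_congr rfl fun k _ => ?_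
    rw [integral_indicator measurableSet_Ico]
    simp
  · intro k _
    rw [integrable_indicator_iff measurableSet_Ico]
    exact integrableOn_const (by simp)

theorem integral_floor_add_mul {b : ℕ → ℝ} {n : ℕ} (hb₀ : b 0 = 0) (hb : ∀ k, n < k → b k = 0)
    {s : ℝ} (hs : 0 < s) (N : ℝ) :
    ∫ y : ℝ, b ⌊N + s * y⌋₊ = s⁻¹ * ∑ k ∈ Finset.range (n + 1), b k := by
  rw [Measure.integral_comp_mul_left (fun t => b ⌊N + t⌋₊) s,
    integral_add_left_eq_self (fun t => b ⌊t⌋₊) N, integral_floor hb₀ hb,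
    abs_of_pos (inv_pos.mpr hs), smul_eq_mul]

theorem integrable_exp_neg_abs_div_three : Integrable fun y : ℝ => Real.exp (3 - |y| / 3) := by
  have h : Integrable fun y : ℝ => Real.exp (-(1 / 3) * |y|) := by
    rw [← integrableOn_univ, ← Set.Iic_union_Ioi (a := (0 : ℝ))]
    refine IntegrableOn.union ?_ ?_
    · refine (integrableOn_exp_mul_Iic (a := 1 / 3) (by norm_num) 0).congr_fun (fun y hy => ?_)
        measurableSet_Iic
      simp only [abs_of_nonpos (Set.mem_Iic.mp hy), neg_mul_neg]
    · refine (integrableOn_exp_mul_Ioi (a := -(1 / 3)) (by norm_num) 0).congr_fun (fun y hy => ?_)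
        measurableSet_Ioi
      simp only [abs_of_pos (Set.mem_Ioi.mp hy)]
  convert h.const_mul (Real.exp 3) using 2 with y
  rw [← Real.exp_add]
  congr 1
  ring

theorem tendsto_sum_mul_cycleMass {s : ℕ → ℝ} (hs : Tendsto s atTop atTop)
    (hn : ∀ n : ℕ, (n : ℝ) = 4 * s n ^ 4) {f : ℕ → ℕ → ℝ} (hf : ∀ n k, |f n k| ≤ 1) {φ : ℝ → ℝ}
    (hφ : ∀ᵐ y, Tendsto (fun n => f n ⌊2 * s n ^ 2 + s n * y⌋₊) atTop (𝓝 (φ y))) :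
    Tendsto (fun n => (∑ k ∈ Finset.range (n + 1), f n k * cycleMass n k) /
      (s n * cycleMass n ⌊2 * s n ^ 2⌋₊)) atTop (𝓝 (∫ y, φ y * Real.exp (-y ^ 2 / 2))) := by
  have hlim : Tendsto (fun n => ∫ y, f n ⌊2 * s n ^ 2 + s n * y⌋₊ *
      (cycleMass n ⌊2 * s n ^ 2 + s n * y⌋₊ / cycleMass n ⌊2 * s n ^ 2⌋₊)) atTop
      (𝓝 (∫ y, φ y * Real.exp (-y ^ 2 / 2))) := by
    refine tendsto_integral_filter_of_dominated_convergence
      (fun y => 2 * Real.exp (3 - |y| / 3)) (Eventually.of_forall fun n => ?_) ?_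
      (integrable_exp_neg_abs_div_three.const_mul 2) ?_
    · have hm : Measurable fun y : ℝ => ⌊2 * s n ^ 2 + s n * y⌋₊ :=
        Nat.measurable_floor.comp (by fun_prop)
      exact ((measurable_from_nat (f := fun k => f n k *
        (cycleMass n k / cycleMass n ⌊2 * s n ^ 2⌋₊))).comp hm).aestronglyMeasurable
    · filter_upwards [hs.eventually_ge_atTop 1] with n h₁
      refine Eventually.of_forall fun y => ?_
      have h₀ := cycleMass_nonneg n ⌊2 * s n ^ 2⌋₊
      rw [norm_mul, Real.norm_eq_abs, Real.norm_of_nonneg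
        (div_nonneg (cycleMass_nonneg _ _) h₀)]
      refine (mul_le_of_le_one_left (div_nonneg (cycleMass_nonneg _ _) h₀) (hf _ _)).trans ?_
      refine div_le_of_le_mul₀ h₀ (by positivity) ?_
      rw [mul_comm (2 * Real.exp _)]
      exact cycleMass_floor_le_exp h₁ (hn n) y
    · filter_upwards [hφ] with y hy
      exact hy.mul (tendsto_cycleMass_floor_div hs hn y)
  refine hlim.congr' ?_
  filter_upwards [hs.eventually_gt_atTop 0] with n h₀
  rw [integral_floor_add_mul (n := n) (b := fun k => f n k *
    (cycleMass n k / cycleMass n ⌊2 * s n ^ 2⌋₊)) (by simp [cycleMass_zero])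
    (fun k hk => by simp [cycleMass_eq_zero hk]) h₀, Finset.sum_congr rfl fun k _ =>
      (mul_div_assoc (f n k) (cycleMass n k) (cycleMass n ⌊2 * s n ^ 2⌋₊)).symm,
    ← Finset.sum_div, inv_mul_eq_div, div_div, mul_comm (s n)]

open scoped Classical in
theorem tendsto_ite_floor_le {s : ℕ → ℝ} (hs : Tendsto s atTop atTop) {x y : ℝ} (hxy : y ≠ x) :
    Tendsto (fun n => if ((⌊2 * s n ^ 2 + s n * y⌋₊ : ℝ) - 2 * s n ^ 2) / s n ≤ x then (1 : ℝ)
      else 0) atTop (𝓝 (if y ≤ x then 1 else 0)) := by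
  have h := tendsto_floor_sub_div hs y
  refine tendsto_const_nhds.congr' ?_
  rcases hxy.lt_or_gt with hlt | hgt
  · filter_upwards [h.eventually_lt_const hlt] with n hn'
    rw [if_pos hlt.le, if_pos hn'.le]
  · filter_upwards [h.eventually_const_lt hgt] with n hn'
    rw [if_neg hgt.not_ge, if_neg hn'.not_ge]

theorem integral_exp_neg_sq_div_two : ∫ y : ℝ, Real.exp (-y ^ 2 / 2) = √(2 * Real.pi) := by
  have h := integral_gaussian (1 / 2)
  rw [div_div_eq_mul_div, div_one, mul_comm] at h
  rw [← h]
  congr 1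
  funext y
  congr 1
  ring

/-- **Corollary 3.3.** For `θ_k = k` (so `g_θ(t) = (1-t)^{-1}` up to the
constant term), `(K_{0n} - n^{1/2})/(2^{-1/2} n^{1/4})` converges in
distribution to a standard normal random variable. -/
theorem clt_numCycles_simple :
    convergesToStdNormal (fun k => (k : ℝ))
      (fun n => (n : ℝ) ^ ((1 : ℝ) / 2))
      (fun n => (2 : ℝ) ^ (-(1 : ℝ) / 2) * (n : ℝ) ^ ((1 : ℝ) / 4)) := by
  intro x
  set s : ℕ → ℝ := fun n => (2 : ℝ) ^ (-(1 : ℝ) / 2) * (n : ℝ) ^ ((1 : ℝ) / 4) with hsdef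
  have hs : Tendsto s atTop atTop :=
    ((tendsto_rpow_atTop (by norm_num)).comp tendsto_natCast_atTop_atTop).const_mul_atTop
      (by positivity)
  have hroot (n : ℕ) : (n : ℝ) ^ ((1 : ℝ) / 2) = 2 * s n ^ 2 := by
    rw [hsdef, mul_pow, ← Real.rpow_mul_natCast zero_le_two, ← Real.rpow_mul_natCast n.cast_nonneg]
    norm_num [Real.rpow_neg_one]
    ring
  have hn (n : ℕ) : (n : ℝ) = 4 * s n ^ 4 := by
    have h : ((n : ℝ) ^ ((1 : ℝ) / 2)) ^ 2 = n := by
      rw [← Real.rpow_mul_natCast n.cast_nonneg]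
      norm_num
    rw [hroot] at h
    linear_combination -h
  classical
  have hnum := tendsto_sum_mul_cycleMass hs hn
    (f := fun n k => if ((k : ℝ) - 2 * s n ^ 2) / s n ≤ x then 1 else 0)
    (φ := fun y => if y ≤ x then 1 else 0)
    (fun n k => by split_ifs <;> simp)
    ((Measure.ae_ne volume x).mono fun y hy => by convert tendsto_ite_floor_le hs hy)
  have hden := tendsto_sum_mul_cycleMass hs hn (f := fun _ _ => 1) (φ := fun _ => 1)
    (fun n k => by simp) (Eventually.of_forall fun y => tendsto_const_nhds)
  simp only [one_mul, integral_exp_neg_sq_div_two] at hden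
  have hlim := hnum.div hden (by positivity)
  have hcdf : stdNormalCDF x =
      (∫ y, (if y ≤ x then 1 else 0) * Real.exp (-y ^ 2 / 2)) / √(2 * Real.pi) := by
    rw [stdNormalCDF, integral_div, ← integral_indicator measurableSet_Iic]
    congr 2
    funext y
    simp [Set.indicator_apply]
  rw [hcdf]
  refine hlim.congr' ?_
  filter_upwards [eventually_gt_atTop 0, hs.eventually_ge_atTop 1] with n hn₀ hs₁
  have hmass : 0 < cycleMass n ⌊2 * s n ^ 2⌋₊ := by
    refine cycleMass_pos (Nat.floor_pos.mpr (by nlinarith)) ?_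
    have : (⌊2 * s n ^ 2⌋₊ : ℝ) ≤ n := by
      refine (Nat.floor_le (by positivity)).trans ?_
      rw [hn n]
      nlinarith [one_le_pow₀ hs₁ (n := 2)]
    exact_mod_cast this
  have hc : s n * cycleMass n ⌊2 * s n ^ 2⌋₊ ≠ 0 := by positivity
  have hprob := ewensProb_numCycles hn₀ fun k => ((k : ℝ) - 2 * s n ^ 2) / s n ≤ x
  simp only [one_mul] at hprob
  simp only [Pi.div_apply]
  rw [hroot, div_div_div_cancel_right₀ hc]
  convert hprob.symm
end
end

section
/- Let g = g_θ be log-admissible, let r_x be the unique solution of a(r) = x, and suppose r_x satisfies the technical condition (*). Fix M > 0. Then for every s with −M < s < M, the Laplace transform of the total cycle count under the generalized Ewens measure satisfies log 𝔼[exp(−s K_{0n})] = −g(r_n)(1 + o(1)) s + (g(r_n) + n η_1(n))(1 + o(1)) s²/2 + O(ξ(n) s³), where ξ(n) = sup_{x ∈ [e^{−M} n, e^{M} n]} ( g(r_x) + x |η_1(x)| ). -/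
open Filter Set Asymptotics MeasureTheory
open scoped Topology

noncomputable section

/-- `log`-admissibility of a power series `g` with coefficients `gc`, radius of
convergence `ρ`, and associated functions `a`, `b`, `δ` (Definition 2.1). -/
structure IsLogAdmissible (g : ℂ → ℂ) (gc : ℕ → ℝ) (ρ : ℝ) (a b δ : ℝ → ℝ) : Prop where
  rho_pos : 0 < ρ
  coeff_nonneg : ∀ n, 0 ≤ gc n
  series : ∀ z : ℂ, ‖z‖ < ρ → HasSum (fun n => (gc n : ℂ) * z ^ n) (g z)
  radius : ∀ t : ℝ, ρ < t → ¬ Summable fun n => gc n * t ^ n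
  a_nonneg : ∀ r ∈ Set.Ico (0 : ℝ) ρ, 0 ≤ a r
  b_nonneg : ∀ r ∈ Set.Ico (0 : ℝ) ρ, 0 ≤ b r
  delta_pos : ∀ r ∈ Set.Ico (0 : ℝ) ρ, 0 < δ r
  /-- approximation: `g(re^{iφ}) = g(r) + iφa(r) - φ²b(r)/2 + R(r,φ)` with
  `R(r,φ) = o(φ³ δ(r)⁻³)` uniformly in `φ` as `r → ρ`. -/
  approx : ∃ ε : ℝ → ℝ, Tendsto ε (𝓝[<] ρ) (𝓝 0) ∧
    ∀ r ∈ Set.Ico (0 : ℝ) ρ, ∀ φ : ℝ, |φ| ≤ δ r →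
      ‖g (r * Complex.exp (φ * Complex.I)) -
          (g r + φ * Complex.I * a r - (φ : ℂ) ^ 2 / 2 * b r)‖ ≤
        ε r * |φ| ^ 3 * (δ r)⁻¹ ^ 3
  a_div : Tendsto a (𝓝[<] ρ) atTop
  b_div : Tendsto b (𝓝[<] ρ) atTop
  delta_lim : Tendsto δ (𝓝[<] ρ) (𝓝 0)
  width : ∀ ε : ℝ, 0 < ε →
    Tendsto (fun r => ε * δ r ^ 2 * b r - Real.log (b r)) (𝓝[<] ρ) atTop
  mono : ∀ r ∈ Set.Ico (0 : ℝ) ρ, ∀ φ : ℝ, δ r < |φ| → |φ| ≤ Real.pi →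
    (g (r * Complex.exp (φ * Complex.I))).re ≤
      max (g (r * Complex.exp (δ r * Complex.I))).re
        (g (r * Complex.exp (-δ r * Complex.I))).re

/-- The technical condition (*): `|r_x^{(k)}| x^k ≲ |r_x^{(k-1)}| x^{k-1}` for
all sufficiently large `x` and `2 ≤ k ≤ 4`. -/
def TechCond (r : ℝ → ℝ) : Prop :=
  ∃ C > 0, ∃ x₀ : ℝ, ∀ x ≥ x₀, ∀ k : ℕ, 2 ≤ k → k ≤ 4 →
    |iteratedDeriv k r x| * x ^ k ≤ C * |iteratedDeriv (k - 1) r x| * x ^ (k - 1)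

/-- If `f 0 = 0` and `‖f' ψ‖ ≤ K |ψ|^j` on the symmetric interval `(-L, L)`, then
`‖f φ‖ ≤ K |φ|^(j+1)` there. -/
lemma norm_le_pow_succ_of_norm_deriv_le {E : Type*} [NormedAddCommGroup E] [NormedSpace ℝ E]
    {f f' : ℝ → E} {K L : ℝ} {j : ℕ} (hK : 0 ≤ K) (h0 : f 0 = 0)
    (hf : ∀ ψ, |ψ| < L → HasDerivAt f (f' ψ) ψ) (hb : ∀ ψ, |ψ| < L → ‖f' ψ‖ ≤ K * |ψ| ^ j)
    {φ : ℝ} (hφ : |φ| < L) : ‖f φ‖ ≤ K * |φ| ^ (j + 1) := by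
  have hle : ∀ ψ ∈ Set.uIcc 0 φ, |ψ| ≤ |φ| := fun ψ hψ => by
    simpa using Set.abs_sub_left_of_mem_uIcc hψ
  have key := Convex.norm_image_sub_le_of_norm_hasDerivWithin_le (𝕜 := ℝ) (f := f) (f' := f')
    (s := Set.uIcc 0 φ) (C := K * |φ| ^ j)
    (fun ψ hψ => (hf ψ ((hle ψ hψ).trans_lt hφ)).hasDerivWithinAt)
    (fun ψ hψ => (hb ψ ((hle ψ hψ).trans_lt hφ)).trans
      (mul_le_mul_of_nonneg_left (pow_le_pow_left₀ (abs_nonneg ψ) (hle ψ hψ) j) hK))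
    (convex_uIcc 0 φ) Set.left_mem_uIcc Set.right_mem_uIcc
  rw [h0, sub_zero, sub_zero, Real.norm_eq_abs] at key
  calc ‖f φ‖ ≤ _ := key
    _ = _ := by ring

/-- The `k`-th moment series `Σ_j j^k c_j z^j`. -/
def momC (c : ℕ → ℝ) (k : ℕ) (z : ℂ) : ℂ := ∑' j : ℕ, (((j : ℝ) ^ k * c j : ℝ) : ℂ) * z ^ j

/-- The `k`-th moment series `Σ_j j^k c_j t^j` at a real argument. -/
def momR (c : ℕ → ℝ) (k : ℕ) (t : ℝ) : ℝ := ∑' j : ℕ, (j : ℝ) ^ k * c j * t ^ j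

/-- Nonnegative coefficients whose power series converges on `[0, ρ)`. -/
structure PosSeries (c : ℕ → ℝ) (ρ : ℝ) : Prop where
  nonneg : ∀ j, 0 ≤ c j
  summable : ∀ t ∈ Set.Ico (0 : ℝ) ρ, Summable fun j => c j * t ^ j

namespace PosSeries

variable {c : ℕ → ℝ} {ρ : ℝ}

lemma summable_mom (h : PosSeries c ρ) (k : ℕ) {t : ℝ} (ht : t ∈ Set.Ico (0 : ℝ) ρ) :
    Summable fun j : ℕ => (j : ℝ) ^ k * c j * t ^ j := by
  obtain ⟨u, htu, huρ⟩ := exists_between ht.2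
  have hu0 : 0 < u := ht.1.trans_lt htu
  have hsum := h.summable u ⟨hu0.le, huρ⟩
  have hq : Summable fun n : ℕ => (n : ℝ) ^ k * (t / u) ^ n :=
    summable_pow_mul_geometric_of_norm_lt_one k (by
      rw [Real.norm_eq_abs, abs_of_nonneg (div_nonneg ht.1 hu0.le), div_lt_one hu0]; exact htu)
  obtain ⟨C, hC⟩ := hq.tendsto_atTop_zero.bddAbove_range
  refine Summable.of_nonneg_of_le (fun j => ?_) (fun j => ?_) (hsum.mul_left C)
  · have := h.nonneg j; have := ht.1; positivity
  · have h1 : (j : ℝ) ^ k * (t / u) ^ j ≤ C := hC ⟨j, rfl⟩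
    calc (j : ℝ) ^ k * c j * t ^ j = ((j : ℝ) ^ k * (t / u) ^ j) * (c j * u ^ j) := by
          rw [div_pow]; field_simp
      _ ≤ C * (c j * u ^ j) := by
          have := h.nonneg j
          gcongr

lemma norm_term (h : PosSeries c ρ) (k j : ℕ) (z : ℂ) :
    ‖(((j : ℝ) ^ k * c j : ℝ) : ℂ) * z ^ j‖ = (j : ℝ) ^ k * c j * ‖z‖ ^ j := by
  have := h.nonneg j
  rw [norm_mul, norm_pow, Complex.norm_real, Real.norm_of_nonneg (by positivity)]

lemma summable_momC (h : PosSeries c ρ) (k : ℕ) {z : ℂ} (hz : ‖z‖ < ρ) :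
    Summable fun j : ℕ => (((j : ℝ) ^ k * c j : ℝ) : ℂ) * z ^ j := by
  refine Summable.of_norm ?_
  simp_rw [h.norm_term]
  exact h.summable_mom k ⟨norm_nonneg z, hz⟩

lemma norm_momC_le (h : PosSeries c ρ) (k : ℕ) {z : ℂ} (hz : ‖z‖ < ρ) :
    ‖momC c k z‖ ≤ momR c k ‖z‖ := by
  have hs := h.summable_mom k ⟨norm_nonneg z, hz⟩
  refine (norm_tsum_le_tsum_norm ?_).trans_eq ?_
  · simpa only [h.norm_term] using hs
  · simp only [h.norm_term, momR]

lemma momC_ofReal (c : ℕ → ℝ) (k : ℕ) (t : ℝ) : momC c k (t : ℂ) = (momR c k t : ℂ) := by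
  simp only [momC, momR]
  push_cast
  rfl

lemma momR_nonneg (h : PosSeries c ρ) (k : ℕ) {t : ℝ} (ht : 0 ≤ t) : 0 ≤ momR c k t :=
  tsum_nonneg fun j => by have := h.nonneg j; positivity

lemma exists_hasDerivAt_momC (h : PosSeries c ρ) (k : ℕ) {z : ℂ} (hz : ‖z‖ < ρ) :
    ∃ d, HasDerivAt (momC c k) d z ∧ z * d = momC c (k + 1) z := by
  obtain ⟨u, hzu, huρ⟩ := exists_between hz
  have hu0 : 0 ≤ u := (norm_nonneg z).trans hzu.le
  have hu := h.summable_mom k ⟨hu0, huρ⟩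
  have hle : ∀ (i : ℕ) (w : ℂ), w ∈ Metric.ball (0 : ℂ) u →
      ‖(((i : ℝ) ^ k * c i : ℝ) : ℂ) * w ^ i‖ ≤ (i : ℝ) ^ k * c i * u ^ i := fun i w hw => by
    rw [h.norm_term]
    have := h.nonneg i
    have : ‖w‖ ≤ u := by simpa using (Metric.mem_ball.1 hw).le
    gcongr
  have hzb : z ∈ Metric.ball (0 : ℂ) u := by simpa using hzu
  have hd : ∀ i : ℕ, DifferentiableOn ℂ (fun w : ℂ => (((i : ℝ) ^ k * c i : ℝ) : ℂ) * w ^ i)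
      (Metric.ball (0 : ℂ) u) := fun i => by fun_prop
  have hder := Complex.hasSum_deriv_of_summable_norm hu hd Metric.isOpen_ball hle hzb
  have hdiff := Complex.differentiableOn_tsum_of_summable_norm hu hd Metric.isOpen_ball hle
  refine ⟨_, (hdiff.differentiableAt (Metric.isOpen_ball.mem_nhds hzb)).hasDerivAt, ?_⟩
  have h2 := hder.mul_left z
  rw [← h2.tsum_eq, momC]
  refine tsum_congr fun j => ?_
  rw [deriv_const_mul _ (by fun_prop)]
  rcases j with _ | j
  · simp
  · simp
    ring

/-- The moment series along the circle of radius `t`. -/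
def _root_.momArc (c : ℕ → ℝ) (t : ℝ) (k : ℕ) (φ : ℝ) : ℂ :=
  momC c k (t * Complex.exp (φ * Complex.I))

lemma norm_arc {t : ℝ} (ht : 0 ≤ t) (φ : ℝ) : ‖(t : ℂ) * Complex.exp (φ * Complex.I)‖ = t := by
  rw [norm_mul, Complex.norm_exp_ofReal_mul_I, mul_one, Complex.norm_real, Real.norm_of_nonneg ht]

lemma hasDerivAt_momArc (h : PosSeries c ρ) {t : ℝ} (ht : t ∈ Set.Ico (0 : ℝ) ρ) (k : ℕ) (φ : ℝ) :
    HasDerivAt (momArc c t k) (Complex.I * momArc c t (k + 1) φ) φ := by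
  obtain ⟨d, hd, hd'⟩ := h.exists_hasDerivAt_momC k
    (z := (t : ℂ) * Complex.exp (φ * Complex.I)) (by rw [norm_arc ht.1]; exact ht.2)
  have h1 : HasDerivAt (fun φ : ℝ => (t : ℂ) * Complex.exp (φ * Complex.I))
      ((t : ℂ) * (Complex.exp (φ * Complex.I) * (1 * Complex.I))) φ :=
    (((Complex.ofRealCLM.hasDerivAt (x := φ)).mul_const Complex.I).cexp).const_mul _
  have h2 := hd.comp φ h1
  refine h2.congr_deriv ?_
  rw [momArc, ← hd']
  ring

lemma norm_momArc_le (h : PosSeries c ρ) {t : ℝ} (ht : t ∈ Set.Ico (0 : ℝ) ρ) (k : ℕ) (φ : ℝ) :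
    ‖momArc c t k φ‖ ≤ momR c k t := by
  have := h.norm_momC_le k (z := (t : ℂ) * Complex.exp (φ * Complex.I))
    (by rw [norm_arc ht.1]; exact ht.2)
  rwa [norm_arc ht.1] at this

lemma momArc_zero (c : ℕ → ℝ) (t : ℝ) (k : ℕ) : momArc c t k 0 = (momR c k t : ℂ) := by
  simp [momArc, momC_ofReal]

lemma momArc_pi (c : ℕ → ℝ) (t : ℝ) (k : ℕ) :
    momArc c t k (-Real.pi) = momArc c t k Real.pi := by
  simp [momArc, Complex.exp_neg]

lemma hasDerivAt_momR (h : PosSeries c ρ) {t : ℝ} (ht : t ∈ Set.Ioo (0 : ℝ) ρ) (k : ℕ) :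
    HasDerivAt (momR c k) (momR c (k + 1) t / t) t := by
  obtain ⟨d, hd, hd'⟩ := h.exists_hasDerivAt_momC k (z := (t : ℂ))
    (by rw [Complex.norm_real, Real.norm_of_nonneg ht.1.le]; exact ht.2)
  have hr := hd.real_of_complex
  rw [momC_ofReal] at hd'
  have ht0 : (t : ℂ) ≠ 0 := by exact_mod_cast ht.1.ne'
  have hdd : d = ((momR c (k + 1) t / t : ℝ) : ℂ) := by
    push_cast; rw [← hd']; field_simp
  rw [hdd, Complex.ofReal_re] at hr
  exact hr.congr_of_eventuallyEq (Eventually.of_forall fun x => by simp [momC_ofReal])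

/-- First and second order Taylor bounds along the circle. -/
lemma norm_momArc_sub_le (h : PosSeries c ρ) {t : ℝ} (ht : t ∈ Set.Ico (0 : ℝ) ρ) (k : ℕ) (φ : ℝ) :
    ‖momArc c t k φ - momR c k t‖ ≤ momR c (k + 1) t * |φ| := by
  have := norm_le_pow_succ_of_norm_deriv_le (L := |φ| + 1) (j := 0)
    (f := fun φ => momArc c t k φ - momR c k t)
    (h.momR_nonneg (k + 1) ht.1) (by simp [momArc_zero])
    (fun ψ _ => (h.hasDerivAt_momArc ht k ψ).sub_const _)
    (fun ψ _ => by simpa using h.norm_momArc_le ht (k + 1) ψ) (φ := φ) (by linarith)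
  simpa using this

lemma norm_momArc_sub_sub_le (h : PosSeries c ρ) {t : ℝ} (ht : t ∈ Set.Ico (0 : ℝ) ρ) (k : ℕ)
    (φ : ℝ) :
    ‖momArc c t k φ - momR c k t - φ * (Complex.I * momR c (k + 1) t)‖ ≤
      momR c (k + 2) t * |φ| ^ 2 := by
  refine norm_le_pow_succ_of_norm_deriv_le (L := |φ| + 1) (j := 1)
    (f := fun φ : ℝ => momArc c t k φ - momR c k t - φ * (Complex.I * momR c (k + 1) t))
    (f' := fun φ => Complex.I * (momArc c t (k + 1) φ - momR c (k + 1) t))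
    (h.momR_nonneg (k + 2) ht.1) (by simp [momArc_zero])
    (fun ψ _ => ?_) (fun ψ _ => ?_) (by linarith)
  · refine (((h.hasDerivAt_momArc ht k ψ).sub_const _).sub
      ((Complex.ofRealCLM.hasDerivAt (x := ψ)).mul_const _)).congr_deriv ?_
    simp
    ring
  · simpa using h.norm_momArc_sub_le ht (k + 1) ψ

lemma norm_momArc_sub_sub_add_le (h : PosSeries c ρ) {t : ℝ} (ht : t ∈ Set.Ico (0 : ℝ) ρ) (k : ℕ)
    (φ : ℝ) :
    ‖momArc c t k φ - momR c k t - φ * (Complex.I * momR c (k + 1) t)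
        + (φ : ℂ) ^ 2 / 2 * momR c (k + 2) t‖ ≤ momR c (k + 3) t * |φ| ^ 3 := by
  refine norm_le_pow_succ_of_norm_deriv_le (L := |φ| + 1) (j := 2)
    (f := fun φ : ℝ => momArc c t k φ - momR c k t - φ * (Complex.I * momR c (k + 1) t)
        + (φ : ℂ) ^ 2 / 2 * momR c (k + 2) t)
    (f' := fun φ => Complex.I * (momArc c t (k + 1) φ - momR c (k + 1) t
      - φ * (Complex.I * momR c (k + 2) t)))
    (h.momR_nonneg (k + 3) ht.1) (by simp [momArc_zero])
    (fun ψ _ => ?_) (fun ψ _ => ?_) (by linarith)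
  · refine ((((h.hasDerivAt_momArc ht k ψ).sub_const _).sub
      ((Complex.ofRealCLM.hasDerivAt (x := ψ)).mul_const _)).add
      ((((Complex.ofRealCLM.hasDerivAt (x := ψ)).pow 2).div_const 2).mul_const _)).congr_deriv ?_
    simp
    ring_nf
    simp
  · simpa using h.norm_momArc_sub_sub_le ht (k + 1) ψ

end PosSeries

/-- The saddle point weight `exp (w (g(te^{iφ}) - g(t) - iφ a(t)))`. -/
def arcWeight (c : ℕ → ℝ) (t w φ : ℝ) : ℂ :=
  Complex.exp (w * (momArc c t 0 φ - momR c 0 t - φ * (Complex.I * momR c 1 t)))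

/-- The average of `f` against the complex saddle point weight. -/
def arcAvg (c : ℕ → ℝ) (t w : ℝ) (f : ℝ → ℂ) : ℂ :=
  (∫ φ in (-Real.pi)..Real.pi, f φ * arcWeight c t w φ) /
    ∫ φ in (-Real.pi)..Real.pi, arcWeight c t w φ

namespace PosSeries

variable {c : ℕ → ℝ} {ρ t w : ℝ}

lemma continuous_momArc (h : PosSeries c ρ) (ht : t ∈ Set.Ico (0 : ℝ) ρ) (k : ℕ) :
    Continuous (momArc c t k) :=
  continuous_iff_continuousAt.2 fun φ => (h.hasDerivAt_momArc ht k φ).continuousAt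

lemma hasDerivAt_arcWeight (h : PosSeries c ρ) (ht : t ∈ Set.Ico (0 : ℝ) ρ) (φ : ℝ) :
    HasDerivAt (arcWeight c t w)
      (Complex.I * w * (momArc c t 1 φ - momR c 1 t) * arcWeight c t w φ) φ := by
  have h1 := (((((h.hasDerivAt_momArc ht 0 φ).sub_const (momR c 0 t : ℂ)).sub
    ((Complex.ofRealCLM.hasDerivAt (x := φ)).mul_const (Complex.I * momR c 1 t))).const_mul
      (w : ℂ))).cexp
  refine h1.congr_deriv ?_
  simp [arcWeight]
  ring

lemma continuous_arcWeight (h : PosSeries c ρ) (ht : t ∈ Set.Ico (0 : ℝ) ρ) :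
    Continuous (arcWeight c t w) :=
  continuous_iff_continuousAt.2 fun φ => (h.hasDerivAt_arcWeight ht φ).continuousAt

lemma arcWeight_pi {n : ℕ} (hn : (n : ℝ) = w * momR c 1 t) :
    arcWeight c t w (-Real.pi) = arcWeight c t w Real.pi := by
  rw [arcWeight, arcWeight, momArc_pi, Complex.exp_eq_exp_iff_exists_int]
  refine ⟨n, ?_⟩
  have hn' : (w : ℂ) * (momR c 1 t : ℂ) = n := by exact_mod_cast hn.symm
  push_cast
  linear_combination (2 * Real.pi * Complex.I) * hn'

lemma arcAvg_add (h : PosSeries c ρ) (ht : t ∈ Set.Ico (0 : ℝ) ρ) {f g : ℝ → ℂ}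
    (hf : Continuous f) (hg : Continuous g) :
    arcAvg c t w (fun φ => f φ + g φ) = arcAvg c t w f + arcAvg c t w g := by
  have hW := h.continuous_arcWeight (w := w) ht
  simp only [arcAvg, add_mul]
  rw [intervalIntegral.integral_add (by apply Continuous.intervalIntegrable; fun_prop)
    (by apply Continuous.intervalIntegrable; fun_prop), add_div]

lemma arcAvg_const_mul (k : ℂ) (f : ℝ → ℂ) :
    arcAvg c t w (fun φ => k * f φ) = k * arcAvg c t w f := by
  rw [arcAvg, arcAvg, ← mul_div_assoc, ← intervalIntegral.integral_const_mul]
  simp only [mul_assoc]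

lemma arcAvg_const (hZ : ∫ φ in (-Real.pi)..Real.pi, arcWeight c t w φ ≠ 0) (k : ℂ) :
    arcAvg c t w (fun _ => k) = k := by
  rw [arcAvg, intervalIntegral.integral_const_mul, mul_div_cancel_right₀ _ hZ]

/-- Integration by parts along the circle. -/
lemma arcAvg_stein (h : PosSeries c ρ) (ht : t ∈ Set.Ico (0 : ℝ) ρ) {n : ℕ}
    (hn : (n : ℝ) = w * momR c 1 t) {f f' : ℝ → ℂ}
    (hf : ∀ φ, HasDerivAt f (Complex.I * f' φ) φ) (hf' : Continuous f')
    (hp : f (-Real.pi) = f Real.pi) :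
    arcAvg c t w f' = -w * arcAvg c t w (fun φ => f φ * (momArc c t 1 φ - momR c 1 t)) := by
  have hW := h.continuous_arcWeight (w := w) ht
  have hfc : Continuous f := continuous_iff_continuousAt.2 fun φ => (hf φ).continuousAt
  have hA := h.continuous_momArc ht 1
  have key := intervalIntegral.integral_eq_sub_of_hasDerivAt (a := -Real.pi) (b := Real.pi)
    (f := fun φ => f φ * arcWeight c t w φ)
    (fun φ _ => (hf φ).mul (h.hasDerivAt_arcWeight ht φ)) (by
      apply Continuous.intervalIntegrable; fun_prop)
  rw [hp, arcWeight_pi hn, sub_self] at key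
  have h2 : ∫ φ in (-Real.pi)..Real.pi, (Complex.I * f' φ * arcWeight c t w φ + f φ *
      (Complex.I * w * (momArc c t 1 φ - momR c 1 t) * arcWeight c t w φ)) =
      Complex.I * ((∫ φ in (-Real.pi)..Real.pi, f' φ * arcWeight c t w φ) + w *
        ∫ φ in (-Real.pi)..Real.pi, f φ * (momArc c t 1 φ - momR c 1 t) * arcWeight c t w φ) := by
    rw [← intervalIntegral.integral_const_mul, ← intervalIntegral.integral_add,
      ← intervalIntegral.integral_const_mul]
    · congr 1; ext φ; ring
    · apply Continuous.intervalIntegrable; fun_prop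
    · apply Continuous.intervalIntegrable; fun_prop
  rw [h2] at key
  have h3 := (mul_eq_zero.1 key).resolve_left Complex.I_ne_zero
  rw [arcAvg, arcAvg, eq_neg_of_add_eq_zero_left h3]
  ring

lemma norm_arcAvg_le (h : PosSeries c ρ) (ht : t ∈ Set.Ico (0 : ℝ) ρ)
    (hZ : ∫ φ in (-Real.pi)..Real.pi, arcWeight c t w φ ≠ 0) {k : ℕ} {B K : ℝ} (hB : 0 ≤ B)
    (hK : ∫ φ in (-Real.pi)..Real.pi, |φ| ^ k * ‖arcWeight c t w φ‖ ≤
      K * ‖∫ φ in (-Real.pi)..Real.pi, arcWeight c t w φ‖)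
    {f : ℝ → ℂ} (hf : Continuous f) (hb : ∀ φ, ‖f φ‖ ≤ B * |φ| ^ k) :
    ‖arcAvg c t w f‖ ≤ B * K := by
  have hW := h.continuous_arcWeight (w := w) ht
  have hpi : -Real.pi ≤ Real.pi := by linarith [Real.pi_pos]
  rw [arcAvg, norm_div, div_le_iff₀ (norm_pos_iff.2 hZ), mul_assoc]
  calc ‖∫ φ in (-Real.pi)..Real.pi, f φ * arcWeight c t w φ‖
      ≤ ∫ φ in (-Real.pi)..Real.pi, ‖f φ * arcWeight c t w φ‖ :=
        intervalIntegral.norm_integral_le_integral_norm hpi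
    _ ≤ ∫ φ in (-Real.pi)..Real.pi, B * (|φ| ^ k * ‖arcWeight c t w φ‖) := by
        refine intervalIntegral.integral_mono_on hpi ?_ ?_ fun φ _ => ?_
        · apply Continuous.intervalIntegrable; fun_prop
        · apply Continuous.intervalIntegrable; fun_prop
        · rw [norm_mul, ← mul_assoc]
          exact mul_le_mul_of_nonneg_right (hb φ) (norm_nonneg _)
    _ = B * ∫ φ in (-Real.pi)..Real.pi, |φ| ^ k * ‖arcWeight c t w φ‖ :=
        intervalIntegral.integral_const_mul _ _
    _ ≤ _ := by gcongr

/-- Control of the first three centred moments of `g` under the saddle point weight. -/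
lemma arcAvg_bounds (h : PosSeries c ρ) (ht : t ∈ Set.Ico (0 : ℝ) ρ) {n : ℕ}
    (hn : (n : ℝ) = w * momR c 1 t) {w₀ K C : ℝ} (hw₀ : 0 < w₀) (hw : w₀ ≤ w) (hC : 0 ≤ C)
    (hK0 : 0 ≤ K)
    (ha : 0 < momR c 1 t) (hb : 0 < momR c 2 t)
    (hc : momR c 3 t ≤ C * (momR c 2 t ^ 2 / momR c 1 t))
    (hd : momR c 4 t ≤ C * (momR c 2 t ^ 3 / momR c 1 t ^ 2))
    (hZ : ∫ φ in (-Real.pi)..Real.pi, arcWeight c t w φ ≠ 0)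
    (hK2 : ∫ φ in (-Real.pi)..Real.pi, |φ| ^ 2 * ‖arcWeight c t w φ‖ ≤
      K / momR c 2 t * ‖∫ φ in (-Real.pi)..Real.pi, arcWeight c t w φ‖)
    (hK4 : ∫ φ in (-Real.pi)..Real.pi, |φ| ^ 4 * ‖arcWeight c t w φ‖ ≤
      K / momR c 2 t ^ 2 * ‖∫ φ in (-Real.pi)..Real.pi, arcWeight c t w φ‖) :
    ‖arcAvg c t w (fun φ => momArc c t 0 φ - momR c 0 t)‖ ≤ (1 + C) * K ∧
    ‖arcAvg c t w (fun φ => (momArc c t 0 φ - momR c 0 t) ^ 2) +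
      (momR c 1 t ^ 2 / (w * momR c 2 t) : ℝ)‖ ≤ (1 + C) ^ 2 * K + (C + C ^ 2) * K / w₀ ∧
    ‖arcAvg c t w (fun φ => (momArc c t 0 φ - momR c 0 t) ^ 3)‖ ≤
      (2 / w₀ * ((1 + C) * K + 1 / w₀) + (1 + C) * K) * (momR c 1 t ^ 2 / momR c 2 t) := by
  have hw0 : 0 < w := hw₀.trans_le hw
  have hwC : (w : ℂ) ≠ 0 := by exact_mod_cast hw0.ne'
  obtain ⟨γ, hγ⟩ : ∃ γ : ℕ → ℝ → ℂ, ∀ k, γ k = momArc c t k := ⟨_, fun _ => rfl⟩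
  have hγc : ∀ k, Continuous (γ k) := fun k => by rw [hγ]; exact h.continuous_momArc ht k
  have hγ0 := hγc 0
  have hγ1 := hγc 1
  have hγ2 := hγc 2
  have hd0 : ∀ k φ, HasDerivAt (γ k) (Complex.I * γ (k + 1) φ) φ := fun k φ => by
    rw [hγ, hγ]; exact h.hasDerivAt_momArc ht k φ
  have hγp : ∀ k, γ k (-Real.pi) = γ k Real.pi := fun k => by rw [hγ]; exact momArc_pi c t k
  have hT0 : ∀ φ, ‖γ 0 φ - momR c 0 t‖ ≤ momR c 1 t * |φ| := fun φ => by
    rw [hγ]; exact h.norm_momArc_sub_le ht 0 φ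
  have hT : ∀ k φ, ‖γ k φ - momR c k t - φ * (Complex.I * momR c (k + 1) t)‖ ≤
      momR c (k + 2) t * |φ| ^ 2 := fun k φ => by
    rw [hγ]; exact h.norm_momArc_sub_sub_le ht k φ
  have stein : ∀ {f f' : ℝ → ℂ}, (∀ φ, HasDerivAt f (Complex.I * f' φ) φ) → Continuous f' →
      f (-Real.pi) = f Real.pi →
      arcAvg c t w f' = -w * arcAvg c t w (fun φ => f φ * (γ 1 φ - momR c 1 t)) := by
    intro f f' h1 h2 h3
    rw [hγ]; exact h.arcAvg_stein ht hn h1 h2 h3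
  rw [← hγ]
  have hT00 := hT 0
  have hT1 := hT 1
  have hT2 := hT 2
  norm_num at hT00 hT1 hT2
  have hc0 := h.momR_nonneg 3 ht.1
  have hd0' := h.momR_nonneg 4 ht.1
  generalize momR c 0 t = m at *
  generalize momR c 1 t = a at *
  generalize momR c 2 t = b at *
  generalize momR c 3 t = e at *
  generalize momR c 4 t = d at *
  have haC : (a : ℂ) ≠ 0 := by exact_mod_cast ha.ne'
  have hbC : (b : ℂ) ≠ 0 := by exact_mod_cast hb.ne'
  have hD : arcAvg c t w (fun φ => γ 1 φ - a) = 0 := by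
    have := stein (f := fun _ => 1) (f' := fun _ => 0)
      (fun φ => by simpa using hasDerivAt_const φ 1)
      continuous_const rfl
    rw [arcAvg_const hZ] at this
    simpa [hwC] using this
  set E : ℝ → ℂ := fun φ => (γ 0 φ - m) - (a / b : ℂ) * (γ 1 φ - a) with hE
  set E₂ : ℝ → ℂ := fun φ => (γ 2 φ - b) - (e / b : ℂ) * (γ 1 φ - a) with hE₂
  have hEc : Continuous E := by fun_prop
  have hE₂c : Continuous E₂ := by fun_prop
  have hEb : ∀ φ, ‖E φ‖ ≤ (1 + C) * b * |φ| ^ 2 := by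
    intro φ
    have e1 : E φ = (γ 0 φ - m - φ * (Complex.I * a)) -
        (a / b : ℝ) * (γ 1 φ - a - φ * (Complex.I * b)) := by
      simp only [hE]; push_cast; field_simp; ring
    rw [e1]
    refine (norm_sub_le _ _).trans ?_
    rw [norm_mul, Complex.norm_real, Real.norm_of_nonneg (by positivity)]
    have : a / b * e ≤ C * b := by
      calc a / b * e ≤ a / b * (C * (b ^ 2 / a)) := by gcongr
        _ = C * b := by field_simp
    calc _ ≤ b * |φ| ^ 2 + a / b * (e * |φ| ^ 2) := by
          gcongr
          · simpa using hT00 φ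
          · simpa using hT1 φ
      _ = (b + a / b * e) * |φ| ^ 2 := by ring
      _ ≤ (b + C * b) * |φ| ^ 2 := by gcongr
      _ = _ := by ring
  have hE₂b : ∀ φ, ‖E₂ φ‖ ≤ (C + C ^ 2) * (b ^ 3 / a ^ 2) * |φ| ^ 2 := by
    intro φ
    have e1 : E₂ φ = (γ 2 φ - b - φ * (Complex.I * e)) -
        (e / b : ℝ) * (γ 1 φ - a - φ * (Complex.I * b)) := by
      simp only [hE₂]; push_cast; field_simp; ring
    rw [e1]
    refine (norm_sub_le _ _).trans ?_
    rw [norm_mul, Complex.norm_real, Real.norm_of_nonneg (by positivity)]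
    have : e / b * e ≤ C ^ 2 * (b ^ 3 / a ^ 2) := by
      calc e / b * e ≤ (C * (b ^ 2 / a)) / b * (C * (b ^ 2 / a)) := by gcongr
        _ = _ := by field_simp
    calc _ ≤ d * |φ| ^ 2 + e / b * (e * |φ| ^ 2) := by
          gcongr
          · simpa using hT2 φ
          · simpa using hT1 φ
      _ = (d + e / b * e) * |φ| ^ 2 := by ring
      _ ≤ (C * (b ^ 3 / a ^ 2) + C ^ 2 * (b ^ 3 / a ^ 2)) * |φ| ^ 2 := by gcongr
      _ = _ := by ring
  -- first moment
  have hG : arcAvg c t w (fun φ => γ 0 φ - m) = arcAvg c t w E := by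
    have : (fun φ => γ 0 φ - (m : ℂ)) = fun φ => E φ + (a / b : ℂ) * (γ 1 φ - a) := by
      ext φ; simp only [hE]; ring
    rw [this, h.arcAvg_add ht hEc (by fun_prop), arcAvg_const_mul, hD, mul_zero, add_zero]
  have hEavg : ‖arcAvg c t w E‖ ≤ (1 + C) * K := by
    have := h.norm_arcAvg_le ht hZ (by positivity) hK2 hEc hEb
    calc _ ≤ _ := this
      _ = _ := by field_simp
  have hB : arcAvg c t w (fun φ => γ 2 φ - b) = arcAvg c t w E₂ := by
    have : (fun φ => γ 2 φ - (b : ℂ)) = fun φ => E₂ φ + (e / b : ℂ) * (γ 1 φ - a) := by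
      ext φ; simp only [hE₂]; ring
    rw [this, h.arcAvg_add ht hE₂c (by fun_prop), arcAvg_const_mul, hD, mul_zero, add_zero]
  have hE₂avg : ‖arcAvg c t w E₂‖ ≤ (C + C ^ 2) * K * (b ^ 2 / a ^ 2) := by
    have := h.norm_arcAvg_le ht hZ (by positivity) hK2 hE₂c hE₂b
    calc _ ≤ _ := this
      _ = _ := by field_simp
  have hγ1avg : arcAvg c t w (γ 1) = a := by
    have : γ 1 = fun φ => (γ 1 φ - a) + (a : ℂ) := by ext φ; ring
    rw [this, h.arcAvg_add ht (by fun_prop) (by fun_prop), hD, arcAvg_const hZ, zero_add]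
  have hGD : (w : ℂ) * arcAvg c t w (fun φ => (γ 0 φ - m) * (γ 1 φ - a)) = -a := by
    have := stein (f := fun φ => γ 0 φ - m) (f' := γ 1) (fun φ => (hd0 0 φ).sub_const _)
      (by fun_prop) (by simp only [hγp])
    rw [hγ1avg] at this
    linear_combination this
  have hED : (w : ℂ) * arcAvg c t w (fun φ => E φ * (γ 1 φ - a)) =
      (a / b : ℂ) * arcAvg c t w E₂ := by
    have := stein (f := E) (f' := fun φ => (γ 1 φ - a) + (-(a / b : ℂ)) * (γ 2 φ - b)) (fun φ => by
      refine (((hd0 0 φ).sub_const _).sub (((hd0 1 φ).sub_const _).const_mul _)).congr_deriv ?_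
      norm_num
      field_simp
      ring) (by fun_prop) (by simp only [hE, hγp])
    rw [h.arcAvg_add ht (by fun_prop) (by fun_prop), arcAvg_const_mul, hD, hB] at this
    linear_combination this
  -- second moment
  have hEE : ‖arcAvg c t w (fun φ => E φ ^ 2)‖ ≤ (1 + C) ^ 2 * K := by
    have := h.norm_arcAvg_le ht hZ (B := ((1 + C) * b) ^ 2) (by positivity) hK4
      (f := fun φ => E φ ^ 2) (by fun_prop) (fun φ => by
        rw [norm_pow]
        calc ‖E φ‖ ^ 2 ≤ ((1 + C) * b * |φ| ^ 2) ^ 2 := by gcongr; exact hEb φ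
          _ = _ := by ring)
    calc _ ≤ _ := this
      _ = _ := by field_simp
  have hEDn : ‖(a / b : ℂ) * arcAvg c t w (fun φ => E φ * (γ 1 φ - a))‖ ≤
      (C + C ^ 2) * K / w₀ := by
    have e1 : (a / b : ℂ) * arcAvg c t w (fun φ => E φ * (γ 1 φ - a)) =
        ((a / b) ^ 2 / w : ℝ) * arcAvg c t w E₂ := by
      push_cast
      field_simp at hED ⊢
      linear_combination hED
    rw [e1, norm_mul, Complex.norm_real, Real.norm_of_nonneg (by positivity)]
    calc (a / b) ^ 2 / w * ‖arcAvg c t w E₂‖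
        ≤ (a / b) ^ 2 / w * ((C + C ^ 2) * K * (b ^ 2 / a ^ 2)) := by gcongr
      _ = (C + C ^ 2) * K / w := by field_simp
      _ ≤ _ := by gcongr
  have hGG : arcAvg c t w (fun φ => (γ 0 φ - m) ^ 2) + (a ^ 2 / (w * b) : ℝ) =
      arcAvg c t w (fun φ => E φ ^ 2) +
        (a / b : ℂ) * arcAvg c t w (fun φ => E φ * (γ 1 φ - a)) := by
    have e1 : (fun φ => (γ 0 φ - (m : ℂ)) ^ 2) =
        fun φ => (a / b : ℂ) * ((γ 0 φ - m) * (γ 1 φ - a)) +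
        (E φ ^ 2 + (a / b : ℂ) * (E φ * (γ 1 φ - a))) := by
      ext φ; simp only [hE]; ring
    rw [e1, h.arcAvg_add ht (by fun_prop) (by fun_prop), h.arcAvg_add ht (by fun_prop)
      (by fun_prop), arcAvg_const_mul, arcAvg_const_mul]
    have e2 : arcAvg c t w (fun φ => (γ 0 φ - m) * (γ 1 φ - a)) = -a / w := by
      field_simp; linear_combination hGD
    rw [e2]
    push_cast
    field_simp
    ring
  -- third moment
  have hGGD : (w : ℂ) * arcAvg c t w (fun φ => (γ 0 φ - m) ^ 2 * (γ 1 φ - a)) =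
      -2 * (a * arcAvg c t w E - a / w) := by
    have := stein (f := fun φ => (γ 0 φ - m) ^ 2) (f' := fun φ => (2 * a : ℂ) * (γ 0 φ - m) +
        2 * ((γ 0 φ - m) * (γ 1 φ - a))) (fun φ => by
      refine (((hd0 0 φ).sub_const _).pow 2).congr_deriv ?_
      norm_num
      ring) (by fun_prop) (by simp only [hγp])
    rw [h.arcAvg_add ht (by fun_prop) (by fun_prop), arcAvg_const_mul, arcAvg_const_mul, hG] at this
    have e2 : arcAvg c t w (fun φ => (γ 0 φ - m) * (γ 1 φ - a)) = -a / w := by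
      field_simp; linear_combination hGD
    rw [e2] at this
    linear_combination this
  have hGGE : ‖arcAvg c t w (fun φ => (γ 0 φ - m) ^ 2 * E φ)‖ ≤ (1 + C) * K * (a ^ 2 / b) := by
    have := h.norm_arcAvg_le ht hZ (B := a ^ 2 * ((1 + C) * b)) (by positivity) hK4
      (f := fun φ => (γ 0 φ - m) ^ 2 * E φ) (by fun_prop) (fun φ => by
        rw [norm_mul, norm_pow]
        calc ‖γ 0 φ - m‖ ^ 2 * ‖E φ‖ ≤ (a * |φ|) ^ 2 * ((1 + C) * b * |φ| ^ 2) := by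
              gcongr
              · exact hT0 φ
              · exact hEb φ
          _ = _ := by ring)
    calc _ ≤ _ := this
      _ = _ := by field_simp
  have hGGG : arcAvg c t w (fun φ => (γ 0 φ - m) ^ 3) =
      (-(2 * a ^ 2 / (b * w)) : ℝ) * (arcAvg c t w E - (1 / w : ℝ)) +
        arcAvg c t w (fun φ => (γ 0 φ - m) ^ 2 * E φ) := by
    have e1 : (fun φ => (γ 0 φ - (m : ℂ)) ^ 3) = fun φ => (a / b : ℂ) * ((γ 0 φ - m) ^ 2 *
        (γ 1 φ - a)) + (γ 0 φ - m) ^ 2 * E φ := by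
      ext φ; simp only [hE]; ring
    rw [e1, h.arcAvg_add ht (by fun_prop) (by fun_prop), arcAvg_const_mul]
    push_cast
    field_simp at hGGD ⊢
    linear_combination a * hGGD
  refine ⟨by rw [hG]; exact hEavg, ?_, ?_⟩
  · rw [hGG]
    exact (norm_add_le _ _).trans (add_le_add hEE hEDn)
  · rw [hGGG]
    refine (norm_add_le _ _).trans ?_
    rw [norm_mul, Complex.norm_real, Real.norm_eq_abs, abs_neg, abs_of_nonneg (by positivity)]
    have h1 : ‖arcAvg c t w E - (1 / w : ℝ)‖ ≤ (1 + C) * K + 1 / w₀ := by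
      refine (norm_sub_le _ _).trans (add_le_add hEavg ?_)
      rw [Complex.norm_real, Real.norm_of_nonneg (by positivity)]
      gcongr
    calc _ ≤ 2 * a ^ 2 / (b * w₀) * ((1 + C) * K + 1 / w₀) + (1 + C) * K * (a ^ 2 / b) := by
          gcongr
      _ = _ := by field_simp

end PosSeries

lemma pow_le_sixteen_mul_exp_half {j : ℕ} (hj : j ≤ 2) {y : ℝ} (hy : 0 ≤ y) :
    y ^ j ≤ 16 * Real.exp (y / 2) := by
  have h1 : y / 4 ≤ Real.exp (y / 4) := by linarith [Real.add_one_le_exp (y / 4)]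
  have h2 : Real.exp (y / 2) = Real.exp (y / 4) ^ 2 := by
    rw [← Real.exp_nat_mul]; congr 1; push_cast; ring
  have h3 : 1 ≤ Real.exp (y / 4) := Real.one_le_exp (by linarith)
  rw [h2]
  interval_cases j <;> nlinarith

/-- Laplace's method on `[-π, π]`: a function which is Gaussian up to a bounded factor near `0`
and negligible away from `0` has absolute moments of the expected order. -/
lemma exists_laplace_bound (w₀ w₁ : ℝ) (hw₀ : 0 < w₀) :
    ∃ K : ℝ, 0 ≤ K ∧ ∀ (F : ℝ → ℂ) (b δ w : ℝ), Continuous F → w₀ ≤ w → w ≤ w₁ → 1 ≤ b →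
      8 * Real.pi * Real.exp (w₁ / 2) ≤ b → 0 < δ → 1 ≤ b * δ ^ 2 → δ ≤ Real.pi →
      (∀ φ, |φ| ≤ δ → ‖F φ‖ ≤ 2 * Real.exp (-(w * b / 2) * φ ^ 2)) →
      (∀ φ, δ < |φ| → |φ| ≤ Real.pi → ‖F φ‖ ≤ 2 * b⁻¹ ^ 3) →
      (∀ φ, |φ| ≤ δ → 1 / 2 * Real.exp (-(w * b / 2) * φ ^ 2) ≤ (F φ).re) →
      (∫ φ in (-Real.pi)..Real.pi, F φ) ≠ 0 ∧
      ∀ j, 1 ≤ j → j ≤ 2 → ∫ φ in (-Real.pi)..Real.pi, |φ| ^ (2 * j) * ‖F φ‖ ≤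
        K / b ^ j * ‖∫ φ in (-Real.pi)..Real.pi, F φ‖ := by
  set L : ℝ := 32 * (2 / w₀ + 1) ^ 2 * √(Real.pi / (w₀ / 4)) + 4 * Real.pi ^ 5 + 4 * Real.pi ^ 3
    with hL
  have hL0 : 0 ≤ L := by positivity
  refine ⟨L * (2 * Real.exp (w₁ / 2)), by positivity, ?_⟩
  intro F b δ w hF hw hw1 hb hb1 hδ hδb hδπ hP1 hP2 hP3
  have hπ := Real.pi_pos
  have hππ : -Real.pi ≤ Real.pi := by linarith
  have hw0 : 0 < w := hw₀.trans_le hw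
  have hb0 : 0 < b := by linarith
  obtain ⟨s, hs, hsb⟩ : ∃ s : ℝ, 1 ≤ s ∧ b = s ^ 2 :=
    ⟨√b, Real.one_le_sqrt.2 hb, (Real.sq_sqrt hb0.le).symm⟩
  have hs0 : 0 < s := by linarith
  have hβδ : s⁻¹ ≤ δ := by
    rw [hsb, ← mul_pow] at hδb
    have : 1 ≤ s * δ := by
      by_contra hcon
      push Not at hcon
      have : 0 ≤ s * δ := by positivity
      nlinarith
    rw [inv_le_iff_one_le_mul₀ hs0]; linarith
  have hβπ : s⁻¹ ≤ Real.pi := hβδ.trans hδπ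
  have hβ0 : 0 < s⁻¹ := by positivity
  have hre : Continuous fun φ => (F φ).re := Complex.continuous_re.comp hF
  have hii : ∀ p q, IntervalIntegrable (fun φ => (F φ).re) volume p q := fun p q =>
    hre.intervalIntegrable _ _
  -- lower bound for the total mass
  have hout : ∀ φ, |φ| ≤ Real.pi → -(2 * b⁻¹ ^ 3) ≤ (F φ).re := by
    intro φ hφ
    rcases le_or_gt |φ| δ with h | h
    · refine le_trans ?_ (hP3 φ h)
      have : 0 ≤ Real.exp (-(w * b / 2) * φ ^ 2) := (Real.exp_pos _).le
      have : 0 ≤ b⁻¹ ^ 3 := by positivity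
      linarith
    · exact (neg_le_neg (hP2 φ h hφ)).trans (abs_le.1 (Complex.abs_re_le_norm _)).1
  have hmid : ∀ φ, |φ| ≤ s⁻¹ → 1 / 2 * Real.exp (-(w₁ / 2)) ≤ (F φ).re := by
    intro φ hφ
    refine le_trans ?_ (hP3 φ (hφ.trans hβδ))
    gcongr
    have : φ ^ 2 ≤ s⁻¹ ^ 2 := sq_le_sq' (by linarith [abs_le.1 hφ]) (abs_le.1 hφ).2
    have h1 : b * φ ^ 2 ≤ 1 := by
      calc b * φ ^ 2 ≤ b * s⁻¹ ^ 2 := by gcongr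
        _ = 1 := by rw [hsb]; field_simp
    have : 0 ≤ b * φ ^ 2 := by positivity
    nlinarith
  have hlow : s⁻¹ / (2 * Real.exp (w₁ / 2)) ≤ (∫ φ in (-Real.pi)..Real.pi, F φ).re := by
    have hcre : (∫ φ in (-Real.pi)..Real.pi, F φ).re = ∫ φ in (-Real.pi)..Real.pi, (F φ).re := by
      have := Complex.reCLM.intervalIntegral_comp_comm (hF.intervalIntegrable (μ := volume)
        (-Real.pi) Real.pi)
      simpa using this.symm
    rw [hcre, ← intervalIntegral.integral_add_adjacent_intervals (hii (-Real.pi) (-s⁻¹))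
      (hii (-s⁻¹) Real.pi), ← intervalIntegral.integral_add_adjacent_intervals (hii (-s⁻¹) s⁻¹)
      (hii s⁻¹ Real.pi)]
    have i1 : ∫ _ in (-Real.pi)..(-s⁻¹), -(2 * b⁻¹ ^ 3) ≤ ∫ φ in (-Real.pi)..(-s⁻¹), (F φ).re :=
      intervalIntegral.integral_mono_on (by linarith) (by simp) (hii _ _) fun φ hφ =>
        hout φ (abs_le.2 ⟨hφ.1, by linarith [hφ.2]⟩)
    have i3 : ∫ _ in (s⁻¹)..Real.pi, -(2 * b⁻¹ ^ 3) ≤ ∫ φ in (s⁻¹)..Real.pi, (F φ).re :=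
      intervalIntegral.integral_mono_on (by linarith) (by simp) (hii _ _) fun φ hφ =>
        hout φ (abs_le.2 ⟨by linarith [hφ.1], hφ.2⟩)
    have i2 : ∫ _ in (-s⁻¹)..(s⁻¹), 1 / 2 * Real.exp (-(w₁ / 2)) ≤
        ∫ φ in (-s⁻¹)..(s⁻¹), (F φ).re :=
      intervalIntegral.integral_mono_on (by linarith) (by simp) (hii _ _) fun φ hφ =>
        hmid φ (abs_le.2 hφ)
    simp only [intervalIntegral.integral_const, smul_eq_mul] at i1 i2 i3
    have hE : 0 < Real.exp (w₁ / 2) := Real.exp_pos _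
    have hbb : 4 * Real.pi * b⁻¹ ^ 3 ≤ s⁻¹ * (1 / 2 * Real.exp (-(w₁ / 2))) := by
      rw [Real.exp_neg]
      have h1 : 8 * Real.pi * b⁻¹ ≤ (Real.exp (w₁ / 2))⁻¹ := by
        rw [← div_eq_mul_inv, ← one_div, div_le_div_iff₀ hb0 hE]
        linarith
      have h2 : b⁻¹ ^ 2 ≤ s⁻¹ := by
        rw [hsb]
        have : s⁻¹ ≤ 1 := inv_le_one_of_one_le₀ hs
        calc ((s ^ 2)⁻¹) ^ 2 = s⁻¹ ^ 4 := by rw [← inv_pow]; ring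
          _ ≤ s⁻¹ ^ 1 := pow_le_pow_of_le_one hβ0.le this (by norm_num)
          _ = s⁻¹ := pow_one _
      calc 4 * Real.pi * b⁻¹ ^ 3 = b⁻¹ ^ 2 * (1 / 2 * (8 * Real.pi * b⁻¹)) := by ring
        _ ≤ s⁻¹ * (1 / 2 * (Real.exp (w₁ / 2))⁻¹) := by gcongr
    have hX : s⁻¹ / (2 * Real.exp (w₁ / 2)) = s⁻¹ * (1 / 2 * Real.exp (-(w₁ / 2))) := by
      rw [Real.exp_neg]; field_simp
    have hb3 : 0 ≤ b⁻¹ ^ 3 := by positivity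
    rw [hX]
    nlinarith
  have hnorm : s⁻¹ / (2 * Real.exp (w₁ / 2)) ≤ ‖∫ φ in (-Real.pi)..Real.pi, F φ‖ :=
    hlow.trans ((le_abs_self _).trans (Complex.abs_re_le_norm _))
  refine ⟨fun h0 => ?_, fun j hj1 hj2 => ?_⟩
  · rw [h0, norm_zero] at hnorm
    have : 0 < s⁻¹ / (2 * Real.exp (w₁ / 2)) := by positivity
    linarith
  -- upper bound for the moments
  have hpt : ∀ φ, |φ| ≤ Real.pi → |φ| ^ (2 * j) * ‖F φ‖ ≤
      32 * (2 / w₀ + 1) ^ 2 / b ^ j * Real.exp (-(w₀ / 4 * b) * φ ^ 2) +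
        2 * (Real.pi ^ 4 + Real.pi ^ 2) * b⁻¹ ^ 3 := by
    intro φ hφ
    rcases le_or_gt |φ| δ with h | h
    · have hy : 0 ≤ w * b / 2 * φ ^ 2 := by positivity
      have h1 := pow_le_sixteen_mul_exp_half hj2 hy
      have h2 : |φ| ^ (2 * j) = (2 / (w * b)) ^ j * (w * b / 2 * φ ^ 2) ^ j := by
        rw [pow_mul, sq_abs, ← mul_pow]; congr 1; field_simp
      have h3 : (2 / (w * b)) ^ j ≤ (2 / w₀ + 1) ^ 2 / b ^ j := by
        rw [← div_div, div_pow]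
        gcongr
        calc (2 / w) ^ j ≤ (2 / w₀ + 1) ^ j := by
              gcongr
              have : 2 / w ≤ 2 / w₀ := by gcongr
              linarith
          _ ≤ (2 / w₀ + 1) ^ 2 := by
              gcongr
              have : 0 < 2 / w₀ := by positivity
              linarith
      have h4 : Real.exp (w * b / 2 * φ ^ 2 / 2) * Real.exp (-(w * b / 2) * φ ^ 2) ≤
          Real.exp (-(w₀ / 4 * b) * φ ^ 2) := by
        rw [← Real.exp_add]
        gcongr
        have : w₀ * (b * φ ^ 2) ≤ w * (b * φ ^ 2) := by gcongr
        nlinarith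
      have h5 : 0 ≤ 2 * (Real.pi ^ 4 + Real.pi ^ 2) * b⁻¹ ^ 3 := by positivity
      calc |φ| ^ (2 * j) * ‖F φ‖ ≤ ((2 / (w * b)) ^ j * (w * b / 2 * φ ^ 2) ^ j) *
            (2 * Real.exp (-(w * b / 2) * φ ^ 2)) := by
            rw [h2]; gcongr; exact hP1 φ h
        _ ≤ ((2 / w₀ + 1) ^ 2 / b ^ j * (16 * Real.exp (w * b / 2 * φ ^ 2 / 2))) *
            (2 * Real.exp (-(w * b / 2) * φ ^ 2)) := by gcongr
        _ = 32 * (2 / w₀ + 1) ^ 2 / b ^ j * (Real.exp (w * b / 2 * φ ^ 2 / 2) *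
            Real.exp (-(w * b / 2) * φ ^ 2)) := by ring
        _ ≤ 32 * (2 / w₀ + 1) ^ 2 / b ^ j * Real.exp (-(w₀ / 4 * b) * φ ^ 2) := by gcongr
        _ ≤ _ := by linarith
    · have h5 : 0 ≤ 32 * (2 / w₀ + 1) ^ 2 / b ^ j * Real.exp (-(w₀ / 4 * b) * φ ^ 2) := by
        positivity
      have h6 : |φ| ^ (2 * j) ≤ Real.pi ^ 4 + Real.pi ^ 2 := by
        have : |φ| ^ (2 * j) ≤ Real.pi ^ (2 * j) := by gcongr
        have h4 : 0 ≤ Real.pi ^ 4 := by positivity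
        have h2 : 0 ≤ Real.pi ^ 2 := by positivity
        interval_cases j <;> norm_num at this ⊢ <;> linarith
      calc |φ| ^ (2 * j) * ‖F φ‖ ≤ (Real.pi ^ 4 + Real.pi ^ 2) * (2 * b⁻¹ ^ 3) := by
            gcongr; exact hP2 φ h hφ
        _ ≤ _ := by linarith
  have hgi : Integrable fun φ : ℝ => Real.exp (-(w₀ / 4 * b) * φ ^ 2) :=
    integrable_exp_neg_mul_sq (by positivity)
  have hgauss : ∫ φ in (-Real.pi)..Real.pi, Real.exp (-(w₀ / 4 * b) * φ ^ 2) ≤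
      √(Real.pi / (w₀ / 4)) * s⁻¹ := by
    rw [intervalIntegral.integral_of_le hππ]
    refine (setIntegral_le_integral hgi
      (Eventually.of_forall fun φ => (Real.exp_pos _).le)).trans ?_
    rw [integral_gaussian, ← div_div, Real.sqrt_div (by positivity), hsb, Real.sqrt_sq hs0.le]
    rfl
  have hup : ∫ φ in (-Real.pi)..Real.pi, |φ| ^ (2 * j) * ‖F φ‖ ≤ L / b ^ j * s⁻¹ := by
    calc ∫ φ in (-Real.pi)..Real.pi, |φ| ^ (2 * j) * ‖F φ‖
        ≤ ∫ φ in (-Real.pi)..Real.pi, (32 * (2 / w₀ + 1) ^ 2 / b ^ j *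
          Real.exp (-(w₀ / 4 * b) * φ ^ 2) + 2 * (Real.pi ^ 4 + Real.pi ^ 2) * b⁻¹ ^ 3) := by
          refine intervalIntegral.integral_mono_on hππ ?_ ?_ fun φ hφ => hpt φ (abs_le.2 hφ)
          · apply Continuous.intervalIntegrable; fun_prop
          · apply Continuous.intervalIntegrable; fun_prop
      _ = 32 * (2 / w₀ + 1) ^ 2 / b ^ j *
          (∫ φ in (-Real.pi)..Real.pi, Real.exp (-(w₀ / 4 * b) * φ ^ 2)) +
          (4 * Real.pi ^ 5 + 4 * Real.pi ^ 3) * b⁻¹ ^ 3 := by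
          rw [intervalIntegral.integral_add (by apply Continuous.intervalIntegrable; fun_prop)
            (by simp), intervalIntegral.integral_const_mul]
          simp only [intervalIntegral.integral_const, smul_eq_mul]
          ring
      _ ≤ 32 * (2 / w₀ + 1) ^ 2 / b ^ j * (√(Real.pi / (w₀ / 4)) * s⁻¹) +
          (4 * Real.pi ^ 5 + 4 * Real.pi ^ 3) * (s⁻¹ / b ^ j) := by
          gcongr
          have hs1 : s⁻¹ ≤ 1 := inv_le_one_of_one_le₀ hs
          rw [hsb, div_eq_mul_inv, ← inv_pow, ← inv_pow, ← inv_pow, ← pow_mul, ← pow_mul,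
            ← pow_succ']
          exact pow_le_pow_of_le_one hβ0.le hs1 (by omega)
      _ = L / b ^ j * s⁻¹ := by rw [hL]; ring
  calc _ ≤ L / b ^ j * s⁻¹ := hup
    _ = L * (2 * Real.exp (w₁ / 2)) / b ^ j * (s⁻¹ / (2 * Real.exp (w₁ / 2))) := by field_simp
    _ ≤ _ := by gcongr

lemma thetaCoeff_zero (θ : ℕ → ℝ) : thetaCoeff θ 0 = 0 := if_pos rfl

lemma gThetaC_eq_momC (θ : ℕ → ℝ) : gThetaC θ = momC (thetaCoeff θ) 0 := by
  funext z
  simp [gThetaC, momC]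

lemma gThetaR_eq_momR (θ : ℕ → ℝ) : gThetaR θ = momR (thetaCoeff θ) 0 := by
  funext z
  simp [gThetaR, momR]

lemma PosSeries.mul_deriv_momR_zero {c : ℕ → ℝ} {ρ t : ℝ} (h : PosSeries c ρ)
    (ht : t ∈ Set.Ico 0 ρ) :
    t * deriv (momR c 0) t = momR c 1 t := by
  rcases ht.1.eq_or_lt with rfl | h0
  · have : momR c 1 0 = 0 := by
      rw [momR]
      refine (tsum_congr fun j => ?_).trans tsum_zero
      rcases j.eq_zero_or_pos with rfl | hj
      · simp
      · simp [hj.ne']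
    simp [this]
  · rw [(h.hasDerivAt_momR ⟨h0, ht.2⟩ 0).deriv]
    field_simp

namespace IsLogAdmissible

lemma posSeries {g : ℂ → ℂ} {c : ℕ → ℝ} {ρ : ℝ} {a b δ : ℝ → ℝ}
    (h : IsLogAdmissible g c ρ a b δ) : PosSeries c ρ where
  nonneg := h.coeff_nonneg
  summable t ht := by
    have := (h.series t (by rw [Complex.norm_real, Real.norm_of_nonneg ht.1]; exact ht.2)).summable
    exact_mod_cast this

lemma eventually_mem_Ioo {g : ℂ → ℂ} {c : ℕ → ℝ} {ρ : ℝ} {a b δ : ℝ → ℝ}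
    (h : IsLogAdmissible g c ρ a b δ) : ∀ᶠ t in 𝓝[<] ρ, t ∈ Set.Ioo 0 ρ :=
  Ioo_mem_nhdsLT h.rho_pos

/-- The quadratic coefficient in the approximation property is forced to be the second moment. -/
lemma eq_momR_two {c : ℕ → ℝ} {ρ : ℝ} {a b δ : ℝ → ℝ}
    (h : IsLogAdmissible (momC c 0) c ρ a b δ) (ha : ∀ t ∈ Set.Ico 0 ρ, a t = momR c 1 t)
    {t : ℝ} (ht : t ∈ Set.Ico 0 ρ) : b t = momR c 2 t := by
  obtain ⟨ε, -, hε⟩ := h.approx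
  set K := ε t * (δ t)⁻¹ ^ 3 + momR c 3 t with hK
  have key : ∀ φ : ℝ, 0 < φ → φ ≤ δ t → |b t - momR c 2 t| ≤ 2 * K * φ := by
    intro φ h0 hφ
    have h1 := hε t ht φ (by rwa [abs_of_pos h0])
    have h2 := h.posSeries.norm_momArc_sub_sub_add_le ht 0 φ
    rw [abs_of_pos h0] at h1 h2
    rw [ha t ht, PosSeries.momC_ofReal] at h1
    have h3 : ‖((φ ^ 2 / 2 * (b t - momR c 2 t) : ℝ) : ℂ)‖ ≤ K * φ ^ 3 := by
      have : ((φ ^ 2 / 2 * (b t - momR c 2 t) : ℝ) : ℂ) =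
          (momC c 0 (t * Complex.exp (φ * Complex.I)) -
          (momR c 0 t + φ * Complex.I * momR c 1 t - (φ : ℂ) ^ 2 / 2 * b t)) -
          (momArc c t 0 φ - momR c 0 t - φ * (Complex.I * momR c (0 + 1) t)
        + (φ : ℂ) ^ 2 / 2 * momR c (0 + 2) t) := by
        simp only [momArc]
        push_cast
        ring
      rw [this]
      refine (norm_sub_le _ _).trans ((add_le_add h1 h2).trans_eq ?_)
      rw [hK]
      ring
    rw [Complex.norm_real, Real.norm_eq_abs, abs_mul, abs_of_pos (by positivity)] at h3
    have : φ ^ 2 / 2 * |b t - momR c 2 t| ≤ φ ^ 2 / 2 * (2 * K * φ) := h3.trans_eq (by ring)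
    exact le_of_mul_le_mul_left this (by positivity)
  have hlim : Tendsto (fun φ : ℝ => 2 * K * φ) (𝓝[>] 0) (𝓝 (2 * K * 0)) :=
    (tendsto_id.const_mul _).mono_left nhdsWithin_le_nhds
  have h0 : |b t - momR c 2 t| ≤ 2 * K * 0 := by
    refine ge_of_tendsto hlim ?_
    filter_upwards [Ioc_mem_nhdsGT (h.delta_pos t ht)] with φ hφ using key φ hφ.1 hφ.2
  rw [mul_zero] at h0
  exact sub_eq_zero.1 (abs_nonpos_iff.1 h0)

lemma momR_of_gTheta {θ : ℕ → ℝ} {ρ : ℝ} {a b δ : ℝ → ℝ}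
    (h : IsLogAdmissible (gThetaC θ) (thetaCoeff θ) ρ a b δ)
    (ha : ∀ t ∈ Set.Ico 0 ρ, a t = t * deriv (gThetaR θ) t) :
    IsLogAdmissible (momC (thetaCoeff θ) 0) (thetaCoeff θ) ρ (momR (thetaCoeff θ) 1)
      (momR (thetaCoeff θ) 2) δ := by
  rw [gThetaC_eq_momC] at h
  have ha' : ∀ t ∈ Set.Ico 0 ρ, a t = momR (thetaCoeff θ) 1 t := fun t ht => by
    rw [ha t ht, gThetaR_eq_momR, PosSeries.mul_deriv_momR_zero h.posSeries ht]
  have hb : ∀ t ∈ Set.Ico 0 ρ, b t = momR (thetaCoeff θ) 2 t :=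
    fun t ht => h.eq_momR_two ha' ht
  have hI : ∀ᶠ t in 𝓝[<] ρ, t ∈ Set.Ico 0 ρ :=
    h.eventually_mem_Ioo.mono fun t ht => Set.Ioo_subset_Ico_self ht
  obtain ⟨ε, hε, hap⟩ := h.approx
  exact
  { rho_pos := h.rho_pos
    coeff_nonneg := h.coeff_nonneg
    series := h.series
    radius := h.radius
    a_nonneg := fun t ht => h.posSeries.momR_nonneg 1 ht.1
    b_nonneg := fun t ht => h.posSeries.momR_nonneg 2 ht.1
    delta_pos := h.delta_pos
    approx := ⟨ε, hε, fun t ht φ hφ => by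
      have := hap t ht φ hφ
      rwa [ha' t ht, hb t ht] at this⟩
    a_div := h.a_div.congr' (hI.mono ha')
    b_div := h.b_div.congr' (hI.mono hb)
    delta_lim := h.delta_lim
    width := fun e he => (h.width e he).congr' (hI.mono fun t ht => by rw [hb t ht])
    mono := h.mono }

end IsLogAdmissible

namespace PosSeries

variable {c : ℕ → ℝ} {ρ t : ℝ}

lemma momR_one_le_two (h : PosSeries c ρ) (ht : t ∈ Set.Ico 0 ρ) : momR c 1 t ≤ momR c 2 t := by
  refine (h.summable_mom 1 ht).tsum_le_tsum (fun j => ?_) (h.summable_mom 2 ht)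
  have := h.nonneg j
  have := ht.1
  gcongr ?_ * _ * _
  exact_mod_cast (pow_one j).trans_le (Nat.le_self_pow two_ne_zero j)

lemma hasSum_mul_one_sub_sq (h : PosSeries c ρ) (ht : t ∈ Set.Ico 0 ρ) (q : ℝ) :
    HasSum (fun j : ℕ => c j * t ^ j * (1 - j * q) ^ 2)
      (momR c 0 t - 2 * q * momR c 1 t + q ^ 2 * momR c 2 t) := by
  have := (((h.summable_mom 0 ht).hasSum.sub ((h.summable_mom 1 ht).hasSum.mul_left (2 * q))).add
    ((h.summable_mom 2 ht).hasSum.mul_left (q ^ 2)))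
  refine this.congr_fun fun j => ?_
  ring

lemma hasSum_mul_one_sub_div_sq (h : PosSeries c ρ) (ht : t ∈ Set.Ico 0 ρ)
    (h2 : 0 < momR c 2 t) :
    HasSum (fun j : ℕ => c j * t ^ j * (1 - j * (momR c 1 t / momR c 2 t)) ^ 2)
      (momR c 0 t - momR c 1 t ^ 2 / momR c 2 t) := by
  convert h.hasSum_mul_one_sub_sq ht (momR c 1 t / momR c 2 t) using 1
  field_simp
  ring

lemma sq_div_le (h : PosSeries c ρ) (ht : t ∈ Set.Ico 0 ρ) (h2 : 0 < momR c 2 t) :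
    momR c 1 t ^ 2 / momR c 2 t ≤ momR c 0 t :=
  sub_nonneg.1 <| (h.hasSum_mul_one_sub_div_sq ht h2).nonneg fun j => by
    have := h.nonneg j; have := ht.1; positivity

lemma momR_strictMonoOn (h : PosSeries c ρ) (k : ℕ)
    (hpos : ∀ t ∈ Set.Ioo 0 ρ, 0 < momR c (k + 1) t) :
    StrictMonoOn (momR c k) (Set.Ioo 0 ρ) := by
  refine strictMonoOn_of_hasDerivWithinAt_pos (f' := fun t => momR c (k + 1) t / t)
    (convex_Ioo 0 ρ) (fun t ht => (h.hasDerivAt_momR ht k).continuousAt.continuousWithinAt)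
    (fun t ht => (h.hasDerivAt_momR (interior_subset ht) k).hasDerivWithinAt) fun t ht => ?_
  have := interior_subset ht
  exact div_pos (hpos t this) this.1

lemma momR_monotoneOn (h : PosSeries c ρ) (k : ℕ) : MonotoneOn (momR c k) (Set.Ico 0 ρ) := by
  intro s hs t ht hst
  refine (h.summable_mom k hs).tsum_le_tsum (fun j => ?_) (h.summable_mom k ht)
  have := h.nonneg j
  have := hs.1
  gcongr

/-- If some positive-order moment is positive at one point, all of them are at all points. -/
lemma momR_pos (h : PosSeries c ρ) {s : ℝ} (hp : 0 < momR c 1 s)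
    (ht : t ∈ Set.Ioo 0 ρ) (k : ℕ) : 0 < momR c k t := by
  have : ∃ j, j ≠ 0 ∧ c j ≠ 0 := by
    by_contra! hcon
    refine hp.ne' ((tsum_congr fun j => ?_).trans tsum_zero)
    rcases eq_or_ne j 0 with rfl | hj
    · simp
    · simp [hcon j hj]
  obtain ⟨j, hj, hcj⟩ := this
  have ht0 := ht.1
  have h1 : 0 < c j := (h.nonneg j).lt_of_ne' hcj
  have h2 : (0 : ℝ) < j := by exact_mod_cast Nat.pos_of_ne_zero hj
  exact (h.summable_mom k (Set.Ioo_subset_Ico_self ht)).tsum_pos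
    (fun i => by have := h.nonneg i; positivity) j (by positivity)

end PosSeries

namespace IsLogAdmissible

variable {c : ℕ → ℝ} {ρ : ℝ} {δ : ℝ → ℝ}

lemma momR_pos (h : IsLogAdmissible (momC c 0) c ρ (momR c 1) (momR c 2) δ) {t : ℝ}
    (ht : t ∈ Set.Ioo 0 ρ) (k : ℕ) : 0 < momR c k t := by
  obtain ⟨s, hs⟩ := (h.a_div.eventually_gt_atTop 0).exists
  exact h.posSeries.momR_pos hs ht k

lemma tendsto_delta_sq_mul (h : IsLogAdmissible (momC c 0) c ρ (momR c 1) (momR c 2) δ) :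
    Tendsto (fun t => δ t ^ 2 * momR c 2 t) (𝓝[<] ρ) atTop := by
  refine tendsto_atTop_mono' _ ?_ (h.width 1 one_pos)
  filter_upwards [h.b_div.eventually_ge_atTop 1] with t ht
  have := Real.log_nonneg ht
  linarith

lemma tendsto_momR_zero (h : IsLogAdmissible (momC c 0) c ρ (momR c 1) (momR c 2) δ) :
    Tendsto (momR c 0) (𝓝[<] ρ) atTop := by
  obtain ⟨ε, hε, hap⟩ := h.approx
  have hlim : Tendsto (fun t => (δ t ^ 2 * momR c 2 t) / 4 + -(1 / 2)) (𝓝[<] ρ) atTop :=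
    tendsto_atTop_add_const_right _ _ (h.tendsto_delta_sq_mul.atTop_div_const (by norm_num))
  refine tendsto_atTop_mono' _ ?_ hlim
  filter_upwards [h.eventually_mem_Ioo, hε.eventually_le_const one_pos] with t ht hε1
  have htI := Set.Ioo_subset_Ico_self ht
  have hδ := h.delta_pos t htI
  have h1 := hap t htI (δ t) (abs_of_pos hδ).le
  have h2 : ε t * |δ t| ^ 3 * (δ t)⁻¹ ^ 3 = ε t := by
    rw [abs_of_pos hδ, mul_assoc, ← mul_pow, mul_inv_cancel₀ hδ.ne', one_pow, mul_one]
  rw [h2, PosSeries.momC_ofReal] at h1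
  have h3 := h.posSeries.norm_momArc_le htI 0 (δ t)
  have h4 := (Complex.abs_re_le_norm _).trans h1
  have h5 := (Complex.abs_re_le_norm _).trans h3
  rw [momArc] at h5
  have h6 : ((momR c 0 t : ℂ) + (δ t : ℂ) * Complex.I * (momR c 1 t : ℂ)
      - (δ t : ℂ) ^ 2 / 2 * (momR c 2 t : ℂ)).re = momR c 0 t - δ t ^ 2 / 2 * momR c 2 t := by
    simp [← Complex.ofReal_pow]
  rw [Complex.sub_re, h6] at h4
  have := (abs_le.1 h4).1
  have := (abs_le.1 h4).2
  have := (abs_le.1 h5).1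
  linarith

lemma tendsto_momR_div (h : IsLogAdmissible (momC c 0) c ρ (momR c 1) (momR c 2) δ) :
    Tendsto (fun t => momR c 1 t / momR c 2 t) (𝓝[<] ρ) (𝓝 0) := by
  have hS := h.posSeries
  rw [tendsto_order]
  refine ⟨fun e he => ?_, fun e he => ?_⟩
  · filter_upwards [h.eventually_mem_Ioo] with t ht
    exact he.trans (div_pos (h.momR_pos ht 1) (h.momR_pos ht 2))
  · obtain ⟨N, hN⟩ := exists_nat_gt (1 / e + 1)
    set A := ∑ j ∈ Finset.range N, N * (j * c j * ρ ^ j) with hA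
    filter_upwards [h.eventually_mem_Ioo, h.a_div.eventually_ge_atTop A] with t ht hta
    have htI := Set.Ioo_subset_Ico_self ht
    have h1 := (hS.summable_mom 1 htI).hasSum.mul_left (N : ℝ)
    have h2 := (hS.summable_mom 2 htI).hasSum
    have h3 : HasSum (fun j : ℕ => if j ∈ Finset.range N then N * (j * c j * ρ ^ j) else 0) A := by
      have := hasSum_sum_of_ne_finset_zero (L := SummationFilter.unconditional ℕ)
        (s := Finset.range N)
        (f := fun j : ℕ => if j ∈ Finset.range N then N * (j * c j * ρ ^ j) else 0)
        fun j hj => if_neg hj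
      rwa [Finset.sum_congr rfl fun j hj => if_pos hj] at this
    have hle : N * momR c 1 t ≤ A + momR c 2 t := hasSum_le (fun j => by
      have hc := hS.nonneg j
      have h0 : t ^ j ≤ ρ ^ j := pow_le_pow_left₀ ht.1.le ht.2.le j
      have ht0 := ht.1
      rw [pow_one]
      split_ifs with hj
      · have h4 : (N : ℝ) * (j * c j * t ^ j) ≤ N * (j * c j * ρ ^ j) := by gcongr
        have h5 : 0 ≤ (j : ℝ) ^ 2 * c j * t ^ j := by positivity
        linarith
      · have hj : (N : ℝ) ≤ j := by exact_mod_cast not_lt.1 (mt Finset.mem_range.2 hj)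
        have h6 : 0 ≤ (j : ℝ) * c j * t ^ j := by positivity
        nlinarith) h1 (h3.add h2)
    have hb := h.momR_pos ht 2
    rw [div_lt_iff₀ hb]
    have h7 : 1 / e * momR c 1 t < momR c 2 t := by nlinarith [h.momR_pos ht 1]
    rwa [one_div, inv_mul_lt_iff₀ he] at h7

lemma tendsto_variance (h : IsLogAdmissible (momC c 0) c ρ (momR c 1) (momR c 2) δ) :
    Tendsto (fun t => momR c 0 t - momR c 1 t ^ 2 / momR c 2 t) (𝓝[<] ρ) atTop := by
  have hS := h.posSeries
  rw [tendsto_atTop]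
  intro A
  obtain ⟨s, hs, hsA⟩ := (h.eventually_mem_Ioo.and
    (h.tendsto_momR_zero.eventually_gt_atTop (4 * A))).exists
  have hsum := (hS.summable_mom 0 (Set.Ioo_subset_Ico_self hs)).hasSum.tendsto_sum_nat
  obtain ⟨N, hN⟩ := (hsum.eventually_const_lt hsA).exists
  have hq := h.tendsto_momR_div.eventually_le_const
    (show (0 : ℝ) < 1 / (2 * (N + 1)) by positivity)
  filter_upwards [Ioo_mem_nhdsLT hs.2, hq, h.eventually_mem_Ioo] with t hst hq ht
  have htI := Set.Ioo_subset_Ico_self ht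
  have hsum := hS.hasSum_mul_one_sub_div_sq htI (h.momR_pos ht 2)
  set q := momR c 1 t / momR c 2 t with hqdef
  have hq0 : 0 < q := div_pos (h.momR_pos ht 1) (h.momR_pos ht 2)
  have hle := sum_le_hasSum (Finset.range N) (fun j _ => by
    have := hS.nonneg j; have := ht.1; positivity) hsum
  refine le_trans ?_ hle
  have : ∑ j ∈ Finset.range N, (j : ℝ) ^ 0 * c j * s ^ j ≤
      4 * ∑ j ∈ Finset.range N, c j * t ^ j * (1 - j * q) ^ 2 := by
    rw [Finset.mul_sum]
    refine Finset.sum_le_sum fun j hj => ?_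
    have hjN : (j : ℝ) ≤ N := by exact_mod_cast (Finset.mem_range.1 hj).le
    have hjq : j * q ≤ 1 / 2 := by
      calc j * q ≤ N * (1 / (2 * (N + 1))) := by gcongr
        _ ≤ 1 / 2 := by rw [mul_one_div, div_le_div_iff₀ (by positivity) two_pos]; linarith
    have h1 : 1 / 4 ≤ (1 - j * q) ^ 2 := by nlinarith
    have h2 : c j * s ^ j ≤ c j * t ^ j :=
      mul_le_mul_of_nonneg_left (pow_le_pow_left₀ hs.1.le hst.1.le j) (hS.nonneg j)
    have h3 : 0 ≤ c j * t ^ j := mul_nonneg (hS.nonneg j) (pow_nonneg ht.1.le j)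
    rw [pow_zero, one_mul]
    nlinarith
  linarith

end IsLogAdmissible

namespace IsLogAdmissible

variable {c : ℕ → ℝ} {ρ : ℝ} {δ : ℝ → ℝ}

lemma arcWeight_eq (c : ℕ → ℝ) (t w φ : ℝ) :
    arcWeight c t w φ = (Real.exp (-(w * momR c 2 t / 2) * φ ^ 2) : ℝ) *
      Complex.exp (w * (momArc c t 0 φ - (momR c 0 t + φ * Complex.I * momR c 1 t
        - (φ : ℂ) ^ 2 / 2 * momR c 2 t))) := by
  rw [arcWeight, Complex.ofReal_exp, ← Complex.exp_add]
  congr 1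
  push_cast
  ring

lemma exists_laplace_arcWeight (h : IsLogAdmissible (momC c 0) c ρ (momR c 1) (momR c 2) δ)
    {w₀ w₁ : ℝ} (hw₀ : 0 < w₀) (hw₁ : w₀ ≤ w₁) :
    ∃ K : ℝ, 0 ≤ K ∧ ∀ᶠ t in 𝓝[<] ρ, ∀ w, w₀ ≤ w → w ≤ w₁ →
      (∫ φ in (-Real.pi)..Real.pi, arcWeight c t w φ) ≠ 0 ∧
      ∀ j, 1 ≤ j → j ≤ 2 → ∫ φ in (-Real.pi)..Real.pi, |φ| ^ (2 * j) * ‖arcWeight c t w φ‖ ≤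
        K / momR c 2 t ^ j * ‖∫ φ in (-Real.pi)..Real.pi, arcWeight c t w φ‖ := by
  obtain ⟨K, hK0, hK⟩ := exists_laplace_bound w₀ w₁ hw₀
  refine ⟨K, hK0, ?_⟩
  have hw₁0 := hw₀.trans_le hw₁
  obtain ⟨ε, hε, hap⟩ := h.approx
  filter_upwards [h.eventually_mem_Ioo, h.b_div.eventually_ge_atTop 1,
    h.b_div.eventually_ge_atTop (8 * Real.pi * Real.exp (w₁ / 2)),
    h.tendsto_delta_sq_mul.eventually_ge_atTop 1, h.delta_lim.eventually_le_const Real.pi_pos,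
    (h.width (w₀ / 6) (by positivity)).eventually_ge_atTop 0,
    hε.eventually_le_const (show (0 : ℝ) < 1 / (4 * w₁) by positivity)]
    with t ht hb1 hb2 hδb hδπ hwid hεt w hw hw'
  have htI := Set.Ioo_subset_Ico_self ht
  have hδ := h.delta_pos t htI
  have hw0 := hw₀.trans_le hw
  set b := momR c 2 t with hb
  have hb0 : 0 < b := one_pos.trans_le hb1
  set z : ℝ → ℂ := fun φ => w * (momArc c t 0 φ - (momR c 0 t + φ * Complex.I * momR c 1 t
        - (φ : ℂ) ^ 2 / 2 * b)) with hz
  have hzb : ∀ φ, |φ| ≤ δ t → ‖z φ‖ ≤ 1 / 4 := by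
    intro φ hφ
    have h1 := hap t htI φ hφ
    rw [PosSeries.momC_ofReal] at h1
    have h2 : ε t * |φ| ^ 3 * (δ t)⁻¹ ^ 3 ≤ 1 / (4 * w₁) := by
      have h3 : (|φ| * (δ t)⁻¹) ^ 3 ≤ 1 := by
        refine pow_le_one₀ (by positivity) ?_
        rwa [← div_eq_mul_inv, div_le_one hδ]
      calc ε t * |φ| ^ 3 * (δ t)⁻¹ ^ 3 = ε t * (|φ| * (δ t)⁻¹) ^ 3 := by ring
        _ ≤ 1 / (4 * w₁) * (|φ| * (δ t)⁻¹) ^ 3 := by gcongr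
        _ ≤ 1 / (4 * w₁) * 1 := by gcongr
        _ = _ := mul_one _
    rw [hz, norm_mul, Complex.norm_real, Real.norm_of_nonneg hw0.le]
    calc w * _ ≤ w₁ * (1 / (4 * w₁)) := by
          refine mul_le_mul hw' (h1.trans h2) (norm_nonneg _) hw₁0.le
      _ = 1 / 4 := by field_simp
  have hexp : ∀ φ, |φ| ≤ δ t → ‖Complex.exp (z φ) - 1‖ ≤ 1 / 2 := by
    intro φ hφ
    have h1 := hzb φ hφ
    exact (Complex.norm_exp_sub_one_le (by linarith)).trans (by linarith)
  have hF : ∀ φ, arcWeight c t w φ = (Real.exp (-(w * b / 2) * φ ^ 2) : ℝ) * Complex.exp (z φ) :=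
    arcWeight_eq c t w
  have hcen : ∀ φ, |φ| ≤ δ t → ‖arcWeight c t w φ‖ ≤ 2 * Real.exp (-(w * b / 2) * φ ^ 2) := by
    intro φ hφ
    have h1 : ‖Complex.exp (z φ)‖ ≤ 2 := by
      have := norm_sub_norm_le (Complex.exp (z φ)) 1
      have h2 := hexp φ hφ
      rw [norm_one] at this
      linarith
    rw [hF, norm_mul, Complex.norm_real, Real.norm_of_nonneg (Real.exp_nonneg _), mul_comm]
    gcongr
  refine hK _ b (δ t) w (h.posSeries.continuous_arcWeight htI) hw hw' hb1 hb2 hδ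
    (by rwa [mul_comm]) hδπ hcen (fun φ hφ hφ' => ?_) fun φ hφ => ?_
  · have hend : ∀ ψ, |ψ| = δ t → ‖arcWeight c t w ψ‖ ≤ 2 * b⁻¹ ^ 3 := by
      intro ψ hψ
      refine (hcen ψ hψ.le).trans ?_
      have h1 : b⁻¹ ^ 3 = Real.exp (-(3 * Real.log b)) := by
        rw [Real.exp_neg, mul_comm, Real.exp_mul, Real.exp_log hb0, inv_pow]
        norm_cast
      rw [h1, ← sq_abs, hψ]
      gcongr
      nlinarith [mul_le_mul_of_nonneg_right hw (show 0 ≤ δ t ^ 2 * b by positivity)]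
    have hn : ∀ ψ, ‖arcWeight c t w ψ‖ =
        Real.exp (w * ((momArc c t 0 ψ).re - momR c 0 t)) := by
      intro ψ
      rw [arcWeight, Complex.norm_exp]
      simp
    have hm := h.mono t htI φ hφ hφ'
    rcases le_max_iff.1 hm with hm | hm
    · refine le_trans ?_ (hend (δ t) (abs_of_pos hδ))
      rw [hn, hn]
      exact Real.exp_le_exp.2 (mul_le_mul_of_nonneg_left (sub_le_sub_right hm _) hw0.le)
    · refine le_trans ?_ (hend (-δ t) (by rw [abs_neg, abs_of_pos hδ]))
      have hm : (momArc c t 0 φ).re ≤ (momArc c t 0 (-δ t)).re := by simpa [momArc] using hm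
      rw [hn, hn]
      exact Real.exp_le_exp.2 (mul_le_mul_of_nonneg_left (sub_le_sub_right hm _) hw0.le)
  · have h1 : 1 / 2 ≤ (Complex.exp (z φ)).re := by
      have h2 := (Complex.abs_re_le_norm _).trans (hexp φ hφ)
      rw [Complex.sub_re, Complex.one_re] at h2
      linarith [(abs_le.1 h2).1]
    rw [hF, Complex.re_ofReal_mul, mul_comm]
    gcongr

end IsLogAdmissible

namespace IsLogAdmissible

variable {c : ℕ → ℝ} {ρ : ℝ} {δ : ℝ → ℝ} {r : ℝ → ℝ}

lemma saddle_mem_Ioo (hr : ∀ x > 0, r x ∈ Set.Ico 0 ρ ∧ momR c 1 (r x) = x) {x : ℝ}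
    (hx : 0 < x) : r x ∈ Set.Ioo 0 ρ := by
  obtain ⟨hI, h1⟩ := hr x hx
  refine ⟨hI.1.lt_of_ne fun h0 => hx.ne ?_, hI.2⟩
  rw [← h1, ← h0, momR]
  refine ((tsum_congr fun j => ?_).trans tsum_zero).symm
  rcases j.eq_zero_or_pos with rfl | hj
  · simp
  · simp [hj.ne']

lemma momR_one_strictMonoOn (h : IsLogAdmissible (momC c 0) c ρ (momR c 1) (momR c 2) δ) :
    StrictMonoOn (momR c 1) (Set.Ioo 0 ρ) :=
  h.posSeries.momR_strictMonoOn 1 fun _ ht => h.momR_pos ht 2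

lemma saddle_momR_one (h : IsLogAdmissible (momC c 0) c ρ (momR c 1) (momR c 2) δ)
    (hr : ∀ x > 0, r x ∈ Set.Ico 0 ρ ∧ momR c 1 (r x) = x) {t : ℝ} (ht : t ∈ Set.Ioo 0 ρ) :
    r (momR c 1 t) = t :=
  h.momR_one_strictMonoOn.injOn (saddle_mem_Ioo hr (h.momR_pos ht 1)) ht
    (hr _ (h.momR_pos ht 1)).2

lemma saddle_monotoneOn (h : IsLogAdmissible (momC c 0) c ρ (momR c 1) (momR c 2) δ)
    (hr : ∀ x > 0, r x ∈ Set.Ico 0 ρ ∧ momR c 1 (r x) = x) : MonotoneOn r (Set.Ioi 0) := by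
  intro x hx y hy hxy
  rw [← h.momR_one_strictMonoOn.le_iff_le (saddle_mem_Ioo hr hx) (saddle_mem_Ioo hr hy),
    (hr x hx).2, (hr y hy).2]
  exact hxy

lemma hasDerivAt_saddle (h : IsLogAdmissible (momC c 0) c ρ (momR c 1) (momR c 2) δ)
    (hr : ∀ x > 0, r x ∈ Set.Ico 0 ρ ∧ momR c 1 (r x) = x) {x : ℝ} (hx : 0 < x) :
    HasDerivAt r (r x / momR c 2 (r x)) x := by
  have hI := saddle_mem_Ioo hr hx
  have hcont : ContinuousAt r x := by
    refine continuousAt_of_monotoneOn_of_image_mem_nhds (h.saddle_monotoneOn hr)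
      (Ioi_mem_nhds hx) (mem_of_superset (Ioo_mem_nhds hI.1 hI.2) fun t ht => ?_)
    exact ⟨momR c 1 t, h.momR_pos ht 1, h.saddle_momR_one hr ht⟩
  have := HasDerivAt.of_local_left_inverse hcont (h.posSeries.hasDerivAt_momR hI 1)
    (div_pos (h.momR_pos hI 2) hI.1).ne' ((eventually_gt_nhds hx).mono fun y hy => (hr y hy).2)
  rwa [inv_div] at this

lemma tendsto_saddle (h : IsLogAdmissible (momC c 0) c ρ (momR c 1) (momR c 2) δ)
    (hr : ∀ x > 0, r x ∈ Set.Ico 0 ρ ∧ momR c 1 (r x) = x) : Tendsto r atTop (𝓝[<] ρ) := by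
  have hlt : ∀ᶠ x in atTop, r x < ρ := (eventually_gt_atTop 0).mono fun x hx => (hr x hx).1.2
  refine tendsto_nhdsWithin_iff.2 ⟨tendsto_order.2 ⟨fun u hu => ?_, fun u hu =>
    hlt.mono fun x hx => hx.trans hu⟩, hlt⟩
  obtain ⟨v, hv, hvρ⟩ := exists_between (max_lt hu h.rho_pos)
  have hvI : v ∈ Set.Ioo 0 ρ := ⟨(le_max_right _ _).trans_lt hv, hvρ⟩
  filter_upwards [eventually_gt_atTop 0, eventually_ge_atTop (momR c 1 v)] with x hx hvx
  refine ((le_max_left _ _).trans_lt hv).trans_le ?_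
  rwa [← h.momR_one_strictMonoOn.le_iff_le hvI (saddle_mem_Ioo hr hx), (hr x hx).2]

lemma hasDerivAt_momR_saddle (h : IsLogAdmissible (momC c 0) c ρ (momR c 1) (momR c 2) δ)
    (hr : ∀ x > 0, r x ∈ Set.Ico 0 ρ ∧ momR c 1 (r x) = x) {x : ℝ} (hx : 0 < x) (k : ℕ) :
    HasDerivAt (fun x => momR c k (r x)) (momR c (k + 1) (r x) / momR c 2 (r x)) x := by
  have hI := saddle_mem_Ioo hr hx
  refine ((h.posSeries.hasDerivAt_momR hI k).comp x (h.hasDerivAt_saddle hr hx)).congr_deriv ?_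
  have := hI.1.ne'
  field_simp

lemma iteratedDeriv_one_saddle (h : IsLogAdmissible (momC c 0) c ρ (momR c 1) (momR c 2) δ)
    (hr : ∀ x > 0, r x ∈ Set.Ico 0 ρ ∧ momR c 1 (r x) = x) {x : ℝ} (hx : 0 < x) :
    iteratedDeriv 1 r x = r x / momR c 2 (r x) := by
  rw [iteratedDeriv_one, (h.hasDerivAt_saddle hr hx).deriv]

lemma iteratedDeriv_two_saddle (h : IsLogAdmissible (momC c 0) c ρ (momR c 1) (momR c 2) δ)
    (hr : ∀ x > 0, r x ∈ Set.Ico 0 ρ ∧ momR c 1 (r x) = x) {x : ℝ} (hx : 0 < x) :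
    iteratedDeriv 2 r x = r x / momR c 2 (r x) ^ 2 * (1 - momR c 3 (r x) / momR c 2 (r x)) := by
  have hb := (h.momR_pos (saddle_mem_Ioo hr hx) 2).ne'
  have hev : iteratedDeriv 1 r =ᶠ[𝓝 x] fun x => r x / momR c 2 (r x) :=
    (eventually_gt_nhds hx).mono fun y hy => h.iteratedDeriv_one_saddle hr hy
  rw [iteratedDeriv_succ, hev.deriv_eq,
    ((h.hasDerivAt_saddle hr hx).fun_div (h.hasDerivAt_momR_saddle hr hx 2) hb).deriv]
  field_simp

lemma iteratedDeriv_three_saddle (h : IsLogAdmissible (momC c 0) c ρ (momR c 1) (momR c 2) δ)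
    (hr : ∀ x > 0, r x ∈ Set.Ico 0 ρ ∧ momR c 1 (r x) = x) {x : ℝ} (hx : 0 < x) :
    iteratedDeriv 3 r x = r x / momR c 2 (r x) ^ 3 *
      (1 - 3 * momR c 3 (r x) / momR c 2 (r x) - momR c 4 (r x) / momR c 2 (r x) +
        3 * momR c 3 (r x) ^ 2 / momR c 2 (r x) ^ 2) := by
  have hb := (h.momR_pos (saddle_mem_Ioo hr hx) 2).ne'
  have hev : iteratedDeriv 2 r =ᶠ[𝓝 x] fun x =>
      r x / momR c 2 (r x) ^ 2 * (1 - momR c 3 (r x) / momR c 2 (r x)) :=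
    (eventually_gt_nhds hx).mono fun y hy => h.iteratedDeriv_two_saddle hr hy
  have h2 := h.hasDerivAt_momR_saddle hr hx 2
  have h3 := h.hasDerivAt_momR_saddle hr hx 3
  rw [iteratedDeriv_succ, hev.deriv_eq,
    (((h.hasDerivAt_saddle hr hx).fun_div (h2.fun_pow 2) (pow_ne_zero 2 hb)).fun_mul
      ((h3.fun_div h2 hb).const_sub 1)).deriv]
  field_simp
  ring

lemma exists_moment_bound (h : IsLogAdmissible (momC c 0) c ρ (momR c 1) (momR c 2) δ)
    (hr : ∀ x > 0, r x ∈ Set.Ico 0 ρ ∧ momR c 1 (r x) = x) (htech : TechCond r) :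
    ∃ C : ℝ, 0 ≤ C ∧ ∀ᶠ t in 𝓝[<] ρ, momR c 3 t ≤ C * (momR c 2 t ^ 2 / momR c 1 t) ∧
      momR c 4 t ≤ C * (momR c 2 t ^ 3 / momR c 1 t ^ 2) := by
  obtain ⟨C, hC, x₀, hx₀⟩ := htech
  refine ⟨1 + 3 * (1 + C) ^ 2 + C ^ 2, by positivity, ?_⟩
  filter_upwards [h.eventually_mem_Ioo, h.a_div.eventually_ge_atTop x₀] with t ht htx
  have hx := h.momR_pos ht 1
  have hb := h.momR_pos ht 2
  have hc := h.momR_pos ht 3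
  have hd := h.momR_pos ht 4
  have hxb := h.posSeries.momR_one_le_two (Set.Ioo_subset_Ico_self ht)
  have h2 := hx₀ _ htx 2 le_rfl (by norm_num)
  have h3 := hx₀ _ htx 3 (by norm_num) (by norm_num)
  norm_num only at h2 h3
  rw [h.iteratedDeriv_one_saddle hr hx, h.iteratedDeriv_two_saddle hr hx] at h2
  rw [h.iteratedDeriv_two_saddle hr hx, h.iteratedDeriv_three_saddle hr hx] at h3
  rw [h.saddle_momR_one hr ht] at h2 h3
  have ht0 := ht.1
  generalize momR c 1 t = x at *
  generalize momR c 2 t = y at *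
  generalize momR c 3 t = z at *
  generalize momR c 4 t = u at *
  set X := 1 - z / y with hX
  set Y := 1 - 3 * z / y - u / y + 3 * z ^ 2 / y ^ 2 with hY
  rw [abs_mul, abs_of_pos (show 0 < t / y ^ 2 by positivity),
    abs_of_pos (show 0 < t / y by positivity)] at h2
  rw [abs_mul, abs_mul, abs_of_pos (show 0 < t / y ^ 2 by positivity),
    abs_of_pos (show 0 < t / y ^ 3 by positivity)] at h3
  set q := y / x with hq
  have hq1 : 1 ≤ q := (one_le_div hx).2 hxb
  have hXq : |X| ≤ C * q := by
    have : (t / y ^ 2 * x ^ 2) * |X| ≤ (t / y ^ 2 * x ^ 2) * (C * q) := by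
      calc _ = t / y ^ 2 * |X| * x ^ 2 := by ring
        _ ≤ _ := h2
        _ = _ := by rw [hq]; field_simp
    exact le_of_mul_le_mul_left this (by positivity)
  have hYq : |Y| ≤ C ^ 2 * q ^ 2 := by
    have : (t / y ^ 3 * x ^ 3) * |Y| ≤ (t / y ^ 3 * x ^ 3) * (C ^ 2 * q ^ 2) := by
      calc _ = t / y ^ 3 * |Y| * x ^ 3 := by ring
        _ ≤ _ := h3
        _ = (C * (t / y ^ 2) * x ^ 2) * |X| := by ring
        _ ≤ (C * (t / y ^ 2) * x ^ 2) * (C * q) := by gcongr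
        _ = _ := by rw [hq]; field_simp
    exact le_of_mul_le_mul_left this (by positivity)
  have hzy : z / y ≤ (1 + C) * q := by
    have := (abs_le.1 hXq).1
    linarith
  have hzy0 : 0 < z / y := by positivity
  have hzy2 : (z / y) ^ 2 ≤ ((1 + C) * q) ^ 2 := by gcongr
  have huy : u / y ≤ (1 + 3 * (1 + C) ^ 2 + C ^ 2) * q ^ 2 := by
    have h4 := (abs_le.1 hYq).1
    have h5 : Y = 1 - 3 * (z / y) - u / y + 3 * (z / y) ^ 2 := by rw [hY, div_pow]; ring
    nlinarith
  have hle : 1 + C ≤ 1 + 3 * (1 + C) ^ 2 + C ^ 2 := by nlinarith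
  constructor
  · have : z ≤ (1 + C) * q * y := (div_le_iff₀ hb).1 hzy
    refine this.trans ?_
    calc (1 + C) * q * y = (1 + C) * (y ^ 2 / x) := by rw [hq]; ring
      _ ≤ _ := by gcongr
  · refine ((div_le_iff₀ hb).1 huy).trans_eq ?_
    rw [hq]
    ring

lemma mul_deriv_saddle_div (h : IsLogAdmissible (momC c 0) c ρ (momR c 1) (momR c 2) δ)
    (hr : ∀ x > 0, r x ∈ Set.Ico 0 ρ ∧ momR c 1 (r x) = x) {x : ℝ} (hx : 0 < x) :
    x * (-x * deriv r x / r x) = -(momR c 1 (r x) ^ 2 / momR c 2 (r x)) := by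
  have hI := saddle_mem_Ioo hr hx
  have := hI.1.ne'
  rw [(h.hasDerivAt_saddle hr hx).deriv, (hr x hx).2]
  field_simp

end IsLogAdmissible

/-- The multisets of positive parts with sum `n`. -/
def partMultisets (n : ℕ) : Finset (Multiset ℕ) :=
  Finset.univ.image (Nat.Partition.parts : n.Partition → Multiset ℕ)

lemma mem_partMultisets {n : ℕ} {m : Multiset ℕ} :
    m ∈ partMultisets n ↔ m.sum = n ∧ ∀ i ∈ m, 0 < i := by
  simp only [partMultisets, Finset.mem_image, Finset.mem_univ, true_and]
  constructor
  · rintro ⟨p, rfl⟩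
    exact ⟨p.parts_sum, fun i hi => p.parts_pos hi⟩
  · rintro ⟨h1, h2⟩
    exact ⟨⟨m, fun {i} hi => h2 i hi, h1⟩, rfl⟩

/-- The weight `∏_j x_j^{m_j} / m_j!` of a multiset with multiplicities `m_j`, over `1 ≤ j ≤ N`. -/
def partWeight (x : ℕ → ℝ) (N : ℕ) (m : Multiset ℕ) : ℝ :=
  ∏ j ∈ Finset.Icc 1 N, x j ^ m.count j / (m.count j).factorial

lemma count_mul_partWeight (x : ℕ → ℝ) {N j : ℕ} (hj : j ∈ Finset.Icc 1 N) {m : Multiset ℕ}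
    (hm : j ∈ m) : m.count j * partWeight x N m = x j * partWeight x N (m.erase j) := by
  rw [partWeight, partWeight, ← Finset.mul_prod_erase _ _ hj, ← Finset.mul_prod_erase _ _ hj,
    Finset.prod_congr rfl fun i hi => by
      rw [← Multiset.count_erase_of_ne (Finset.ne_of_mem_erase hi) m], Multiset.count_erase_self]
  obtain ⟨k, hk⟩ := Nat.exists_eq_succ_of_ne_zero (Multiset.count_ne_zero.2 hm)
  rw [hk, Nat.succ_sub_one, Nat.factorial_succ]
  push_cast
  field_simp
  rw [Nat.succ_eq_add_one]
  ring

lemma partMultisets_sum_recursion (x : ℕ → ℝ) {N n : ℕ} (hn : n ≤ N) :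
    n * ∑ m ∈ partMultisets n, partWeight x N m =
      ∑ j ∈ Finset.Icc 1 n, j * x j * ∑ m ∈ partMultisets (n - j), partWeight x N m := by
  have h1 : ∀ m ∈ partMultisets n, n * partWeight x N m =
      ∑ j ∈ Finset.Icc 1 n, if j ∈ m then j * (x j * partWeight x N (m.erase j)) else 0 := by
    intro m hm
    obtain ⟨hs, hp⟩ := mem_partMultisets.1 hm
    have h2 : (n : ℝ) = ∑ j ∈ Finset.Icc 1 n, (m.count j : ℝ) * j := by
      have h3 : m.sum = ∑ j ∈ Finset.Icc 1 n, m.count j * j := by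
        rw [Finset.sum_multiset_count_of_subset m (Finset.Icc 1 n)]
        · simp
        · intro i hi
          rw [Multiset.mem_toFinset] at hi
          exact Finset.mem_Icc.2 ⟨hp i hi, hs ▸ Multiset.le_sum_of_mem hi⟩
      have h4 := congrArg (Nat.cast : ℕ → ℝ) (hs.symm.trans h3)
      push_cast at h4
      exact h4
    conv_lhs => rw [h2]
    rw [Finset.sum_mul]
    refine Finset.sum_congr rfl fun j hj => ?_
    split_ifs with hjm
    · rw [← count_mul_partWeight x (Finset.Icc_subset_Icc_right hn hj) hjm]
      ring
    · rw [Multiset.count_eq_zero.2 hjm]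
      simp
  rw [Finset.mul_sum, Finset.sum_congr rfl h1, Finset.sum_comm]
  refine Finset.sum_congr rfl fun j hj => ?_
  obtain ⟨hj1, hjn⟩ := Finset.mem_Icc.1 hj
  rw [← Finset.sum_filter, Finset.mul_sum]
  refine Finset.sum_bij' (fun m _ => m.erase j) (fun m _ => j ::ₘ m) ?_ ?_ ?_ ?_ ?_
  · intro m hm
    obtain ⟨hm, hjm⟩ := Finset.mem_filter.1 hm
    obtain ⟨hs, hp⟩ := mem_partMultisets.1 hm
    refine mem_partMultisets.2 ⟨?_, fun i hi => hp i (Multiset.mem_of_mem_erase hi)⟩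
    have := Multiset.sum_erase hjm
    omega
  · intro m hm
    obtain ⟨hs, hp⟩ := mem_partMultisets.1 hm
    refine Finset.mem_filter.2 ⟨mem_partMultisets.2 ⟨?_, fun i hi => ?_⟩,
      Multiset.mem_cons_self j m⟩
    · rw [Multiset.sum_cons]
      omega
    · rcases Multiset.mem_cons.1 hi with rfl | hi
      · exact hj1
      · exact hp i hi
  · intro m hm
    exact Multiset.cons_erase (Finset.mem_filter.1 hm).2
  · intro m hm
    exact Multiset.erase_cons_head j m
  · intro m hm
    ring

/-- The multiset of cycle lengths, fixed points included. -/
def cycleLengths {n : ℕ} (σ : Equiv.Perm (Fin n)) : Multiset ℕ :=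
  σ.cycleType + Multiset.replicate (n - σ.support.card) 1

lemma cycleLengths_mem_partMultisets {n : ℕ} (σ : Equiv.Perm (Fin n)) :
    cycleLengths σ ∈ partMultisets n := by
  have h1 := σ.partition.parts_sum
  have h2 : ∀ i ∈ σ.partition.parts, 0 < i := fun i hi => σ.partition.parts_pos hi
  rw [Equiv.Perm.parts_partition, Fintype.card_fin] at h1 h2
  exact mem_partMultisets.2 ⟨h1, h2⟩

lemma filter_cycleLengths {n : ℕ} (σ : Equiv.Perm (Fin n)) :
    (cycleLengths σ).filter (2 ≤ ·) = σ.cycleType := by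
  have := σ.filter_parts_partition_eq_cycleType
  rwa [Equiv.Perm.parts_partition, Fintype.card_fin] at this

lemma count_cycleLengths {n j : ℕ} (σ : Equiv.Perm (Fin n)) :
    (cycleLengths σ).count j = cycleCount n j σ := by
  rw [cycleLengths, Multiset.count_add, Multiset.count_replicate, cycleCount]
  by_cases hj : j = 1
  · have : (1 : ℕ) ∉ σ.cycleType := fun h => by
      have := Equiv.Perm.two_le_of_mem_cycleType h
      omega
    simp [hj, Multiset.count_eq_zero.2 this]
  · simp [hj, Ne.symm hj]

lemma numCycles_eq_sum (n : ℕ) (σ : Equiv.Perm (Fin n)) :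
    numCycles n σ = ∑ j ∈ Finset.Icc 1 n, cycleCount n j σ := by
  obtain ⟨hs, hp⟩ := mem_partMultisets.1 (cycleLengths_mem_partMultisets σ)
  have : ∑ j ∈ Finset.Icc 1 n, (cycleLengths σ).count j = (cycleLengths σ).card :=
    Multiset.sum_count_eq_card fun i hi =>
      Finset.mem_Icc.2 ⟨hp i hi, (Multiset.le_sum_of_mem hi).trans_eq hs⟩
  simp_rw [count_cycleLengths] at this
  rw [this, cycleLengths, Multiset.card_add, Multiset.card_replicate, numCycles, add_comm]

lemma filter_add_replicate {m : Multiset ℕ} (hm : ∀ i ∈ m, 0 < i) :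
    m = m.filter (2 ≤ ·) + Multiset.replicate (m.count 1) 1 := by
  conv_lhs => rw [← Multiset.filter_add_not (2 ≤ ·) m]
  congr 1
  rw [← Multiset.filter_eq' m 1]
  refine Multiset.filter_congr fun i hi => ?_
  have := hm i hi
  omega

/-- The number of permutations with prescribed cycle lengths. -/
lemma card_cycleLengths_mul {n : ℕ} {m : Multiset ℕ} (hm : m ∈ partMultisets n) :
    (Finset.univ.filter fun σ : Equiv.Perm (Fin n) => cycleLengths σ = m).card *
      ∏ j ∈ Finset.Icc 1 n, (j ^ m.count j * (m.count j).factorial) = n.factorial := by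
  obtain ⟨hs, hp⟩ := mem_partMultisets.1 hm
  have hdec := filter_add_replicate hp
  set q := m.filter (2 ≤ ·) with hq
  have hq2 : ∀ a ∈ q, 2 ≤ a := fun a ha => (Multiset.mem_filter.1 ha).2
  have hsum : q.sum + m.count 1 = n := by
    have := congrArg Multiset.sum hdec
    rw [Multiset.sum_add, Multiset.sum_replicate, hs] at this
    simpa using this.symm
  have hfil : (Finset.univ.filter fun σ : Equiv.Perm (Fin n) => cycleLengths σ = m) =
      Finset.univ.filter fun σ : Equiv.Perm (Fin n) => σ.cycleType = q := by
    refine Finset.filter_congr fun σ _ => ⟨fun h => ?_, fun h => ?_⟩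
    · rw [hq, ← h, filter_cycleLengths]
    · have h1 : n - σ.support.card = m.count 1 := by
        rw [← Equiv.Perm.sum_cycleType, h]
        omega
      rw [cycleLengths, h, h1]
      exact hdec.symm
  have hcard := Equiv.Perm.card_of_cycleType_mul_eq (Fin n) q
  rw [if_pos ⟨by rw [Fintype.card_fin]; omega, hq2⟩, Fintype.card_fin] at hcard
  rw [hfil, ← hcard]
  congr 1
  have hcount : ∀ j, m.count j = q.count j + if j = 1 then m.count 1 else 0 := by
    intro j
    conv_lhs => rw [hdec]
    rw [Multiset.count_add, Multiset.count_replicate]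
    simp only [eq_comm]
  have hq1 : q.count 1 = 0 := Multiset.count_eq_zero.2 fun h => by
    have := hq2 1 h
    omega
  have hsub : q.toFinset ⊆ Finset.Icc 1 n := fun i hi => by
    rw [Multiset.mem_toFinset] at hi
    have := Multiset.le_sum_of_mem hi
    have := hq2 i hi
    exact Finset.mem_Icc.2 ⟨by omega, by omega⟩
  have h1 : ∏ j ∈ Finset.Icc 1 n, (q.count j).factorial =
      ∏ j ∈ q.toFinset, (q.count j).factorial :=
    (Finset.prod_subset hsub fun j _ hj => by
      rw [Multiset.count_eq_zero.2 (mt Multiset.mem_toFinset.2 hj), Nat.factorial_zero]).symm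
  have h2 : ∏ j ∈ Finset.Icc 1 n, j ^ q.count j = q.prod :=
    (Finset.prod_multiset_count_of_subset q _ hsub).symm
  have h3 : ∏ j ∈ Finset.Icc 1 n, (if j = 1 then (m.count 1).factorial else 1) =
      (m.count 1).factorial := by
    rw [Finset.prod_ite_eq']
    split_ifs with h
    · rfl
    · have : n = 0 := by simpa using h
      have : m.count 1 = 0 := by omega
      simp [this]
  have h4 : n - q.sum = m.count 1 := by omega
  rw [h4, ← h1, ← h2, ← h3, ← Finset.prod_mul_distrib, ← Finset.prod_mul_distrib]
  refine Finset.prod_congr rfl fun j _ => ?_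
  rw [hcount j]
  by_cases hj : j = 1
  · subst hj
    simp [hq1]
  · simp [hj]

/-- The generating polynomial of the cycle count, `w ↦ (1/n!) Σ_σ ∏_j θ_j^{c_j(σ)} w^{K(σ)}`. -/
def ewensPoly (θ : ℕ → ℝ) (n : ℕ) : Polynomial ℝ :=
  ∑ σ : Equiv.Perm (Fin n),
    Polynomial.C ((n.factorial : ℝ)⁻¹ * ewensWeight θ n σ) * Polynomial.X ^ numCycles n σ

lemma eval_ewensPoly (θ : ℕ → ℝ) (n : ℕ) (w : ℝ) :
    (ewensPoly θ n).eval w =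
      (n.factorial : ℝ)⁻¹ * ∑ σ : Equiv.Perm (Fin n), w ^ numCycles n σ * ewensWeight θ n σ := by
  rw [ewensPoly, Polynomial.eval_finsetSum, Finset.mul_sum]
  refine Finset.sum_congr rfl fun σ _ => ?_
  simp
  ring

lemma eval_ewensPoly_eq_sum_partWeight (θ : ℕ → ℝ) (n : ℕ) (w : ℝ) :
    (ewensPoly θ n).eval w =
      ∑ m ∈ partMultisets n, partWeight (fun j => w * thetaCoeff θ j) n m := by
  rw [eval_ewensPoly, ← Finset.sum_fiberwise_of_maps_to
    (fun σ _ => cycleLengths_mem_partMultisets σ), Finset.mul_sum]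
  refine Finset.sum_congr rfl fun m hm => ?_
  have h1 : ∀ σ ∈ Finset.univ.filter fun σ : Equiv.Perm (Fin n) => cycleLengths σ = m,
      w ^ numCycles n σ * ewensWeight θ n σ = ∏ j ∈ Finset.Icc 1 n, (w * θ j) ^ m.count j := by
    intro σ hσ
    rw [numCycles_eq_sum, ← Finset.prod_pow_eq_pow_sum, ewensWeight, ← Finset.prod_mul_distrib]
    refine Finset.prod_congr rfl fun j _ => ?_
    rw [← (Finset.mem_filter.1 hσ).2, count_cycleLengths, mul_pow]
  rw [Finset.sum_congr rfl h1, Finset.sum_const, nsmul_eq_mul]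
  have h2 := card_cycleLengths_mul hm
  have h3 : ∏ j ∈ Finset.Icc 1 n, (w * θ j) ^ m.count j =
      partWeight (fun j => w * thetaCoeff θ j) n m *
        ((∏ j ∈ Finset.Icc 1 n, (j ^ m.count j * (m.count j).factorial) : ℕ) : ℝ) := by
    push_cast
    rw [partWeight, ← Finset.prod_mul_distrib]
    refine Finset.prod_congr rfl fun j hj => ?_
    have hj0 : j ≠ 0 := by
      have := (Finset.mem_Icc.1 hj).1
      omega
    have : w * θ j = w * thetaCoeff θ j * j := by
      rw [thetaCoeff, if_neg hj0]
      field_simp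
    have hf : ((m.count j).factorial : ℝ) ≠ 0 := by exact_mod_cast Nat.factorial_ne_zero _
    rw [this, mul_pow]
    field_simp
  have hf : (n.factorial : ℝ) ≠ 0 := by exact_mod_cast Nat.factorial_ne_zero _
  rw [h3, mul_left_comm _ (partWeight _ _ _), mul_left_comm _ (partWeight _ _ _), ← Nat.cast_mul,
    h2, inv_mul_cancel₀ hf, mul_one]

lemma partWeight_eq_of_le (x : ℕ → ℝ) {n N : ℕ} (hn : n ≤ N) {m : Multiset ℕ}
    (hm : m ∈ partMultisets n) : partWeight x N m = partWeight x n m := by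
  refine (Finset.prod_subset (Finset.Icc_subset_Icc_right hn) fun j hj hj' => ?_).symm
  obtain ⟨hs, -⟩ := mem_partMultisets.1 hm
  have : j ∉ m := fun h => hj' (Finset.mem_Icc.2
    ⟨(Finset.mem_Icc.1 hj).1, (Multiset.le_sum_of_mem h).trans_eq hs⟩)
  simp [Multiset.count_eq_zero.2 this]

lemma eval_ewensPoly_zero (θ : ℕ → ℝ) (w : ℝ) : (ewensPoly θ 0).eval w = 1 := by
  rw [eval_ewensPoly]
  simp [numCycles, ewensWeight]

lemma eval_ewensPoly_recursion (θ : ℕ → ℝ) (n : ℕ) (w : ℝ) :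
    n * (ewensPoly θ n).eval w = w * ∑ j ∈ Finset.Icc 1 n,
      j * thetaCoeff θ j * (ewensPoly θ (n - j)).eval w := by
  rw [eval_ewensPoly_eq_sum_partWeight, partMultisets_sum_recursion _ le_rfl, Finset.mul_sum]
  refine Finset.sum_congr rfl fun j hj => ?_
  rw [eval_ewensPoly_eq_sum_partWeight,
    Finset.sum_congr rfl fun m hm => partWeight_eq_of_le _ (Nat.sub_le n j) hm]
  ring

namespace PosSeries

variable {c : ℕ → ℝ} {ρ t : ℝ}

lemma hasFPowerSeriesAt_momC (h : PosSeries c ρ) (hρ : 0 < ρ) :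
    HasFPowerSeriesAt (momC c 0) (FormalMultilinearSeries.ofScalars ℂ fun n => (c n : ℂ)) 0 := by
  rw [hasFPowerSeriesAt_iff]
  filter_upwards [Metric.ball_mem_nhds (0 : ℂ) hρ] with z hz
  have := (h.summable_momC 0 (mem_ball_zero_iff.1 hz)).hasSum
  simpa [momC, FormalMultilinearSeries.coeff_ofScalars, mul_comm] using this

lemma iteratedDeriv_momC_zero (h : PosSeries c ρ) (hρ : 0 < ρ) (n : ℕ) :
    iteratedDeriv n (momC c 0) 0 = n.factorial * c n := by
  have h1 := h.hasFPowerSeriesAt_momC hρ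
  have h2 := h1.eq_formalMultilinearSeries (AnalyticAt.hasFPowerSeriesAt ⟨_, h1⟩)
  have h3 := congrArg (fun p => p.coeff n) h2
  simp only [FormalMultilinearSeries.coeff_ofScalars] at h3
  rw [h3, mul_div_cancel₀]
  exact_mod_cast n.factorial_ne_zero

lemma differentiableOn_momC (h : PosSeries c ρ) (k : ℕ) :
    DifferentiableOn ℂ (momC c k) (Metric.ball 0 ρ) := fun z hz => by
  obtain ⟨d, hd, -⟩ := h.exists_hasDerivAt_momC k (mem_ball_zero_iff.1 hz)
  exact hd.differentiableAt.differentiableWithinAt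

lemma momC_zero_zero (c : ℕ → ℝ) : momC c 0 0 = c 0 := by
  rw [momC, tsum_eq_single 0 fun j hj => by simp [hj]]
  simp

/-- The Taylor coefficients of `exp (w g_θ)` at the origin. -/
lemma iteratedDeriv_cexp_momC {θ : ℕ → ℝ} (h : PosSeries (thetaCoeff θ) ρ) (hρ : 0 < ρ) (w : ℝ)
    (n : ℕ) : iteratedDeriv n (fun z => Complex.exp (w * momC (thetaCoeff θ) 0 z)) 0 =
      n.factorial * ((ewensPoly θ n).eval w : ℝ) := by
  set c := thetaCoeff θ with hc
  have hg : AnalyticAt ℂ (momC c 0) 0 := ⟨_, h.hasFPowerSeriesAt_momC hρ⟩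
  have hF : AnalyticAt ℂ (fun z => Complex.exp (w * momC c 0 z)) 0 := by fun_prop
  have hdF : deriv (fun z => Complex.exp (w * momC c 0 z)) =ᶠ[𝓝 0]
      fun z => (w * deriv (momC c 0) z) * Complex.exp (w * momC c 0 z) := by
    filter_upwards [Metric.ball_mem_nhds (0 : ℂ) hρ] with z hz
    have hd := ((h.differentiableOn_momC 0).differentiableAt (Metric.isOpen_ball.mem_nhds hz))
    rw [(hd.hasDerivAt.const_mul (w : ℂ)).cexp.deriv, mul_comm]
  induction n using Nat.strong_induction_on with
  | _ n ih =>
    rcases n with _ | n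
    · simp [momC_zero_zero, hc, thetaCoeff_zero, eval_ewensPoly_zero]
    · have hW : AnalyticAt ℂ (fun z => (w : ℂ) * deriv (momC c 0) z) 0 :=
        analyticAt_const.fun_mul hg.deriv
      rw [iteratedDeriv_succ', hdF.iteratedDeriv_eq n,
        iteratedDeriv_fun_mul hW.contDiffAt hF.contDiffAt]
      have hrec := eval_ewensPoly_recursion θ (n + 1) w
      rw [← Finset.Ico_succ_right_eq_Icc, Finset.sum_Ico_eq_sum_range] at hrec
      have hrec' := congrArg (fun x : ℝ => (x : ℂ)) hrec
      simp only [Nat.succ_eq_succ, Nat.succ_eq_add_one, Nat.add_sub_cancel] at hrec'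
      rw [Nat.factorial_succ, Nat.cast_mul, mul_comm ((n + 1 : ℕ) : ℂ), mul_assoc]
      push_cast at hrec' ⊢
      rw [hrec', Finset.mul_sum, Finset.mul_sum]
      refine Finset.sum_congr rfl fun i hi => ?_
      have hin : i ≤ n := Nat.lt_succ_iff.1 (Finset.mem_range.1 hi)
      rw [iteratedDeriv_const_mul_field, ← iteratedDeriv_succ', h.iteratedDeriv_momC_zero hρ,
        ih (n - i) (by omega), Nat.factorial_succ, show n + 1 - (1 + i) = n - i by omega,
        add_comm 1 i, ← Nat.choose_mul_factorial_mul_factorial hin]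
      push_cast
      ring

lemma integral_cexp_momArc {θ : ℕ → ℝ} (h : PosSeries (thetaCoeff θ) ρ) (ht : t ∈ Set.Ioo 0 ρ)
    (w : ℝ) (n : ℕ) :
    ∫ φ in (-Real.pi)..Real.pi,
      Complex.exp (w * momArc (thetaCoeff θ) t 0 φ - n * (φ * Complex.I)) =
      2 * Real.pi * t ^ n * ((ewensPoly θ n).eval w : ℝ) := by
  have hρ : 0 < ρ := ht.1.trans ht.2
  set c := thetaCoeff θ
  set F : ℂ → ℂ := fun z => Complex.exp (w * momC c 0 z)
  have hd : DifferentiableOn ℂ F (Metric.closedBall 0 t) :=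
    (((h.differentiableOn_momC 0).const_mul (w : ℂ)).cexp).mono
      (Metric.closedBall_subset_ball ht.2)
  have hC := hd.circleIntegral_one_div_sub_center_pow_smul ht.1 n
  rw [h.iteratedDeriv_cexp_momC hρ, circleIntegral] at hC
  have ht0 : (t : ℂ) ≠ 0 := by exact_mod_cast ht.1.ne'
  have hper : Function.Periodic (fun φ : ℝ =>
      Complex.exp (w * momArc c t 0 φ - n * (φ * Complex.I))) (2 * Real.pi) := by
    intro φ
    have h1 : momArc c t 0 (φ + 2 * Real.pi) = momArc c t 0 φ := by
      simp only [momArc]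
      push_cast
      rw [add_mul, Complex.exp_add, Complex.exp_two_pi_mul_I, mul_one]
    have h2 : ((φ + 2 * Real.pi : ℝ) : ℂ) * Complex.I =
        φ * Complex.I + 2 * Real.pi * Complex.I := by
      push_cast; ring
    simp only [h1, h2, mul_add, ← sub_sub, Complex.exp_sub, Complex.exp_nat_mul_two_pi_mul_I,
      div_one]
  have hshift := hper.intervalIntegral_add_eq (-Real.pi) 0
  rw [show -Real.pi + 2 * Real.pi = Real.pi by ring, zero_add] at hshift
  rw [hshift]
  have hcircle : ∀ φ : ℝ, deriv (circleMap 0 t) φ • (1 / (circleMap 0 t φ - 0) ^ (n + 1)) •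
      F (circleMap 0 t φ) = Complex.I / t ^ n *
        Complex.exp (w * momArc c t 0 φ - n * (φ * Complex.I)) := by
    intro φ
    have h3 : F (circleMap 0 t φ) = Complex.exp (w * momArc c t 0 φ) := by
      simp [F, circleMap, momArc]
    rw [h3, deriv_circleMap, sub_zero, Complex.exp_sub, Complex.exp_nat_mul, circleMap_zero]
    simp only [smul_eq_mul]
    field_simp
    ring
  simp_rw [hcircle] at hC
  rw [intervalIntegral.integral_const_mul] at hC
  have hI := Complex.I_ne_zero
  have hf : (n.factorial : ℂ) ≠ 0 := by exact_mod_cast n.factorial_ne_zero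
  rw [smul_eq_mul, div_mul_eq_mul_div, div_eq_iff (pow_ne_zero n ht0)] at hC
  have : Complex.I * ∫ φ in (0 : ℝ)..2 * Real.pi,
      Complex.exp (w * momArc c t 0 φ - n * (φ * Complex.I)) =
      Complex.I * (2 * Real.pi * t ^ n * ((ewensPoly θ n).eval w : ℝ)) := by
    rw [hC]
    field_simp
  exact mul_left_cancel₀ hI this

end PosSeries

namespace PosSeries

variable {c θ : ℕ → ℝ} {ρ t w : ℝ} {n : ℕ}

/-- Cauchy's formula for the derivatives of the weighted cycle polynomial. -/
lemma integral_pow_mul_cexp_momArc (h : PosSeries (thetaCoeff θ) ρ) (ht : t ∈ Set.Ioo 0 ρ)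
    (n j : ℕ) (w : ℝ) :
    ∫ φ in (-Real.pi)..Real.pi, momArc (thetaCoeff θ) t 0 φ ^ j *
      Complex.exp (w * momArc (thetaCoeff θ) t 0 φ - n * (φ * Complex.I)) =
      2 * Real.pi * t ^ n * ((Polynomial.derivative^[j] (ewensPoly θ n)).eval w : ℝ) := by
  set γ := momArc (thetaCoeff θ) t 0 with hγ
  have hγc : Continuous γ := h.continuous_momArc (Set.Ioo_subset_Ico_self ht) 0
  induction j generalizing w with
  | zero => simpa using h.integral_cexp_momArc ht w n
  | succ j ih =>
    set F : ℝ → ℝ → ℂ := fun v φ => γ φ ^ j * Complex.exp (v * γ φ - n * (φ * Complex.I))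
    set F' : ℝ → ℝ → ℂ := fun v φ =>
      γ φ ^ (j + 1) * Complex.exp (v * γ φ - n * (φ * Complex.I))
    have hFc : ∀ v, Continuous (F v) := fun v => by fun_prop
    have hF'c : ∀ v, Continuous (F' v) := fun v => by fun_prop
    have hb : ∀ φ, ‖γ φ‖ ≤ momR (thetaCoeff θ) 0 t :=
      h.norm_momArc_le (Set.Ioo_subset_Ico_self ht) 0
    set m := momR (thetaCoeff θ) 0 t
    have hm : 0 ≤ m := (norm_nonneg _).trans (hb 0)
    have hderiv := intervalIntegral.hasDerivAt_integral_of_dominated_loc_of_deriv_le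
      (μ := volume) (a := -Real.pi) (b := Real.pi) (F := F) (F' := F') (x₀ := w)
      (bound := fun _ => m ^ (j + 1) * Real.exp ((|w| + 1) * m))
      (Metric.ball_mem_nhds w one_pos)
      (Filter.Eventually.of_forall fun v => (hFc v).aestronglyMeasurable)
      ((hFc w).intervalIntegrable _ _) (hF'c w).aestronglyMeasurable
      (Filter.Eventually.of_forall fun φ _ v hv => ?_)
      intervalIntegrable_const
      (Filter.Eventually.of_forall fun φ _ v _ => ?_)
    · have hpoly : HasDerivAt (fun v : ℝ => 2 * Real.pi * (t : ℂ) ^ n *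
          ((Polynomial.derivative^[j] (ewensPoly θ n)).eval v : ℝ))
          (2 * Real.pi * (t : ℂ) ^ n *
          ((Polynomial.derivative^[j] (ewensPoly θ n)).derivative.eval w : ℝ)) w :=
        (Polynomial.hasDerivAt _ w).ofReal_comp.const_mul _
      have heq : (fun v : ℝ => ∫ φ in (-Real.pi)..Real.pi, F v φ) = fun v : ℝ =>
          2 * Real.pi * (t : ℂ) ^ n *
            ((Polynomial.derivative^[j] (ewensPoly θ n)).eval v : ℝ) := funext ih
      have h2 := hderiv.2
      rw [heq] at h2
      rw [Function.iterate_succ_apply', ← hpoly.unique h2]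
    · have hv' : |v| ≤ |w| + 1 := by
        have h1 := abs_sub_abs_le_abs_sub v w
        have h2 : |v - w| < 1 := by simpa [Real.dist_eq] using hv
        linarith
      rw [norm_mul, norm_pow, Complex.norm_exp]
      gcongr
      · exact hb φ
      · have h1 : ((v : ℂ) * γ φ - n * (φ * Complex.I)).re = v * (γ φ).re := by simp
        rw [h1]
        calc v * (γ φ).re ≤ |v * (γ φ).re| := le_abs_self _
          _ = |v| * |(γ φ).re| := abs_mul _ _
          _ ≤ (|w| + 1) * m := by
            gcongr
            exact (Complex.abs_re_le_norm _).trans (hb φ)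
    · have h1 : HasDerivAt (fun v : ℝ => (v : ℂ) * γ φ - n * (φ * Complex.I)) (γ φ) v := by
        simpa using ((Complex.ofRealCLM.hasDerivAt (x := v)).mul_const (γ φ)).sub_const
          (n * (φ * Complex.I))
      refine (h1.cexp.const_mul (γ φ ^ j)).congr_deriv ?_
      simp only [F', pow_succ]
      ring

/-- The derivatives of the weighted cycle polynomial at a saddle point. -/
lemma eval_iterate_derivative_ewensPoly (h : PosSeries (thetaCoeff θ) ρ) (ht : t ∈ Set.Ioo 0 ρ)
    (hn : (n : ℝ) = w * momR (thetaCoeff θ) 1 t)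
    (hZ : ∫ φ in (-Real.pi)..Real.pi, arcWeight (thetaCoeff θ) t w φ ≠ 0) (j : ℕ) :
    (((Polynomial.derivative^[j] (ewensPoly θ n)).eval w : ℝ) : ℂ) =
      ((ewensPoly θ n).eval w : ℝ) *
        arcAvg (thetaCoeff θ) t w (fun φ => momArc (thetaCoeff θ) t 0 φ ^ j) := by
  have hj := h.integral_pow_mul_cexp_momArc ht n j w
  have h0 := h.integral_cexp_momArc ht w n
  set c := thetaCoeff θ
  have hn' : (n : ℂ) = w * momR c 1 t := by exact_mod_cast congrArg (fun x : ℝ => (x : ℂ)) hn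
  have hexp : ∀ φ : ℝ, Complex.exp (w * momArc c t 0 φ - n * (φ * Complex.I)) =
      Complex.exp (w * momR c 0 t) * arcWeight c t w φ := by
    intro φ
    rw [arcWeight, ← Complex.exp_add, hn']
    congr 1
    ring
  simp_rw [hexp] at hj h0
  rw [intervalIntegral.integral_const_mul] at h0
  simp_rw [fun φ => mul_left_comm (momArc c t 0 φ ^ j) (Complex.exp (w * momR c 0 t))] at hj
  rw [intervalIntegral.integral_const_mul] at hj
  have hA : ∫ φ in (-Real.pi)..Real.pi, momArc c t 0 φ ^ j * arcWeight c t w φ =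
      arcAvg c t w (fun φ => momArc c t 0 φ ^ j) *
        ∫ φ in (-Real.pi)..Real.pi, arcWeight c t w φ := by
    rw [arcAvg, div_mul_cancel₀ _ hZ]
  rw [hA] at hj
  have hpt : (2 * Real.pi * t ^ n : ℂ) ≠ 0 := by
    have := pow_pos ht.1 n
    have := Real.pi_pos
    exact_mod_cast (by positivity : (2 * Real.pi * t ^ n : ℝ) ≠ 0)
  refine mul_left_cancel₀ hpt ?_
  linear_combination -hj + arcAvg c t w (fun φ => momArc c t 0 φ ^ j) * h0

lemma eval_ewensPoly_pos (h : PosSeries (thetaCoeff θ) ρ) (hθ : ∀ j, 0 ≤ θ j)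
    (ht : t ∈ Set.Ioo 0 ρ) (hw : 0 ≤ w)
    (hn : (n : ℝ) = w * momR (thetaCoeff θ) 1 t)
    (hZ : ∫ φ in (-Real.pi)..Real.pi, arcWeight (thetaCoeff θ) t w φ ≠ 0) :
    0 < (ewensPoly θ n).eval w := by
  have hnn : 0 ≤ (ewensPoly θ n).eval w := by
    rw [eval_ewensPoly]
    refine mul_nonneg (by positivity) (Finset.sum_nonneg fun σ _ => mul_nonneg (by positivity) ?_)
    exact Finset.prod_nonneg fun j _ => pow_nonneg (hθ j) _
  refine hnn.lt_of_ne' fun h0 => hZ ?_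
  have h1 := h.integral_cexp_momArc ht w n
  rw [h0, Complex.ofReal_zero, mul_zero] at h1
  set c := thetaCoeff θ
  have hn' : (n : ℂ) = w * momR c 1 t := by exact_mod_cast congrArg (fun x : ℝ => (x : ℂ)) hn
  have hexp : ∀ φ : ℝ, Complex.exp (w * momArc c t 0 φ - n * (φ * Complex.I)) =
      Complex.exp (w * momR c 0 t) * arcWeight c t w φ := by
    intro φ
    rw [arcWeight, ← Complex.exp_add, hn']
    congr 1
    ring
  simp_rw [hexp] at h1
  rw [intervalIntegral.integral_const_mul] at h1
  exact (mul_eq_zero.1 h1).resolve_left (Complex.exp_ne_zero _)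

lemma arcAvg_momArc_pow (h : PosSeries c ρ) (ht : t ∈ Set.Ico 0 ρ)
    (hZ : ∫ φ in (-Real.pi)..Real.pi, arcWeight c t w φ ≠ 0) {Q : ℕ → ℂ}
    (hQ : ∀ j, Q j = arcAvg c t w (fun φ => (momArc c t 0 φ - momR c 0 t) ^ j)) :
    arcAvg c t w (fun φ => momArc c t 0 φ ^ 1) = momR c 0 t + Q 1 ∧
    arcAvg c t w (fun φ => momArc c t 0 φ ^ 2) =
      momR c 0 t ^ 2 + (2 * momR c 0 t * Q 1 + Q 2) ∧
    arcAvg c t w (fun φ => momArc c t 0 φ ^ 3) =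
      momR c 0 t ^ 3 + (3 * momR c 0 t ^ 2 * Q 1 + (3 * momR c 0 t * Q 2 + Q 3)) := by
  have hγ := h.continuous_momArc ht 0
  obtain ⟨m, hm⟩ : ∃ m : ℂ, m = momR c 0 t := ⟨_, rfl⟩
  simp only [hQ, ← hm]
  refine ⟨?_, ?_, ?_⟩
  · rw [← arcAvg_const (c := c) (t := t) (w := w) hZ m,
      ← h.arcAvg_add ht (by fun_prop) (by fun_prop)]
    rw [arcAvg_const hZ]
    congr 1; ext φ; ring
  · rw [← arcAvg_const (c := c) (t := t) (w := w) hZ (m ^ 2), ← arcAvg_const_mul,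
      ← h.arcAvg_add ht (by fun_prop) (by fun_prop), ← h.arcAvg_add ht (by fun_prop) (by fun_prop)]
    congr 1; ext φ; ring
  · rw [← arcAvg_const (c := c) (t := t) (w := w) hZ (m ^ 3), ← arcAvg_const_mul,
      ← arcAvg_const_mul,
      ← h.arcAvg_add ht (by fun_prop) (by fun_prop), ← h.arcAvg_add ht (by fun_prop) (by fun_prop),
      ← h.arcAvg_add ht (by fun_prop) (by fun_prop)]
    congr 1; ext φ; ring

end PosSeries

/-- The `j`-th derivative of the weighted cycle polynomial, relative to its value. -/
def ewensRatio (θ : ℕ → ℝ) (n j : ℕ) (w : ℝ) : ℝ :=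
  (Polynomial.derivative^[j] (ewensPoly θ n)).eval w / (ewensPoly θ n).eval w

/-- The first three cumulant-type combinations of `ewensRatio` at a saddle point. -/
lemma IsLogAdmissible.exists_ewensRatio_bound {θ : ℕ → ℝ} {ρ w₀ w₁ : ℝ} {δ r : ℝ → ℝ}
    (h : IsLogAdmissible (momC (thetaCoeff θ) 0) (thetaCoeff θ) ρ
      (momR (thetaCoeff θ) 1) (momR (thetaCoeff θ) 2) δ) (hθ : ∀ j, 0 ≤ θ j)
    (hr : ∀ x > 0, r x ∈ Set.Ico 0 ρ ∧ momR (thetaCoeff θ) 1 (r x) = x) (htech : TechCond r)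
    (hw₀ : 0 < w₀) (hw₁ : w₀ ≤ w₁) :
    ∃ K : ℝ, 0 ≤ K ∧ ∀ᶠ t in 𝓝[<] ρ, ∀ w, w₀ ≤ w → w ≤ w₁ → ∀ n : ℕ,
      (n : ℝ) = w * momR (thetaCoeff θ) 1 t →
      0 < (ewensPoly θ n).eval w ∧
      |ewensRatio θ n 1 w - momR (thetaCoeff θ) 0 t| ≤ K ∧
      |ewensRatio θ n 2 w - ewensRatio θ n 1 w ^ 2 +
        momR (thetaCoeff θ) 1 t ^ 2 / (w * momR (thetaCoeff θ) 2 t)| ≤ K ∧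
      |ewensRatio θ n 3 w - 3 * ewensRatio θ n 1 w * ewensRatio θ n 2 w +
        2 * ewensRatio θ n 1 w ^ 3| ≤
        K + K * (momR (thetaCoeff θ) 1 t ^ 2 / momR (thetaCoeff θ) 2 t) := by
  have hp := h.posSeries
  obtain ⟨K, hK0, hK⟩ := h.exists_laplace_arcWeight hw₀ hw₁
  obtain ⟨C, hC0, hC⟩ := h.exists_moment_bound hr htech
  obtain ⟨A, hA⟩ : ∃ A, A = (1 + C) * K := ⟨_, rfl⟩
  obtain ⟨B, hB⟩ : ∃ B, B = (1 + C) ^ 2 * K + (C + C ^ 2) * K / w₀ := ⟨_, rfl⟩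
  obtain ⟨D, hD⟩ : ∃ D, D = 2 / w₀ * ((1 + C) * K + 1 / w₀) + (1 + C) * K := ⟨_, rfl⟩
  have hA0 : 0 ≤ A := by rw [hA]; positivity
  have hB0 : 0 ≤ B := by rw [hB]; positivity
  have hD0 : 0 ≤ D := by rw [hD]; positivity
  refine ⟨A + (B + A ^ 2) + (D + 3 * A / w₀) + (3 * A * B + 2 * A ^ 3), by positivity, ?_⟩
  filter_upwards [h.eventually_mem_Ioo, hK, hC] with t ht hKt hCt w hww₀ hww₁ n hn
  obtain ⟨hZ, hmom⟩ := hKt w hww₀ hww₁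
  have hw0 := hw₀.trans_le hww₀
  have hK2 := hmom 1 le_rfl one_le_two
  have hK4 := hmom 2 one_le_two le_rfl
  rw [mul_one, pow_one] at hK2
  have htc := Set.Ioo_subset_Ico_self ht
  have h1 := h.momR_pos ht 1
  have h2 := h.momR_pos ht 2
  obtain ⟨b1, b2, b3⟩ := hp.arcAvg_bounds htc hn hw₀ hww₀ hC0 hK0 h1 h2 hCt.1 hCt.2 hZ hK2 hK4
  rw [← hA] at b1
  rw [← hB] at b2
  rw [← hD] at b3
  have hpos := hp.eval_ewensPoly_pos hθ ht hw0.le hn hZ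
  have hratio : ∀ j, (ewensRatio θ n j w : ℂ) =
      arcAvg (thetaCoeff θ) t w (fun φ => momArc (thetaCoeff θ) t 0 φ ^ j) := by
    intro j
    rw [ewensRatio, Complex.ofReal_div, hp.eval_iterate_derivative_ewensPoly ht hn hZ j,
      mul_div_cancel_left₀]
    exact_mod_cast hpos.ne'
  obtain ⟨Q, hQ⟩ : ∃ Q : ℕ → ℂ, ∀ j, Q j = arcAvg (thetaCoeff θ) t w
      (fun φ => (momArc (thetaCoeff θ) t 0 φ - momR (thetaCoeff θ) 0 t) ^ j) :=
    ⟨_, fun _ => rfl⟩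
  obtain ⟨e1, e2, e3⟩ := hp.arcAvg_momArc_pow htc hZ hQ
  rw [← hratio] at e1 e2 e3
  have hQ1 := hQ 1
  simp only [pow_one] at hQ1
  rw [← hQ1] at b1
  rw [← hQ] at b2 b3
  generalize momR (thetaCoeff θ) 0 t = m at *
  have hl : 0 ≤ momR (thetaCoeff θ) 1 t ^ 2 / momR (thetaCoeff θ) 2 t := by positivity
  have hlw : momR (thetaCoeff θ) 1 t ^ 2 / (w * momR (thetaCoeff θ) 2 t) =
      momR (thetaCoeff θ) 1 t ^ 2 / momR (thetaCoeff θ) 2 t / w := by rw [mul_comm, div_div]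
  rw [hlw] at b2 ⊢
  generalize momR (thetaCoeff θ) 1 t ^ 2 / momR (thetaCoeff θ) 2 t = l at *
  have hlw0 : l / w ≤ l / w₀ := by gcongr
  have hQ2 : ‖Q 2‖ ≤ B + l / w₀ := by
    calc ‖Q 2‖ = ‖(Q 2 + (l / w : ℝ)) - (l / w : ℝ)‖ := by congr 1; ring
      _ ≤ ‖Q 2 + (l / w : ℝ)‖ + ‖((l / w : ℝ) : ℂ)‖ := norm_sub_le _ _
      _ ≤ B + l / w₀ := by
        rw [Complex.norm_real, Real.norm_of_nonneg (by positivity)]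
        gcongr
  refine ⟨hpos, ?_, ?_, ?_⟩
  · rw [← Real.norm_eq_abs, ← Complex.norm_real]
    have : ((ewensRatio θ n 1 w - m : ℝ) : ℂ) = Q 1 := by
      push_cast; rw [e1]; ring
    rw [this]
    refine b1.trans ?_
    have : 0 ≤ (B + A ^ 2) + (D + 3 * A / w₀) + (3 * A * B + 2 * A ^ 3) := by positivity
    linarith
  · rw [← Real.norm_eq_abs, ← Complex.norm_real]
    have : ((ewensRatio θ n 2 w - ewensRatio θ n 1 w ^ 2 + l / w : ℝ) : ℂ) =
        (Q 2 + (l / w : ℝ)) - Q 1 ^ 2 := by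
      push_cast; rw [e1, e2]; ring
    rw [this]
    calc _ ≤ ‖Q 2 + (l / w : ℝ)‖ + ‖Q 1‖ ^ 2 := by
          rw [← norm_pow]; exact norm_sub_le _ _
      _ ≤ B + A ^ 2 := by gcongr
      _ ≤ _ := by
        have : 0 ≤ A + (D + 3 * A / w₀) + (3 * A * B + 2 * A ^ 3) := by positivity
        linarith
  · rw [← Real.norm_eq_abs, ← Complex.norm_real]
    have : ((ewensRatio θ n 3 w - 3 * ewensRatio θ n 1 w * ewensRatio θ n 2 w +
        2 * ewensRatio θ n 1 w ^ 3 : ℝ) : ℂ) = Q 3 - 3 * (Q 1 * Q 2) + 2 * Q 1 ^ 3 := by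
      push_cast; rw [e1, e2, e3]; ring
    rw [this]
    calc _ ≤ ‖Q 3‖ + 3 * (‖Q 1‖ * ‖Q 2‖) + 2 * ‖Q 1‖ ^ 3 := by
          refine (norm_add_le _ _).trans (add_le_add ((norm_sub_le _ _).trans ?_) ?_) <;> simp
      _ ≤ D * l + 3 * (A * (B + l / w₀)) + 2 * A ^ 3 := by gcongr
      _ = (3 * A * B + 2 * A ^ 3) + (D + 3 * A / w₀) * l := by ring
      _ ≤ _ := by
        refine add_le_add ?_ (mul_le_mul_of_nonneg_right ?_ hl)
        · have : 0 ≤ A + (B + A ^ 2) + (D + 3 * A / w₀) := by positivity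
          linarith
        · have : 0 ≤ A + (B + A ^ 2) + (3 * A * B + 2 * A ^ 3) := by positivity
          linarith

/-- Second order Taylor expansion around `0` with a bound on the third derivative. -/
lemma abs_sub_taylor_two_le {f f₁ f₂ f₃ : ℝ → ℝ} {K L s : ℝ} (hK : 0 ≤ K)
    (h₁ : ∀ s, |s| < L → HasDerivAt f (f₁ s) s) (h₂ : ∀ s, |s| < L → HasDerivAt f₁ (f₂ s) s)
    (h₃ : ∀ s, |s| < L → HasDerivAt f₂ (f₃ s) s) (hb : ∀ s, |s| < L → |f₃ s| ≤ K)
    (hs : |s| < L) : |f s - f 0 - (f₁ 0 * s + f₂ 0 * s ^ 2 / 2)| ≤ K * |s| ^ 3 := by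
  have b₂ : ∀ s, |s| < L → ‖f₂ s - f₂ 0‖ ≤ K * |s| ^ 1 := fun s hs =>
    norm_le_pow_succ_of_norm_deriv_le (f := fun s => f₂ s - f₂ 0) (j := 0) hK (by simp)
      (fun s hs => (h₃ s hs).sub_const _) (by simpa using hb) hs
  have b₁ : ∀ s, |s| < L → ‖f₁ s - f₁ 0 - f₂ 0 * s‖ ≤ K * |s| ^ 2 := fun s hs =>
    norm_le_pow_succ_of_norm_deriv_le (f := fun s => f₁ s - f₁ 0 - f₂ 0 * s) hK (by simp)
      (fun s hs => ((h₂ s hs).sub_const _).sub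
        (by simpa using (hasDerivAt_id s).const_mul (f₂ 0))) b₂ hs
  refine norm_le_pow_succ_of_norm_deriv_le
    (f := fun s => f s - f 0 - (f₁ 0 * s + f₂ 0 * s ^ 2 / 2))
    (f' := fun s => f₁ s - f₁ 0 - f₂ 0 * s) hK (by simp) (fun s hs => ?_) b₁ hs
  have e := ((h₁ s hs).sub_const (f 0)).sub (((hasDerivAt_id s).const_mul (f₁ 0)).add
    ((((hasDerivAt_id s).pow 2).const_mul (f₂ 0)).div_const 2))
  refine e.congr_deriv ?_
  simp
  ring

lemma hasDerivAt_ewensRatio {θ : ℕ → ℝ} {n : ℕ} {w : ℝ} (hw : (ewensPoly θ n).eval w ≠ 0)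
    (j : ℕ) : HasDerivAt (ewensRatio θ n j)
      (ewensRatio θ n (j + 1) w - ewensRatio θ n j w * ewensRatio θ n 1 w) w := by
  refine ((Polynomial.hasDerivAt (Polynomial.derivative^[j] (ewensPoly θ n)) w).div
    (Polynomial.hasDerivAt (ewensPoly θ n) w) hw).congr_deriv ?_
  simp only [ewensRatio, Function.iterate_succ_apply', Function.iterate_zero, id]
  field_simp

lemma hasDerivAt_exp_neg (s : ℝ) :
    HasDerivAt (fun s : ℝ => Real.exp (-s)) (-Real.exp (-s)) s := by
  simpa using (hasDerivAt_neg s).exp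

/-- The derivatives of the cumulant generating function of the number of cycles. -/
lemma hasDerivAt_log_ewensPoly {θ : ℕ → ℝ} {n : ℕ} {s : ℝ}
    (hw : (ewensPoly θ n).eval (Real.exp (-s)) ≠ 0) :
    HasDerivAt (fun s => Real.log ((ewensPoly θ n).eval (Real.exp (-s))))
      (-(Real.exp (-s) * ewensRatio θ n 1 (Real.exp (-s)))) s ∧
    HasDerivAt (fun s => -(Real.exp (-s) * ewensRatio θ n 1 (Real.exp (-s))))
      (Real.exp (-s) * ewensRatio θ n 1 (Real.exp (-s)) + Real.exp (-s) ^ 2 *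
        (ewensRatio θ n 2 (Real.exp (-s)) - ewensRatio θ n 1 (Real.exp (-s)) ^ 2)) s ∧
    HasDerivAt (fun s => Real.exp (-s) * ewensRatio θ n 1 (Real.exp (-s)) + Real.exp (-s) ^ 2 *
        (ewensRatio θ n 2 (Real.exp (-s)) - ewensRatio θ n 1 (Real.exp (-s)) ^ 2))
      (-(Real.exp (-s) * ewensRatio θ n 1 (Real.exp (-s)) + 3 * Real.exp (-s) ^ 2 *
        (ewensRatio θ n 2 (Real.exp (-s)) - ewensRatio θ n 1 (Real.exp (-s)) ^ 2) +
        Real.exp (-s) ^ 3 * (ewensRatio θ n 3 (Real.exp (-s)) -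
          3 * ewensRatio θ n 1 (Real.exp (-s)) * ewensRatio θ n 2 (Real.exp (-s)) +
          2 * ewensRatio θ n 1 (Real.exp (-s)) ^ 3))) s := by
  have he := hasDerivAt_exp_neg s
  have h1 := (hasDerivAt_ewensRatio hw 1).comp s he
  have h2 := (hasDerivAt_ewensRatio hw 2).comp s he
  refine ⟨?_, ?_, ?_⟩
  · refine (((Polynomial.hasDerivAt (ewensPoly θ n) _).comp s he).log hw).congr_deriv ?_
    simp only [ewensRatio, Function.iterate_succ_apply', Function.iterate_zero, id,
      Function.comp_apply]
    ring
  · refine (he.mul h1).neg.congr_deriv ?_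
    simp only [Function.comp_apply]
    ring
  · refine ((he.mul h1).add ((he.pow 2).mul (h2.sub (h1.pow 2)))).congr_deriv ?_
    simp only [Function.comp_apply, Pi.sub_apply, Pi.pow_apply, Nat.cast_ofNat]
    ring

lemma log_ewensExpect_exp {θ : ℕ → ℝ} {n : ℕ} {s : ℝ}
    (hs : 0 < (ewensPoly θ n).eval (Real.exp (-s)))
    (h0 : 0 < (ewensPoly θ n).eval (Real.exp (-0))) :
    Real.log (ewensExpect θ n fun σ => Real.exp (-s * (numCycles n σ : ℝ))) =
      Real.log ((ewensPoly θ n).eval (Real.exp (-s))) -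
        Real.log ((ewensPoly θ n).eval (Real.exp (-0))) := by
  rw [← Real.log_div hs.ne' h0.ne', eval_ewensPoly, eval_ewensPoly, mul_div_mul_left _ _
    (by positivity), ewensExpect]
  simp only [neg_zero, Real.exp_zero, one_pow, one_mul]
  congr 2
  refine Finset.sum_congr rfl fun σ _ => ?_
  rw [mul_comm (-s), Real.exp_nat_mul]

namespace IsLogAdmissible

variable {θ : ℕ → ℝ} {ρ : ℝ} {δ r : ℝ → ℝ}

lemma momR_zero_le_sSup
    (h : IsLogAdmissible (momC (thetaCoeff θ) 0) (thetaCoeff θ) ρ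
      (momR (thetaCoeff θ) 1) (momR (thetaCoeff θ) 2) δ)
    (hr : ∀ x > 0, r x ∈ Set.Ico 0 ρ ∧ momR (thetaCoeff θ) 1 (r x) = x) {u v x : ℝ}
    (hu : 0 < u) (hx : x ∈ Set.Icc u v) :
    momR (thetaCoeff θ) 0 (r x) ≤ sSup ((fun x : ℝ => gThetaR θ (r x) +
      x * |(-x * deriv r x / r x)|) '' Set.Icc u v) := by
  have hval : ∀ y ∈ Set.Icc u v, gThetaR θ (r y) + y * |(-y * deriv r y / r y)| =
      momR (thetaCoeff θ) 0 (r y) +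
        momR (thetaCoeff θ) 1 (r y) ^ 2 / momR (thetaCoeff θ) 2 (r y) := fun y hy => by
    have hy0 := hu.trans_le hy.1
    have hI := saddle_mem_Ioo hr hy0
    have h2 := h.momR_pos hI 2
    rw [gThetaR_eq_momR, ← congrArg (· * _) (abs_of_pos hy0), ← abs_mul,
      h.mul_deriv_saddle_div hr hy0, abs_neg, abs_of_nonneg (by positivity)]
  have hle : momR (thetaCoeff θ) 0 (r x) ≤ gThetaR θ (r x) + x * |(-x * deriv r x / r x)| := by
    have := h.momR_pos (saddle_mem_Ioo hr (hu.trans_le hx.1)) 2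
    rw [hval x hx]
    exact le_add_of_nonneg_right (by positivity)
  refine hle.trans (le_csSup ?_ (Set.mem_image_of_mem _ hx))
  refine ⟨2 * momR (thetaCoeff θ) 0 (r v), ?_⟩
  rintro _ ⟨y, hy, rfl⟩
  have hy0 := hu.trans_le hy.1
  have hv0 := hy0.trans_le hy.2
  have hI := saddle_mem_Ioo hr hy0
  have hm : momR (thetaCoeff θ) 0 (r y) ≤ momR (thetaCoeff θ) 0 (r v) :=
    h.posSeries.momR_monotoneOn 0 (Set.Ioo_subset_Ico_self hI) (hr v hv0).1
      (h.saddle_monotoneOn hr hy0 hv0 hy.2)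
  have hl := h.posSeries.sq_div_le (Set.Ioo_subset_Ico_self hI) (h.momR_pos hI 2)
  simp only
  rw [hval y hy]
  linarith

/-- The bounds on `ewensRatio`, evaluated at the saddle points `r (n e^s)`. -/
lemma exists_ewensRatio_saddle_bound
    (h : IsLogAdmissible (momC (thetaCoeff θ) 0) (thetaCoeff θ) ρ
      (momR (thetaCoeff θ) 1) (momR (thetaCoeff θ) 2) δ) (hθ : ∀ j, 0 ≤ θ j)
    (hr : ∀ x > 0, r x ∈ Set.Ico 0 ρ ∧ momR (thetaCoeff θ) 1 (r x) = x) (htech : TechCond r)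
    {M : ℝ} (hM : 0 < M) :
    ∃ K : ℝ, 0 ≤ K ∧ ∀ᶠ n : ℕ in atTop, 0 < n ∧ ∀ s, |s| < M → ∀ m l w,
      m = momR (thetaCoeff θ) 0 (r (Real.exp s * n)) →
      l = momR (thetaCoeff θ) 1 (r (Real.exp s * n)) ^ 2 /
        momR (thetaCoeff θ) 2 (r (Real.exp s * n)) →
      w = Real.exp (-s) →
      1 ≤ m ∧ 0 ≤ l ∧ l ≤ m ∧
      0 < (ewensPoly θ n).eval w ∧
      |ewensRatio θ n 1 w - m| ≤ K ∧
      |ewensRatio θ n 2 w - ewensRatio θ n 1 w ^ 2 + l / w| ≤ K ∧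
      |ewensRatio θ n 3 w - 3 * ewensRatio θ n 1 w * ewensRatio θ n 2 w +
        2 * ewensRatio θ n 1 w ^ 3| ≤ K + K * l := by
  obtain ⟨K, hK0, hK⟩ := h.exists_ewensRatio_bound hθ hr htech (Real.exp_pos (-M))
    (Real.exp_le_exp.2 (by linarith : -M ≤ M))
  refine ⟨K, hK0, ?_⟩
  obtain ⟨X, hX⟩ := eventually_atTop.1 ((h.tendsto_saddle hr).eventually
    (hK.and (h.tendsto_momR_zero.eventually_ge_atTop 1)))
  filter_upwards [eventually_gt_atTop 0,
    (tendsto_natCast_atTop_atTop (R := ℝ)).eventually_ge_atTop (X / Real.exp (-M))]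
    with n hn hnX
  refine ⟨hn, ?_⟩
  intro s hs m l w hm' hl' hw'
  obtain ⟨hs1, hs2⟩ := abs_lt.1 hs
  have hn0 : (0 : ℝ) < n := by exact_mod_cast hn
  have hx0 : 0 < Real.exp s * n := by positivity
  have hxX : X ≤ Real.exp s * n := by
    rw [div_le_iff₀ (Real.exp_pos _)] at hnX
    calc X ≤ n * Real.exp (-M) := hnX
      _ ≤ n * Real.exp s := by gcongr
      _ = _ := mul_comm _ _
  obtain ⟨hb, hm⟩ := hX _ hxX
  have hI := saddle_mem_Ioo hr hx0
  have h2 := h.momR_pos hI 2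
  obtain ⟨c1, c2, c3, c4⟩ := hb (Real.exp (-s)) (Real.exp_le_exp.2 (by linarith))
    (Real.exp_le_exp.2 (by linarith)) n (by
      rw [(hr _ hx0).2, ← mul_assoc, ← Real.exp_add]; simp)
  rw [← hw', ← hm'] at c2
  rw [← hw'] at c1 c3 c4
  rw [← hm'] at hm
  rw [mul_comm w, ← div_div, ← hl'] at c3
  rw [← hl'] at c4
  refine ⟨hm, ?_, ?_, c1, c2, c3, c4⟩
  · rw [hl']
    positivity
  · rw [hl', hm']
    exact h.posSeries.sq_div_le (Set.Ioo_subset_Ico_self hI) h2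

end IsLogAdmissible

/-- **Proposition 3.4.** Let `g = g_θ` be log-admissible, `r_x` the unique
solution of `a(r) = x`, satisfying the technical condition (*), and fix `M > 0`.
Then for every `-M < s < M`,
`log 𝔼[exp(-s K_{0n})] = -g(r_n)(1+o(1)) s + (g(r_n) + n η₁(n))(1+o(1)) s²/2
+ O(ξ(n) s³)` where `ξ(n) = sup_{x ∈ [e^{-M}n, e^{M}n]} (g(r_x) + x|η₁(x)|)`
and `η₁(x) = -x r_x'/r_x`. -/
theorem expansion_log_laplace
    (θ : ℕ → ℝ) (hθ : ∀ j, 0 ≤ θ j) (ρ : ℝ) (a b δ : ℝ → ℝ)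
    (hadm : IsLogAdmissible (gThetaC θ) (thetaCoeff θ) ρ a b δ)
    (ha : ∀ t ∈ Set.Ico (0 : ℝ) ρ, a t = t * deriv (gThetaR θ) t)
    (r : ℝ → ℝ) (hr : ∀ x > 0, r x ∈ Set.Ico 0 ρ ∧ a (r x) = x)
    (hru : ∀ x > 0, ∀ y ∈ Set.Ico (0 : ℝ) ρ, a y = x → y = r x)
    (htech : TechCond r) (M : ℝ) (hM : 0 < M) :
    ∃ C > 0, ∃ e₁ e₂ : ℕ → ℝ, Tendsto e₁ atTop (𝓝 0) ∧ Tendsto e₂ atTop (𝓝 0) ∧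
      ∀ᶠ n : ℕ in atTop, ∀ s : ℝ, -M < s → s < M →
        |Real.log (ewensExpect θ n fun σ => Real.exp (-s * (numCycles n σ : ℝ))) -
            (-(gThetaR θ (r n)) * (1 + e₁ n) * s +
              (gThetaR θ (r n) + (n : ℝ) * (-(n : ℝ) * deriv r n / r n)) *
                (1 + e₂ n) * s ^ 2 / 2)| ≤
          C * sSup ((fun x : ℝ => gThetaR θ (r x) + x * |(-x * deriv r x / r x)|) ''
              Set.Icc (Real.exp (-M) * n) (Real.exp M * n)) * |s| ^ 3 := by
  have h := hadm.momR_of_gTheta ha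
  have hr' : ∀ x > 0, r x ∈ Set.Ico 0 ρ ∧ momR (thetaCoeff θ) 1 (r x) = x := fun x hx => by
    obtain ⟨hI, hx'⟩ := hr x hx
    refine ⟨hI, ?_⟩
    rw [← hadm.posSeries.mul_deriv_momR_zero hI, ← gThetaR_eq_momR, ← ha _ hI, hx']
  obtain ⟨K, hK0, hK⟩ := h.exists_ewensRatio_saddle_bound hθ hr' htech hM
  have htend : Tendsto (fun n : ℕ => r n) atTop (𝓝[<] ρ) :=
    (h.tendsto_saddle hr').comp tendsto_natCast_atTop_atTop
  obtain ⟨W, hW⟩ : ∃ W, W = Real.exp M := ⟨_, rfl⟩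
  have hW0 : 0 < W := hW ▸ Real.exp_pos M
  set V : ℕ → ℝ := fun n => momR (thetaCoeff θ) 0 (r n) -
    momR (thetaCoeff θ) 1 (r n) ^ 2 / momR (thetaCoeff θ) 2 (r n) with hV
  have hg : Tendsto (fun n : ℕ => momR (thetaCoeff θ) 0 (r n)) atTop atTop :=
    h.tendsto_momR_zero.comp htend
  have hVt : Tendsto V atTop atTop := h.tendsto_variance.comp htend
  refine ⟨W * (1 + K) + 3 * W ^ 2 * (W + K) + W ^ 3 * (2 * K), by positivity,
    fun n => ewensRatio θ n 1 1 / momR (thetaCoeff θ) 0 (r n) - 1,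
    fun n => (ewensRatio θ n 1 1 + (ewensRatio θ n 2 1 - ewensRatio θ n 1 1 ^ 2)) / V n - 1,
    ?_, ?_, ?_⟩
  · refine squeeze_zero_norm' ?_ (hg.const_div_atTop K)
    filter_upwards [hK, hg.eventually_gt_atTop 0] with n hn hg0
    obtain ⟨-, -, -, -, h1, -⟩ := hn.2 0 (by simpa using hM) _ _ _ rfl rfl rfl
    simp only [neg_zero, Real.exp_zero, one_mul] at h1
    rw [div_sub_one hg0.ne', norm_div, Real.norm_eq_abs, Real.norm_of_nonneg hg0.le]
    gcongr
  · refine squeeze_zero_norm' ?_ (hVt.const_div_atTop (2 * K))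
    filter_upwards [hK, hVt.eventually_gt_atTop 0] with n hn hV0
    obtain ⟨-, -, -, -, h1, h2, -⟩ := hn.2 0 (by simpa using hM) _ _ _ rfl rfl rfl
    simp only [neg_zero, Real.exp_zero, one_mul, div_one] at h1 h2
    rw [div_sub_one hV0.ne', norm_div, Real.norm_eq_abs, Real.norm_of_nonneg hV0.le]
    gcongr
    rw [abs_le] at h1 h2 ⊢
    simp only [hV]
    constructor <;> linarith [h1.1, h1.2, h2.1, h2.2]
  · filter_upwards [hK, hg.eventually_gt_atTop 0, hVt.eventually_gt_atTop 0]
      with n hn hg0 hV0 s hs1 hs2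
    obtain ⟨hn0, hn⟩ := hn
    have hn0' : (0 : ℝ) < n := by exact_mod_cast hn0
    have hs : |s| < M := abs_lt.2 ⟨hs1, hs2⟩
    have hpos : ∀ u, |u| < M → 0 < (ewensPoly θ n).eval (Real.exp (-u)) := fun u hu =>
      (hn u hu _ _ _ rfl rfl rfl).2.2.2.1
    obtain ⟨ξ, hξ⟩ : ∃ ξ, ξ = sSup ((fun x : ℝ => gThetaR θ (r x) +
      x * |(-x * deriv r x / r x)|) '' Set.Icc (Real.exp (-M) * n) (Real.exp M * n)) := ⟨_, rfl⟩
    have hξle : ∀ u, |u| < M → momR (thetaCoeff θ) 0 (r (Real.exp u * n)) ≤ ξ := fun u hu => by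
      obtain ⟨hu1, hu2⟩ := abs_lt.1 hu
      rw [hξ]
      refine h.momR_zero_le_sSup hr' (by positivity) ⟨?_, ?_⟩ <;> gcongr
    have hξ0 : 0 ≤ ξ := by
      refine le_trans ?_ (hξle 0 (by simpa using hM))
      simpa using hg0.le
    rw [log_ewensExpect_exp (hpos s hs) (hpos 0 (by simpa using hM)), ← hξ, gThetaR_eq_momR,
      h.mul_deriv_saddle_div hr' hn0']
    have key := abs_sub_taylor_two_le
      (K := (W * (1 + K) + 3 * W ^ 2 * (W + K) + W ^ 3 * (2 * K)) * ξ) (by positivity)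
      (fun u hu => (hasDerivAt_log_ewensPoly (hpos u hu).ne').1)
      (fun u hu => (hasDerivAt_log_ewensPoly (hpos u hu).ne').2.1)
      (fun u hu => (hasDerivAt_log_ewensPoly (hpos u hu).ne').2.2) (fun u hu => ?_) hs
    · refine le_of_eq_of_le ?_ key
      simp only [neg_zero, Real.exp_zero, one_mul, one_pow]
      congr 3
      · rw [add_sub_cancel]
        field_simp
      · rw [add_sub_cancel, ← sub_eq_add_neg, mul_div_cancel₀ _ hV0.ne']
    · obtain ⟨w, hw⟩ : ∃ w, w = Real.exp (-u) := ⟨_, rfl⟩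
      obtain ⟨m, hm⟩ : ∃ m, m = momR (thetaCoeff θ) 0 (r (Real.exp u * n)) := ⟨_, rfl⟩
      obtain ⟨hm1, hl0, hlm, -, b1, b2, b3⟩ := hn u hu m _ w hm rfl hw
      have hmξ : m ≤ ξ := hm ▸ hξle u hu
      obtain ⟨hu1, hu2⟩ := abs_lt.1 hu
      have hw0 : 0 < w := hw ▸ Real.exp_pos _
      have hwW : w ≤ W := by
        rw [hw, hW]; exact Real.exp_le_exp.2 (by linarith)
      have hwW' : 1 / w ≤ W := by
        rw [hw, hW, one_div, ← Real.exp_neg]; exact Real.exp_le_exp.2 (by linarith)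
      rw [← hw]
      generalize momR (thetaCoeff θ) 1 (r (Real.exp u * n)) ^ 2 /
        momR (thetaCoeff θ) 2 (r (Real.exp u * n)) = l at *
      generalize ewensRatio θ n 3 w - 3 * ewensRatio θ n 1 w * ewensRatio θ n 2 w +
        2 * ewensRatio θ n 1 w ^ 3 = k₃ at *
      generalize ewensRatio θ n 2 w - ewensRatio θ n 1 w ^ 2 = k₂ at *
      generalize ewensRatio θ n 1 w = k₁ at *
      have hk₁ : |k₁| ≤ (1 + K) * m := by
        have := abs_sub_abs_le_abs_sub k₁ m
        rw [abs_of_pos (by linarith : 0 < m)] at this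
        nlinarith
      have hk₂ : |k₂| ≤ (W + K) * m := by
        have h1 := abs_sub_abs_le_abs_sub k₂ (-(l / w))
        rw [sub_neg_eq_add, abs_neg, abs_of_nonneg (by positivity : 0 ≤ l / w)] at h1
        have h2 : l / w ≤ W * m := by
          calc l / w = 1 / w * l := by ring
            _ ≤ W * m := by gcongr
        nlinarith
      have hk₃ : |k₃| ≤ 2 * K * m := by nlinarith
      calc |-(w * k₁ + 3 * w ^ 2 * k₂ + w ^ 3 * k₃)|
          ≤ w * |k₁| + 3 * w ^ 2 * |k₂| + w ^ 3 * |k₃| := by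
            rw [abs_neg]
            refine (abs_add_three _ _ _).trans (le_of_eq ?_)
            simp only [abs_mul, abs_pow, abs_of_pos hw0, Nat.abs_ofNat]
        _ ≤ W * ((1 + K) * m) + 3 * W ^ 2 * ((W + K) * m) + W ^ 3 * (2 * K * m) := by gcongr
        _ = (W * (1 + K) + 3 * W ^ 2 * (W + K) + W ^ 3 * (2 * K)) * m := by ring
        _ ≤ _ := by gcongr
end
end
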